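/- Assume the inverse temperature sequence (β_N)_{N≥1} with β_N ∈ (0,1) satisfies lim_{N→∞} β_N = 1 and lim_{N→∞} N^{1/3}(1 − β_N²) = c where c ∈ (0,∞) or c = ∞. Define ν(β) = −(1/2)·ln(1 − β²) − β²/2 for β < 1, and let W_N = (F_N(β_N) − E F_N(β_N))/√(ν(β_N)). Then there exists a finite constant L (depending on the sequence (β_N)) such that for all N ≥ 1, d_TV(W_N, g) ≤ (L/√(ν(β_N)))·(N^{1/3}(1 − β_N²))^{−3/4}, where g is a standard Gaussian random variable and d_TV(X,Y) = sup_A |P(X ∈ A) − P(Y ∈ A)| is the total variation distance. -/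

import Mathlib

open MeasureTheory ProbabilityTheory Real Finset Filter

noncomputable section

/-- Spin configurations: each of the `N` sites carries a `±1` spin, encoded by a `Bool`. -/
abbrev Config (N : ℕ) := Fin N → Bool

/-- The `±1` value of a spin. -/
def spin (b : Bool) : ℝ := if b then 1 else -1

/-- The value of the last spin `σ_N` (junk value `0` when `N = 0`). -/
def spinLast {N : ℕ} (σ : Config N) : ℝ :=
  if h : 0 < N then spin (σ ⟨N - 1, Nat.sub_lt h Nat.one_pos⟩) else 0

/-- The Gaussian disorder: i.i.d. standard Gaussians indexed by pairs `(i, j)`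
(only the entries with `i < j` are used). -/
def gaussPi (N : ℕ) : Measure (Fin N × Fin N → ℝ) :=
  Measure.pi fun _ => gaussianReal 0 1

instance (N : ℕ) : IsProbabilityMeasure (gaussPi N) := by
  unfold gaussPi; infer_instance

/-- Three independent copies `g, g', g''` of the disorder. -/
def disM3 (N : ℕ) :
    Measure ((Fin N × Fin N → ℝ) × (Fin N × Fin N → ℝ) × (Fin N × Fin N → ℝ)) :=
  (gaussPi N).prod ((gaussPi N).prod (gaussPi N))

/-- The SK Hamiltonian `H_{N,β}(σ) = (β/√N) ∑_{i<j} g_{ij} σ_i σ_j`. -/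
def ham (N : ℕ) (β : ℝ) (g : Fin N × Fin N → ℝ) (σ : Config N) : ℝ :=
  (β / Real.sqrt N) *
    ∑ p ∈ Finset.univ.filter (fun p : Fin N × Fin N => p.1 < p.2),
      g p * spin (σ p.1) * spin (σ p.2)

/-- The cavity Hamiltonian `H⁻_N(σ) = (β/√N) ∑_{i<j<N} g_{ij} σ_i σ_j` on the first
`N - 1` spins. -/
def hamCav (N : ℕ) (β : ℝ) (g : Fin N × Fin N → ℝ) (σ : Config N) : ℝ :=
  (β / Real.sqrt N) *
    ∑ p ∈ Finset.univ.filter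
        (fun p : Fin N × Fin N => p.1 < p.2 ∧ (p.2 : ℕ) < N - 1),
      g p * spin (σ p.1) * spin (σ p.2)

/-- The overlap `R(σ¹,σ²) = (1/N) ∑_{i ≤ N} σ_i¹ σ_i²`. -/
def ovlp (N : ℕ) (σ τ : Config N) : ℝ := (∑ i, spin (σ i) * spin (τ i)) / N

/-- The truncated overlap `R⁻(σ¹,σ²) = (1/N) ∑_{i ≤ N−1} σ_i¹ σ_i²`. -/
def ovlpm (N : ℕ) (σ τ : Config N) : ℝ :=
  (∑ i ∈ Finset.univ.filter (fun i : Fin N => (i : ℕ) < N - 1),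
    spin (σ i) * spin (τ i)) / N

/-- The partition function `Z_N(β)`. -/
def partFun (N : ℕ) (β : ℝ) (g : Fin N × Fin N → ℝ) : ℝ :=
  ∑ σ : Config N, Real.exp (ham N β g σ)

/-- The free energy `F_N(β) = ln Z_N(β)`. -/
def freeEnergy (N : ℕ) (β : ℝ) (g : Fin N × Fin N → ℝ) : ℝ :=
  Real.log (partFun N β g)

/-- Two-replica Gibbs average `⟨f⟩` for the single SK system. -/
def gibbs2 (N : ℕ) (β : ℝ) (g : Fin N × Fin N → ℝ)
    (f : Config N → Config N → ℝ) : ℝ :=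
  (∑ σ : Config N, ∑ τ : Config N,
    f σ τ * Real.exp (ham N β g σ + ham N β g τ)) / (partFun N β g) ^ 2

/-- Disorder expectation of the two-replica Gibbs average. -/
def Egibbs2 (N : ℕ) (β : ℝ) (f : Config N → Config N → ℝ) : ℝ :=
  ∫ g, gibbs2 N β g f ∂gaussPi N

/-- The interpolated Hamiltonian `√t · H_N + √(1−t) · H'_N`. -/
def hamT (N : ℕ) (β t : ℝ) (g g' : Fin N × Fin N → ℝ) (σ : Config N) : ℝ :=
  Real.sqrt t * ham N β g σ + Real.sqrt (1 - t) * ham N β g' σ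

/-- The coupled Gibbs weight `exp(H¹_{N,t}(σ) + H²_{N,t}(τ))`. -/
def wT (N : ℕ) (β t : ℝ) (g g' g'' : Fin N × Fin N → ℝ)
    (ρ : Config N × Config N) : ℝ :=
  Real.exp (hamT N β t g g' ρ.1 + hamT N β t g g'' ρ.2)

/-- The coupled Gibbs average `⟨f⟩_t` of a function of one pair `(σ, τ)`. -/
def gibbsT (N : ℕ) (β t : ℝ) (g g' g'' : Fin N × Fin N → ℝ)
    (f : Config N × Config N → ℝ) : ℝ :=
  (∑ ρ : Config N × Config N, f ρ * wT N β t g g' g'' ρ) /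
    (∑ ρ : Config N × Config N, wT N β t g g' g'' ρ)

/-- The coupled Gibbs average `⟨f⟩_t` of a function of two pairs. -/
def gibbsT2 (N : ℕ) (β t : ℝ) (g g' g'' : Fin N × Fin N → ℝ)
    (f : Config N × Config N → Config N × Config N → ℝ) : ℝ :=
  (∑ ρ₁ : Config N × Config N, ∑ ρ₂ : Config N × Config N,
    f ρ₁ ρ₂ * wT N β t g g' g'' ρ₁ * wT N β t g g' g'' ρ₂) /
    (∑ ρ : Config N × Config N, wT N β t g g' g'' ρ) ^ 2

/-- Disorder expectation `E⟨f⟩_t` (one pair). -/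
def EgibbsT (N : ℕ) (β t : ℝ) (f : Config N × Config N → ℝ) : ℝ :=
  ∫ ω, gibbsT N β t ω.1 ω.2.1 ω.2.2 f ∂disM3 N

/-- Disorder expectation `E⟨f⟩_t` (two pairs). -/
def EgibbsT2 (N : ℕ) (β t : ℝ)
    (f : Config N × Config N → Config N × Config N → ℝ) : ℝ :=
  ∫ ω, gibbsT2 N β t ω.1 ω.2.1 ω.2.2 f ∂disM3 N

/-- The `s`-dependent cavity field term
`(β/√N) σ_N ∑_{i<N} (√t g_{iN} + √(1−t) g'_{iN}) σ_i`. -/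
def cavField (N : ℕ) (β t : ℝ) (g g' : Fin N × Fin N → ℝ) (σ : Config N) : ℝ :=
  if h : 0 < N then
    (β / Real.sqrt N) * spin (σ ⟨N - 1, Nat.sub_lt h Nat.one_pos⟩) *
      ∑ i ∈ Finset.univ.filter (fun i : Fin N => (i : ℕ) < N - 1),
        (Real.sqrt t * g (i, ⟨N - 1, Nat.sub_lt h Nat.one_pos⟩) +
          Real.sqrt (1 - t) * g' (i, ⟨N - 1, Nat.sub_lt h Nat.one_pos⟩)) * spin (σ i)
  else 0

/-- The cavity-interpolated Hamiltonian `H^1_{N,t,s}` (resp. `H^2_{N,t,s}` with `g''`). -/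
def hamTS (N : ℕ) (β t s : ℝ) (g g' : Fin N × Fin N → ℝ) (σ : Config N) : ℝ :=
  Real.sqrt t * hamCav N β g σ + Real.sqrt (1 - t) * hamCav N β g' σ +
    Real.sqrt s * cavField N β t g g' σ

/-- The coupled cavity Gibbs weight `exp(H¹_{N,t,s}(σ) + H²_{N,t,s}(τ))`. -/
def wTS (N : ℕ) (β t s : ℝ) (g g' g'' : Fin N × Fin N → ℝ)
    (ρ : Config N × Config N) : ℝ :=
  Real.exp (hamTS N β t s g g' ρ.1 + hamTS N β t s g g'' ρ.2)

/-- The coupled cavity Gibbs average `⟨f⟩_{t,s}` of a function of one pair. -/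
def gibbsTS1 (N : ℕ) (β t s : ℝ) (g g' g'' : Fin N × Fin N → ℝ)
    (f : Config N × Config N → ℝ) : ℝ :=
  (∑ ρ : Config N × Config N, f ρ * wTS N β t s g g' g'' ρ) /
    (∑ ρ : Config N × Config N, wTS N β t s g g' g'' ρ)

/-- The coupled cavity Gibbs average `⟨f⟩_{t,s}` of a function of two pairs. -/
def gibbsTS2 (N : ℕ) (β t s : ℝ) (g g' g'' : Fin N × Fin N → ℝ)
    (f : Config N × Config N → Config N × Config N → ℝ) : ℝ :=
  (∑ ρ₁ : Config N × Config N, ∑ ρ₂ : Config N × Config N,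
    f ρ₁ ρ₂ * wTS N β t s g g' g'' ρ₁ * wTS N β t s g g' g'' ρ₂) /
    (∑ ρ : Config N × Config N, wTS N β t s g g' g'' ρ) ^ 2

/-- The coupled cavity Gibbs average `⟨f⟩_{t,s}` of a function of `n` pairs. -/
def gibbsTSn (N : ℕ) (β t s : ℝ) (g g' g'' : Fin N × Fin N → ℝ) {n : ℕ}
    (f : (Fin n → Config N × Config N) → ℝ) : ℝ :=
  (∑ ρ : Fin n → Config N × Config N, f ρ * ∏ l, wTS N β t s g g' g'' (ρ l)) /
    (∑ ρ₀ : Config N × Config N, wTS N β t s g g' g'' ρ₀) ^ n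

/-- Disorder expectation `E⟨f⟩_{t,s}` (one pair). -/
def EgibbsTS1 (N : ℕ) (β t s : ℝ) (f : Config N × Config N → ℝ) : ℝ :=
  ∫ ω, gibbsTS1 N β t s ω.1 ω.2.1 ω.2.2 f ∂disM3 N

/-- Disorder expectation `E⟨f⟩_{t,s}` (two pairs). -/
def EgibbsTS2 (N : ℕ) (β t s : ℝ)
    (f : Config N × Config N → Config N × Config N → ℝ) : ℝ :=
  ∫ ω, gibbsTS2 N β t s ω.1 ω.2.1 ω.2.2 f ∂disM3 N

/-- Disorder expectation `E⟨f⟩_{t,s}` (`n` pairs). -/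
def EgibbsTSn (N : ℕ) (β t s : ℝ) {n : ℕ}
    (f : (Fin n → Config N × Config N) → ℝ) : ℝ :=
  ∫ ω, gibbsTSn N β t s ω.1 ω.2.1 ω.2.2 f ∂disM3 N

/-- The covariance kernel `U(ρ, ρ')` of the `s`-part of the coupled cavity Hamiltonians. -/
def Ufun (N : ℕ) (β t : ℝ) (ρ ρ' : Config N × Config N) : ℝ :=
  β ^ 2 / 2 * (spinLast ρ.1 * spinLast ρ'.1 * ovlpm N ρ.1 ρ'.1 +
      spinLast ρ.2 * spinLast ρ'.2 * ovlpm N ρ.2 ρ'.2) +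
    β ^ 2 * t / 2 * (spinLast ρ.1 * spinLast ρ'.2 * ovlpm N ρ.1 ρ'.2 +
      spinLast ρ.2 * spinLast ρ'.1 * ovlpm N ρ.2 ρ'.1)

/-- `ν(β) = −(1/2)·ln(1 − β²) − β²/2`. -/
def nuSK (b : ℝ) : ℝ := -(1 / 2) * Real.log (1 - b ^ 2) - b ^ 2 / 2

set_option linter.unusedSectionVars false

/-- The standard Gaussian measure on `E → ℝ`. -/
abbrev stdG (E : Type*) [Fintype E] : Measure (E → ℝ) :=
  Measure.pi fun _ => gaussianReal 0 1

section GaussianIBP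

lemma integrable_id_gaussianReal : Integrable (fun t : ℝ => t) (gaussianReal 0 1) :=
  (memLp_id_gaussianReal (μ := 0) (v := 1) 1).integrable (by simp)

lemma integral_gaussianReal_mul_eq_deriv {Φ Φ' : ℝ → ℝ} {C : ℝ}
    (hd : ∀ t, HasDerivAt Φ (Φ' t) t) (hb : ∀ t, |Φ t| ≤ C) (hb' : ∀ t, |Φ' t| ≤ C) :
    ∫ t, t * Φ t ∂gaussianReal 0 1 = ∫ t, Φ' t ∂gaussianReal 0 1 := by
  have hΦc : Continuous Φ := continuous_iff_continuousAt.2 fun t => (hd t).continuousAt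
  have hΦ'm : Measurable Φ' := by
    have : Φ' = deriv Φ := by ext t; exact (hd t).deriv.symm
    rw [this]; exact measurable_deriv Φ
  have hpd : ∀ t, HasDerivAt (gaussianPDFReal 0 1) (-(t * gaussianPDFReal 0 1 t)) t := by
    intro t
    rw [gaussianPDFReal_def]
    have h1 : HasDerivAt (fun x : ℝ => -(x - 0) ^ 2 / (2 * ((1 : NNReal) : ℝ))) (-t) t := by
      refine (((((hasDerivAt_id t).sub_const 0).pow 2).neg).div_const
        (2 * ((1 : NNReal) : ℝ))).congr_deriv ?_
      simp
      ring
    refine ((h1.exp).const_mul (√(2 * π * ((1 : NNReal) : ℝ)))⁻¹).congr_deriv ?_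
    ring
  have hpi : Integrable (gaussianPDFReal 0 1) := integrable_gaussianPDFReal 0 1
  have hti : Integrable (fun t => t * gaussianPDFReal 0 1 t) := by
    have := integrable_id_gaussianReal
    rw [gaussianReal_of_var_ne_zero 0 one_ne_zero,
      integrable_withDensity_iff (measurable_gaussianPDF 0 1)
        (ae_of_all _ fun x => gaussianPDF_lt_top)] at this
    simpa [toReal_gaussianPDF] using this
  rw [integral_gaussianReal_eq_integral_smul one_ne_zero,
    integral_gaussianReal_eq_integral_smul one_ne_zero]
  have key := integral_mul_deriv_eq_deriv_mul_of_integrable (u := Φ) (u' := Φ')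
    (v := gaussianPDFReal 0 1) (v' := fun t => -(t * gaussianPDFReal 0 1 t)) (fun t _ => hd t)
    (fun t _ => hpd t) ?_ ?_ ?_
  · simp only [smul_eq_mul]
    have e1 : ∀ t, gaussianPDFReal 0 1 t * (t * Φ t) = -(Φ t * -(t * gaussianPDFReal 0 1 t)) := by
      intro t; ring
    simp_rw [e1]
    rw [integral_neg, key, neg_neg]
    congr 1; ext t; ring
  · exact (hti.neg).bdd_mul hΦc.aestronglyMeasurable (ae_of_all _ hb)
  · exact hpi.bdd_mul hΦ'm.aestronglyMeasurable (ae_of_all _ hb')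
  · exact hpi.bdd_mul hΦc.aestronglyMeasurable (ae_of_all _ hb)

variable {E : Type*} [Fintype E]

lemma integrable_eval_stdG (e : E) : Integrable (fun g : E → ℝ => g e) (stdG E) :=
  (measurePreserving_eval (fun _ : E => gaussianReal 0 1) e).integrable_comp_of_integrable
    integrable_id_gaussianReal

variable [DecidableEq E]

lemma measurePreserving_update (e : E) :
    MeasurePreserving (fun p : (E → ℝ) × ℝ => Function.update p.1 e p.2)
      ((stdG E).prod (gaussianReal 0 1)) (stdG E) := by
  have hm : Measurable (fun p : (E → ℝ) × ℝ => Function.update p.1 e p.2) := by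
    refine measurable_pi_lambda _ fun i => ?_
    by_cases h : i = e
    · subst h; simpa using measurable_snd
    · simp only [Function.update_of_ne h]
      exact (measurable_pi_apply i).comp measurable_fst
  refine ⟨hm, ?_⟩
  refine (Measure.pi_eq fun s hs => ?_).symm
  rw [Measure.map_apply hm (MeasurableSet.univ_pi hs)]
  have : (fun p : (E → ℝ) × ℝ => Function.update p.1 e p.2) ⁻¹' (Set.univ.pi s) =
      (Set.univ.pi (Function.update s e Set.univ)) ×ˢ s e := by
    ext ⟨x, t⟩
    simp only [Set.mem_preimage, Set.mem_pi, Set.mem_univ, true_imp_iff, Set.mem_prod]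
    constructor
    · intro h
      refine ⟨fun i => ?_, by simpa using h e⟩
      by_cases hi : i = e
      · subst hi; simp
      · simpa [Function.update_of_ne hi] using h i
    · rintro ⟨h, ht⟩ i
      by_cases hi : i = e
      · subst hi; simpa
      · simpa [Function.update_of_ne hi] using h i
  rw [this, Measure.prod_prod, Measure.pi_pi]
  rw [← Finset.mul_prod_erase univ _ (mem_univ e), ← Finset.mul_prod_erase univ _ (mem_univ e)]
  simp only [Function.update_self, measure_univ, one_mul]
  rw [mul_comm]
  congr 1
  refine Finset.prod_congr rfl fun i hi => ?_
  rw [Function.update_of_ne (Finset.ne_of_mem_erase hi)]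

lemma integral_stdG_update (e : E) {f : (E → ℝ) → ℝ} (hf : Integrable f (stdG E)) :
    ∫ g, f g ∂stdG E = ∫ g, ∫ t, f (Function.update g e t) ∂gaussianReal 0 1 ∂stdG E := by
  have hmp := measurePreserving_update e
  have h2 := hmp.integrable_comp_of_integrable hf
  have h3 := integral_prod _ h2
  simp only [Function.comp_def] at h3
  rw [← h3]
  conv_lhs => rw [← hmp.map_eq]
  rw [integral_map hmp.measurable.aemeasurable (by rw [hmp.map_eq]; exact hf.aestronglyMeasurable)]

lemma integral_stdG_mul_eq_deriv (e : E) {Φ Φ' : (E → ℝ) → ℝ} {C : ℝ}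
    (hΦ : Measurable Φ) (hΦ' : Measurable Φ')
    (hd : ∀ g t, HasDerivAt (fun s => Φ (Function.update g e s)) (Φ' (Function.update g e t)) t)
    (hb : ∀ t, |Φ t| ≤ C) (hb' : ∀ t, |Φ' t| ≤ C) :
    ∫ g, g e * Φ g ∂stdG E = ∫ g, Φ' g ∂stdG E := by
  have hi1 : Integrable (fun g : E → ℝ => g e * Φ g) (stdG E) :=
    (integrable_eval_stdG e).mul_bdd (c := C) hΦ.aestronglyMeasurable (ae_of_all _ hb)
  have hi2 : Integrable Φ' (stdG E) :=
    Integrable.of_bound hΦ'.aestronglyMeasurable C (ae_of_all _ hb')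
  rw [integral_stdG_update e hi1, integral_stdG_update e hi2]
  congr 1; ext g
  simp only [Function.update_self]
  exact integral_gaussianReal_mul_eq_deriv (hd g) (fun t => hb _) (fun t => hb' _)

end GaussianIBP

section Replicas

variable {ι S E : Type*} [Fintype ι] [DecidableEq ι] [Fintype S]

/-- The Gibbs weights `e^{h(s)} / ∑ e^{h}`. -/
def softmax (h : S → ℝ) (s : S) : ℝ := exp (h s) / ∑ s', exp (h s')

lemma sum_exp_pos [Nonempty S] (h : S → ℝ) : 0 < ∑ s, exp (h s) :=
  Finset.sum_pos (fun _ _ => exp_pos _) univ_nonempty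

lemma softmax_nonneg (h : S → ℝ) (s : S) : 0 ≤ softmax h s :=
  div_nonneg (exp_pos _).le (Finset.sum_nonneg fun _ _ => (exp_pos _).le)

lemma sum_softmax [Nonempty S] (h : S → ℝ) : ∑ s, softmax h s = 1 := by
  unfold softmax
  rw [← Finset.sum_div, div_self (sum_exp_pos h).ne']

lemma softmax_eq_exp [Nonempty S] (h : S → ℝ) (s : S) :
    softmax h s = exp (h s - log (∑ s', exp (h s'))) := by
  rw [exp_sub, exp_log (sum_exp_pos h), softmax]

/-- The average of `f` over independent replicas with law `p`. -/
def av (p : S → ℝ) (f : (ι → S) → ℝ) : ℝ := ∑ ρ : ι → S, (∏ l, p (ρ l)) * f ρ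

lemma av_add (p : S → ℝ) (f g : (ι → S) → ℝ) :
    av p (fun ρ => f ρ + g ρ) = av p f + av p g := by
  simp [av, mul_add, Finset.sum_add_distrib]

lemma av_sub (p : S → ℝ) (f g : (ι → S) → ℝ) :
    av p (fun ρ => f ρ - g ρ) = av p f - av p g := by
  simp [av, mul_sub, Finset.sum_sub_distrib]

lemma av_const_mul (p : S → ℝ) (a : ℝ) (f : (ι → S) → ℝ) :
    av p (fun ρ => a * f ρ) = a * av p f := by
  simp only [av, Finset.mul_sum]
  exact Finset.sum_congr rfl fun _ _ => by ring

lemma av_mul_const (p : S → ℝ) (a : ℝ) (f : (ι → S) → ℝ) :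
    av p (fun ρ => f ρ * a) = av p f * a := by
  simp only [av, Finset.sum_mul]
  exact Finset.sum_congr rfl fun _ _ => by ring

lemma av_sum {κ : Type*} (p : S → ℝ) (t : Finset κ) (f : κ → (ι → S) → ℝ) :
    av p (fun ρ => ∑ k ∈ t, f k ρ) = ∑ k ∈ t, av p (f k) := by
  simp only [av, Finset.mul_sum]
  exact Finset.sum_comm

lemma av_mono {p : S → ℝ} (hp : ∀ s, 0 ≤ p s) {f g : (ι → S) → ℝ} (h : ∀ ρ, f ρ ≤ g ρ) :
    av p f ≤ av p g :=
  Finset.sum_le_sum fun ρ _ =>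
    mul_le_mul_of_nonneg_left (h ρ) (Finset.prod_nonneg fun _ _ => hp _)

lemma abs_av_le {p : S → ℝ} (hp : ∀ s, 0 ≤ p s) (f : (ι → S) → ℝ) :
    |av p f| ≤ av p (fun ρ => |f ρ|) := by
  refine (Finset.abs_sum_le_sum_abs _ _).trans (Finset.sum_le_sum fun ρ _ => ?_)
  rw [abs_mul, abs_of_nonneg (Finset.prod_nonneg fun _ _ => hp _)]

lemma av_const {p : S → ℝ} (h1 : ∑ s, p s = 1) (a : ℝ) :
    av (ι := ι) p (fun _ => a) = a := by
  simp only [av, ← Finset.sum_mul]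
  rw [← Fintype.prod_sum (fun (_ : ι) s => p s)]
  simp [h1]

/-- Resampling one replica does not change the average. -/
lemma av_update {p : S → ℝ} (h1 : ∑ s, p s = 1) (q : ι) (f : (ι → S) → ℝ) :
    av p f = av p (fun ρ => ∑ s, p s * f (Function.update ρ q s)) := by
  have key : ∑ x : (ι → S) × S, (∏ l, p (x.1 l)) * p x.2 * f x.1 =
      ∑ x : (ι → S) × S, (∏ l, p (x.1 l)) * p x.2 * f (Function.update x.1 q x.2) := by
    refine Fintype.sum_equiv
      ⟨fun x => (Function.update x.1 q x.2, x.1 q), fun x => (Function.update x.1 q x.2, x.1 q),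
        fun x => by simp, fun x => by simp⟩ _ _ fun x => ?_
    simp only [Equiv.coe_fn_mk, Function.update_idem, Function.update_eq_self]
    congr 1
    rw [← Finset.mul_prod_erase univ _ (mem_univ q),
      ← Finset.mul_prod_erase univ (fun l => p (Function.update x.1 q x.2 l)) (mem_univ q)]
    have : ∏ l ∈ univ.erase q, p (Function.update x.1 q x.2 l) = ∏ l ∈ univ.erase q, p (x.1 l) :=
      Finset.prod_congr rfl fun l hl => by rw [Function.update_of_ne (Finset.ne_of_mem_erase hl)]
    rw [this]
    simp only [Function.update_self]
    ring
  rw [Fintype.sum_prod_type, Fintype.sum_prod_type] at key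
  calc av p f = ∑ ρ : ι → S, ∑ s, (∏ l, p (ρ l)) * p s * f ρ := by
        refine Finset.sum_congr rfl fun ρ _ => ?_
        rw [← Finset.sum_mul, ← Finset.mul_sum, h1, mul_one]
    _ = _ := by
        rw [key]
        refine Finset.sum_congr rfl fun ρ _ => ?_
        rw [Finset.mul_sum]
        exact Finset.sum_congr rfl fun s _ => by ring

/-- `f` does not depend on the replica `q`. -/
def Free (f : (ι → S) → ℝ) (q : ι) : Prop := ∀ ρ s, f (Function.update ρ q s) = f ρ

lemma Free.mul {f g : (ι → S) → ℝ} {q : ι} (hf : Free f q) (hg : Free g q) :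
    Free (fun ρ => f ρ * g ρ) q := fun ρ s => by simp only [hf ρ s, hg ρ s]

lemma Free.abs {f : (ι → S) → ℝ} {q : ι} (hf : Free f q) :
    Free (fun ρ => |f ρ|) q := fun ρ s => by simp only [hf ρ s]

lemma av_mul_free {p : S → ℝ} (h1 : ∑ s, p s = 1) {q : ι} {f : (ι → S) → ℝ} (hf : Free f q)
    (c : S → ℝ) : av p (fun ρ => f ρ * c (ρ q)) = av p f * ∑ s, p s * c s := by
  rw [av_update h1 q, ← av_mul_const]
  refine congrArg _ (funext fun ρ => ?_)
  rw [Finset.mul_sum]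
  refine Finset.sum_congr rfl fun s _ => ?_
  rw [hf ρ s, Function.update_self]; ring

lemma av_pair {p : S → ℝ} (h1 : ∑ s, p s = 1) {a b : ι} (hab : a ≠ b) (F : S → S → ℝ) :
    av p (fun ρ => F (ρ a) (ρ b)) = ∑ s, ∑ t, p s * p t * F s t := by
  rw [av_update h1 a, av_update h1 b]
  simp only [Function.update_self, Function.update_of_ne hab.symm]
  rw [av_const h1, Finset.sum_comm]
  refine Finset.sum_congr rfl fun s _ => ?_
  rw [Finset.mul_sum]
  exact Finset.sum_congr rfl fun t _ => by ring

lemma hasDerivAt_log_sum_exp [Nonempty S] {h : ℝ → S → ℝ} {h' : S → ℝ} {r : ℝ}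
    (hd : ∀ s, HasDerivAt (fun r => h r s) (h' s) r) :
    HasDerivAt (fun r => log (∑ s, exp (h r s))) (∑ s, softmax (h r) s * h' s) r := by
  have h1 : HasDerivAt (fun r => ∑ s, exp (h r s)) (∑ s, exp (h r s) * h' s) r :=
    HasDerivAt.fun_sum fun s _ => (hd s).exp
  refine (h1.log (sum_exp_pos _).ne').congr_deriv ?_
  rw [Finset.sum_div]
  exact Finset.sum_congr rfl fun s _ => by rw [softmax]; ring

lemma hasDerivAt_av_softmax [Nonempty S] {h : ℝ → S → ℝ} {h' : S → ℝ} {r : ℝ}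
    (hd : ∀ s, HasDerivAt (fun r => h r s) (h' s) r) {A : Finset ι} {q : ι} (hq : q ∉ A)
    {f : (ι → S) → ℝ} (hf : ∀ l ∉ A, Free f l) :
    HasDerivAt (fun r => av (softmax (h r)) f)
      (av (softmax (h r)) fun ρ => f ρ * (∑ l ∈ A, h' (ρ l) - #A * h' (ρ q))) r := by
  set m := ∑ s, softmax (h r) s * h' s with hm
  have h1 : ∀ ρ : ι → S, HasDerivAt (fun r => ∏ l, softmax (h r) (ρ l))
      ((∏ l, softmax (h r) (ρ l)) * ∑ l, (h' (ρ l) - m)) r := by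
    intro ρ
    simp only [softmax_eq_exp, ← Real.exp_sum]
    exact (HasDerivAt.fun_sum fun l _ => (hd (ρ l)).sub (hasDerivAt_log_sum_exp hd)).exp
  have h2 : HasDerivAt (fun r => av (softmax (h r)) f)
      (∑ ρ : ι → S, (∏ l, softmax (h r) (ρ l)) * (∑ l, (h' (ρ l) - m)) * f ρ) r :=
    HasDerivAt.fun_sum fun ρ _ => (h1 ρ).mul_const _
  refine h2.congr_deriv ?_
  have hs := sum_softmax (h r)
  have e0 : ∀ l ∉ A, av (softmax (h r)) (fun ρ => f ρ * (h' (ρ l) - m)) = 0 := by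
    intro l hl
    simp only [mul_sub]
    rw [av_sub, av_mul_free hs (hf l hl), av_mul_const, sub_self]
  calc _ = av (softmax (h r)) (fun ρ => ∑ l, f ρ * (h' (ρ l) - m)) := by
        refine Finset.sum_congr rfl fun ρ _ => ?_
        rw [Finset.mul_sum, Finset.mul_sum, Finset.sum_mul]
        exact Finset.sum_congr rfl fun l _ => by ring
    _ = ∑ l ∈ A, av (softmax (h r)) (fun ρ => f ρ * (h' (ρ l) - m)) := by
        rw [av_sum, ← Finset.sum_subset (Finset.subset_univ A) fun l _ hl => e0 l hl]
    _ = ∑ l ∈ A, av (softmax (h r)) (fun ρ => f ρ * (h' (ρ l) - h' (ρ q))) := by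
        refine Finset.sum_congr rfl fun l _ => ?_
        simp only [mul_sub]
        rw [av_sub, av_sub, av_mul_const, av_mul_free hs (hf q hq)]
    _ = _ := by
        rw [← av_sum]
        refine congrArg _ (funext fun ρ => ?_)
        rw [← Finset.mul_sum, Finset.sum_sub_distrib, Finset.sum_const, nsmul_eq_mul]

variable [Fintype E] [DecidableEq E]

/-- The Hamiltonian in which the couplings indexed by `J` are multiplied by `r`. -/
def cavH (c : E → S → ℝ) (J : Finset E) (r : ℝ) (g : E → ℝ) (s : S) : ℝ :=
  ∑ e, (if e ∈ J then r else 1) * (g e * c e s)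

/-- The disorder average of the replica average at cavity parameter `r`. -/
def cphi (c : E → S → ℝ) (J : Finset E) (f : (ι → S) → ℝ) (r : ℝ) : ℝ :=
  ∫ g, av (softmax (cavH c J r g)) f ∂stdG E

lemma continuous_av_softmax {X : Type*} [TopologicalSpace X] [Nonempty S] {h : X → S → ℝ}
    (hh : ∀ s, Continuous fun x => h x s) (f : (ι → S) → ℝ) :
    Continuous fun x => av (softmax (h x)) f := by
  unfold av softmax
  refine continuous_finsetSum _ fun ρ _ => (continuous_finsetProd _ fun l _ => ?_).mul
    continuous_const
  refine Continuous.div (by fun_prop) (by fun_prop) fun x => (sum_exp_pos _).ne'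

variable (c : E → S → ℝ) (J : Finset E)

lemma continuous_cavH (r : ℝ) (s : S) : Continuous fun g => cavH c J r g s := by
  unfold cavH; fun_prop

lemma exists_abs_le (f : (ι → S) → ℝ) : ∃ C, 0 ≤ C ∧ ∀ ρ, |f ρ| ≤ C :=
  ⟨∑ ρ, |f ρ|, Finset.sum_nonneg fun _ _ => abs_nonneg _, fun ρ =>
    Finset.single_le_sum (f := fun ρ => |f ρ|) (fun _ _ => abs_nonneg _) (mem_univ ρ)⟩

lemma abs_av_softmax_le [Nonempty S] (h : S → ℝ) {f : (ι → S) → ℝ} {C : ℝ}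
    (hC : ∀ ρ, |f ρ| ≤ C) : |av (softmax h) f| ≤ C :=
  (abs_av_le (softmax_nonneg h) f).trans <|
    (av_mono (softmax_nonneg h) hC).trans (av_const (sum_softmax h) C).le

lemma integrable_av_cavH [Nonempty S] (f : (ι → S) → ℝ) (r : ℝ) :
    Integrable (fun g => av (softmax (cavH c J r g)) f) (stdG E) := by
  obtain ⟨C, -, hC⟩ := exists_abs_le f
  exact Integrable.of_bound (continuous_av_softmax (continuous_cavH c J r) f).aestronglyMeasurable
    C (ae_of_all _ fun g => abs_av_softmax_le _ hC)

/-- The polynomial in the coupling coefficients produced by differentiating at `r`. -/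
def cavD (A : Finset ι) (q q' : ι) (ρ : ι → S) : ℝ :=
  ∑ e ∈ J, (∑ l ∈ A, c e (ρ l) - #A * c e (ρ q)) *
    (∑ l ∈ insert q A, c e (ρ l) - (#A + 1) * c e (ρ q'))

lemma hasDerivAt_cavH_r (g : E → ℝ) (s : S) (r : ℝ) :
    HasDerivAt (fun r => cavH c J r g s) (∑ e ∈ J, g e * c e s) r := by
  have : ∀ e, HasDerivAt (fun r : ℝ => (if e ∈ J then r else 1) * (g e * c e s))
      (if e ∈ J then g e * c e s else 0) r := by
    intro e
    by_cases h : e ∈ J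
    · simpa [h] using (hasDerivAt_id r).mul_const (g e * c e s)
    · simpa [h] using hasDerivAt_const r (g e * c e s)
  refine (HasDerivAt.fun_sum fun e _ => this e).congr_deriv ?_
  rw [Finset.sum_ite_mem, Finset.univ_inter]

lemma hasDerivAt_cavH_update (g : E → ℝ) (s : S) (r : ℝ) (e : E) (he : e ∈ J) (t : ℝ) :
    HasDerivAt (fun t => cavH c J r (Function.update g e t) s) (r * c e s) t := by
  have : ∀ e', HasDerivAt (fun t : ℝ => (if e' ∈ J then r else 1) *
      (Function.update g e t e' * c e' s)) (if e' = e then r * c e s else 0) t := by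
    intro e'
    by_cases h : e' = e
    · subst h
      simpa [he] using ((hasDerivAt_id t).mul_const (c e' s)).const_mul r
    · simp only [Function.update_of_ne h, h, if_false]
      exact hasDerivAt_const t _
  refine (HasDerivAt.fun_sum fun e _ => this e).congr_deriv ?_
  simp

lemma hasDerivAt_cphi [Nonempty S] {A : Finset ι} {q q' : ι} (hq : q ∉ A) (hq' : q' ∉ insert q A)
    {f : (ι → S) → ℝ} (hf : ∀ l ∉ A, Free f l) (r : ℝ) :
    HasDerivAt (cphi c J f) (r * cphi c J (fun ρ => f ρ * cavD c J A q q' ρ) r) r := by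
  set d : E → (ι → S) → ℝ := fun e ρ => f ρ * (∑ l ∈ A, c e (ρ l) - #A * c e (ρ q)) with hdd
  have hD : ∀ r g, HasDerivAt (fun r => av (softmax (cavH c J r g)) f)
      (∑ e ∈ J, g e * av (softmax (cavH c J r g)) (d e)) r := by
    intro r g
    refine (hasDerivAt_av_softmax (fun s => hasDerivAt_cavH_r c J g s r) hq hf).congr_deriv ?_
    simp only [← av_const_mul]
    rw [← av_sum]
    refine congrArg _ (funext fun ρ => ?_)
    simp only [hdd]
    rw [Finset.sum_comm, Finset.mul_sum, ← Finset.sum_sub_distrib, Finset.mul_sum]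
    refine Finset.sum_congr rfl fun e _ => ?_
    rw [← Finset.mul_sum]
    ring
  choose C hC0 hC using fun e => exists_abs_le (d e)
  have hb : Integrable (fun g : E → ℝ => ∑ e ∈ J, |g e| * C e) (stdG E) :=
    integrable_finsetSum _ fun e _ => ((integrable_eval_stdG e).abs.mul_const _)
  have hcont : ∀ (f : (ι → S) → ℝ) r, Continuous fun g => av (softmax (cavH c J r g)) f :=
    fun f r => continuous_av_softmax (continuous_cavH c J r) f
  have key := (hasDerivAt_integral_of_dominated_loc_of_deriv_le (μ := stdG E)
    (F := fun r g => av (softmax (cavH c J r g)) f)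
    (F' := fun r g => ∑ e ∈ J, g e * av (softmax (cavH c J r g)) (d e)) (x₀ := r)
    (s := Set.univ) Filter.univ_mem (Eventually.of_forall fun r => (hcont f r).aestronglyMeasurable)
    (integrable_av_cavH c J f r)
    (continuous_finsetSum _ fun e _ =>
      (continuous_apply e).mul (hcont (d e) r)).aestronglyMeasurable
    (ae_of_all _ fun g r _ => by
      refine (Finset.abs_sum_le_sum_abs _ _).trans (Finset.sum_le_sum fun e _ => ?_)
      rw [abs_mul]
      exact mul_le_mul_of_nonneg_left (abs_av_softmax_le _ (hC e)) (abs_nonneg _)) hb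
    (ae_of_all _ fun g r _ => hD r g)).2
  refine key.congr_deriv ?_
  rw [integral_finsetSum]
  swap
  · intro e _
    exact (integrable_eval_stdG e).mul_bdd (c := C e) (hcont (d e) r).aestronglyMeasurable
      (ae_of_all _ fun g => abs_av_softmax_le _ (hC e))
  have hfd : ∀ e, ∀ l ∉ insert q A, Free (d e) l := by
    intro e l hl ρ s
    simp only [hdd]
    rw [hf l (fun h => hl (mem_insert_of_mem h))]
    congr 2
    · refine Finset.sum_congr rfl fun i hi => ?_
      rw [Function.update_of_ne]
      rintro rfl
      exact hl (mem_insert_of_mem hi)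
    · rw [Function.update_of_ne]
      rintro rfl
      exact hl (mem_insert_self _ _)
  have hibp : ∀ e ∈ J, ∫ g, g e * av (softmax (cavH c J r g)) (d e) ∂stdG E =
      ∫ g, av (softmax (cavH c J r g)) (fun ρ => r * (d e ρ *
        (∑ l ∈ insert q A, c e (ρ l) - (#A + 1) * c e (ρ q')))) ∂stdG E := by
    intro e he
    obtain ⟨C', -, hC'⟩ := exists_abs_le (fun ρ => r * (d e ρ *
        (∑ l ∈ insert q A, c e (ρ l) - (#A + 1) * c e (ρ q'))))
    refine integral_stdG_mul_eq_deriv e (C := max (C e) C') (hcont _ r).measurable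
      (hcont _ r).measurable (fun g t => ?_)
      (fun g => (abs_av_softmax_le _ (hC e)).trans (le_max_left _ _))
      (fun g => (abs_av_softmax_le _ hC').trans (le_max_right _ _))
    refine (hasDerivAt_av_softmax (fun s => hasDerivAt_cavH_update c J g s r e he t) hq'
      (hfd e)).congr_deriv ?_
    refine congrArg _ (funext fun ρ => ?_)
    rw [← Finset.mul_sum, card_insert_of_notMem hq]
    push_cast
    ring
  rw [Finset.sum_congr rfl hibp, ← integral_finsetSum]
  swap
  · intro e _
    exact integrable_av_cavH c J _ r
  rw [cphi, ← integral_const_mul]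
  congr 1; ext g
  rw [← av_sum, ← av_const_mul]
  refine congrArg _ (funext fun ρ => ?_)
  rw [cavD, Finset.mul_sum, Finset.mul_sum]
  refine Finset.sum_congr rfl fun e _ => ?_
  simp only [hdd]
  ring

end Replicas

section CavityBounds

variable {S E : Type*} [Fintype S] [Nonempty S] [Fintype E] [DecidableEq E]

section Linear

variable {ι : Type*} [Fintype ι] [DecidableEq ι] (c : E → S → ℝ) (J : Finset E)

lemma cphi_sub (f g : (ι → S) → ℝ) (r : ℝ) :
    cphi c J (fun ρ => f ρ - g ρ) r = cphi c J f r - cphi c J g r := by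
  simp only [cphi, av_sub]
  exact integral_sub (integrable_av_cavH c J f r) (integrable_av_cavH c J g r)

lemma cphi_add (f g : (ι → S) → ℝ) (r : ℝ) :
    cphi c J (fun ρ => f ρ + g ρ) r = cphi c J f r + cphi c J g r := by
  simp only [cphi, av_add]
  exact integral_add (integrable_av_cavH c J f r) (integrable_av_cavH c J g r)

lemma cphi_const_mul (a : ℝ) (f : (ι → S) → ℝ) (r : ℝ) :
    cphi c J (fun ρ => a * f ρ) r = a * cphi c J f r := by
  simp only [cphi, av_const_mul]
  exact integral_const_mul _ _

lemma cphi_neg (f : (ι → S) → ℝ) (r : ℝ) :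
    cphi c J (fun ρ => - f ρ) r = - cphi c J f r := by
  simpa using cphi_const_mul c J (-1) f r

lemma cphi_sum {κ : Type*} (t : Finset κ) (f : κ → (ι → S) → ℝ) (r : ℝ) :
    cphi c J (fun ρ => ∑ x ∈ t, f x ρ) r = ∑ x ∈ t, cphi c J (f x) r := by
  simp only [cphi, av_sum]
  exact integral_finsetSum _ fun x _ => integrable_av_cavH c J (f x) r

variable {c J}

lemma cphi_mono {f g : (ι → S) → ℝ} (h : ∀ ρ, f ρ ≤ g ρ) (r : ℝ) :
    cphi c J f r ≤ cphi c J g r :=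
  integral_mono (integrable_av_cavH c J f r) (integrable_av_cavH c J g r)
    fun _ => av_mono (softmax_nonneg _) h

lemma abs_cphi_le (f : (ι → S) → ℝ) (r : ℝ) :
    |cphi c J f r| ≤ cphi c J (fun ρ => |f ρ|) r := by
  refine abs_le.2 ⟨?_, cphi_mono (fun ρ => le_abs_self _) r⟩
  rw [← cphi_neg]
  exact cphi_mono (fun ρ => neg_abs_le _) r

lemma cphi_nonneg {f : (ι → S) → ℝ} (h : ∀ ρ, 0 ≤ f ρ) (r : ℝ) : 0 ≤ cphi c J f r := by
  have := (abs_nonneg _).trans (abs_cphi_le (c := c) (J := J) f r)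
  simpa only [abs_of_nonneg (h _)] using this

/-- A function that changes sign under a symmetry of the `r = 0` weights, applied to one replica,
averages to zero. -/
lemma cphi_zero_of_odd {T : S → S} (hT : Function.Involutive T)
    (hc : ∀ e ∉ J, ∀ s, c e (T s) = c e s) {g : (ι → S) → ℝ} (l : ι)
    (hg : ∀ ρ, g (Function.update ρ l (T (ρ l))) = - g ρ) : cphi c J g 0 = 0 := by
  have hH : ∀ g s, cavH c J 0 g (T s) = cavH c J 0 g s := by
    intro g s
    refine Finset.sum_congr rfl fun e _ => ?_
    by_cases he : e ∈ J
    · simp [he]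
    · simp [he, hc e he s]
  have hp : ∀ g s, softmax (cavH c J 0 g) (T s) = softmax (cavH c J 0 g) s := by
    intro g s
    rw [softmax, softmax, hH]
  have : ∀ x, av (softmax (cavH c J 0 x)) g = 0 := by
    intro x
    have key : av (softmax (cavH c J 0 x)) g = - av (softmax (cavH c J 0 x)) g := by
      unfold av
      rw [← Finset.sum_neg_distrib]
      refine Fintype.sum_equiv
        ⟨fun ρ => Function.update ρ l (T (ρ l)), fun ρ => Function.update ρ l (T (ρ l)),
          fun ρ => by simp [hT (ρ l)], fun ρ => by simp [hT (ρ l)]⟩ _ _ fun ρ => ?_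
      simp only [Equiv.coe_fn_mk, hg]
      rw [mul_neg, neg_neg]
      congr 1
      refine Finset.prod_congr rfl fun i _ => ?_
      by_cases hi : i = l
      · subst hi; simp [hp]
      · rw [Function.update_of_ne hi]
    linarith
  simp [cphi, this]

end Linear

/-- The covariance kernel of the couplings indexed by `J`. -/
def cavK (c : E → S → ℝ) (J : Finset E) (s t : S) : ℝ := ∑ e ∈ J, c e s * c e t

lemma cavK_comm (c : E → S → ℝ) (J : Finset E) (s t : S) : cavK c J s t = cavK c J t s :=
  Finset.sum_congr rfl fun _ _ => mul_comm _ _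

/-- Bounds on the covariance kernel: `k` is the non-constant part of its diagonal. -/
structure CavBd (c : E → S → ℝ) (J : Finset E) (k : S → ℝ) (ω : S → S → ℝ) (ω₀ : S → ℝ) :
    Prop where
  diag : ∃ κ, ∀ s, cavK c J s s = κ + k s
  off : ∀ s t, |cavK c J s t| ≤ ω s t
  kle : ∀ s, |k s| ≤ ω₀ s
  ωle : ∀ s t, ω s t ≤ 4
  ω₀le : ∀ s, ω₀ s ≤ 4

variable {c : E → S → ℝ} {J : Finset E} {k : S → ℝ} {ω : S → S → ℝ} {ω₀ : S → ℝ}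

lemma cavD_eq {ι : Type*} [Fintype ι] [DecidableEq ι] (hK : CavBd c J k ω ω₀) {A : Finset ι}
    {q q' : ι} (hq : q ∉ A) (ρ : ι → S) :
    cavD c J A q q' ρ =
      ∑ a ∈ A, (k (ρ a) - k (ρ q)) + ∑ a ∈ A, ∑ b ∈ A.erase a, cavK c J (ρ a) (ρ b)
      + ∑ a ∈ A, cavK c J (ρ a) (ρ q) - (#A + 1) * ∑ a ∈ A, cavK c J (ρ a) (ρ q')
      - #A * ∑ a ∈ A, cavK c J (ρ q) (ρ a) + #A * (#A + 1) * cavK c J (ρ q) (ρ q') := by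
  obtain ⟨κ, hκ⟩ := hK.diag
  have h1 : ∀ a ∈ A, ∑ b ∈ A, cavK c J (ρ a) (ρ b) =
      κ + k (ρ a) + ∑ b ∈ A.erase a, cavK c J (ρ a) (ρ b) := by
    intro a ha
    rw [← Finset.add_sum_erase A _ ha, hκ]
  have h2 : ∑ a ∈ A, ∑ b ∈ A.erase a, cavK c J (ρ a) (ρ b) =
      ∑ a ∈ A, ∑ b ∈ A, cavK c J (ρ a) (ρ b) - ∑ a ∈ A, (κ + k (ρ a)) := by
    rw [← Finset.sum_sub_distrib]
    exact Finset.sum_congr rfl fun a ha => by rw [h1 a ha]; ring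
  have h3 : cavD c J A q q' ρ = ∑ a ∈ A, ∑ b ∈ A, cavK c J (ρ a) (ρ b)
      + ∑ a ∈ A, cavK c J (ρ a) (ρ q) - (#A + 1) * ∑ a ∈ A, cavK c J (ρ a) (ρ q')
      - #A * (cavK c J (ρ q) (ρ q) + ∑ a ∈ A, cavK c J (ρ q) (ρ a))
      + #A * (#A + 1) * cavK c J (ρ q) (ρ q') := by
    have e1 : ∑ a ∈ A, ∑ b ∈ A, cavK c J (ρ a) (ρ b) =
        ∑ e ∈ J, (∑ a ∈ A, c e (ρ a)) * ∑ b ∈ A, c e (ρ b) := by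
      simp only [cavK, Finset.sum_mul_sum]
      conv_rhs => rw [Finset.sum_comm]
      exact Finset.sum_congr rfl fun a _ => Finset.sum_comm
    have e2 : ∀ x, ∑ a ∈ A, cavK c J (ρ a) (ρ x) = ∑ e ∈ J, (∑ a ∈ A, c e (ρ a)) * c e (ρ x) := by
      intro x
      simp only [cavK, Finset.sum_mul]
      exact Finset.sum_comm
    have e3 : ∑ a ∈ A, cavK c J (ρ q) (ρ a) = ∑ e ∈ J, c e (ρ q) * ∑ a ∈ A, c e (ρ a) := by
      simp only [cavK, Finset.mul_sum]
      exact Finset.sum_comm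
    rw [e1, e2, e2, e3]
    unfold cavD cavK
    simp only [Finset.sum_insert hq, Finset.mul_sum (s := J), ← Finset.sum_add_distrib,
      ← Finset.sum_sub_distrib]
    exact Finset.sum_congr rfl fun e _ => by ring
  rw [h2, h3, hκ]
  simp only [Finset.sum_add_distrib, Finset.sum_sub_distrib, Finset.sum_const, nsmul_eq_mul]
  ring

lemma abs_cavD_le {ι : Type*} [Fintype ι] [DecidableEq ι] (hK : CavBd c J k ω ω₀)
    {A T : Finset ι} {q q' : ι} (hq : q ∉ A) (hq' : q' ∉ insert q A) (hT : insert q' (insert q A) ⊆ T)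
    (ρ : ι → S) {B : ℝ} (hB : ∀ a ∈ T, ∀ b ∈ T, a ≠ b → |cavK c J (ρ a) (ρ b)| ≤ B)
    (hk : ∀ a ∈ T, |k (ρ a)| ≤ B) :
    |cavD c J A q q' ρ| ≤ #A * (5 + 4 * #A) * B := by
  have hqT : q ∈ T := hT (by simp)
  have hq'T : q' ∈ T := hT (by simp)
  have hAT : ∀ a ∈ A, a ∈ T := fun a ha => hT (by simp [ha])
  have hqq : q ≠ q' := by rintro rfl; simp at hq'
  have hAq : ∀ a ∈ A, a ≠ q := by rintro a ha rfl; exact hq ha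
  have hAq' : ∀ a ∈ A, a ≠ q' := by rintro a ha rfl; exact hq' (by simp [ha])
  have hB0 : 0 ≤ B := (abs_nonneg _).trans (hk q hqT)
  have hn : (0 : ℝ) ≤ #A := Nat.cast_nonneg _
  have bd : ∀ (F : ι → ℝ) (M : ℝ), (∀ a ∈ A, |F a| ≤ M) → |∑ a ∈ A, F a| ≤ #A * M := by
    intro F M h
    refine (Finset.abs_sum_le_sum_abs _ _).trans ?_
    simpa using Finset.sum_le_card_nsmul A _ M h
  have t1 : |∑ a ∈ A, (k (ρ a) - k (ρ q))| ≤ #A * (2 * B) := bd _ _ fun a ha =>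
    (abs_sub _ _).trans (by linarith [hk a (hAT a ha), hk q hqT])
  have t2 : |∑ a ∈ A, ∑ b ∈ A.erase a, cavK c J (ρ a) (ρ b)| ≤ #A * (#A * B) := bd _ _ fun a ha => by
    refine (Finset.abs_sum_le_sum_abs _ _).trans ?_
    refine (Finset.sum_le_card_nsmul _ _ B fun b hb => hB a (hAT a ha) b
      (hAT b (Finset.mem_of_mem_erase hb)) (Finset.ne_of_mem_erase hb).symm).trans ?_
    rw [nsmul_eq_mul]
    exact mul_le_mul_of_nonneg_right (by exact_mod_cast Finset.card_erase_le) hB0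
  have t3 : |∑ a ∈ A, cavK c J (ρ a) (ρ q)| ≤ #A * B := bd _ _ fun a ha =>
    hB a (hAT a ha) q hqT (hAq a ha)
  have t4 : |∑ a ∈ A, cavK c J (ρ a) (ρ q')| ≤ #A * B := bd _ _ fun a ha =>
    hB a (hAT a ha) q' hq'T (hAq' a ha)
  have t5 : |∑ a ∈ A, cavK c J (ρ q) (ρ a)| ≤ #A * B := bd _ _ fun a ha =>
    hB q hqT a (hAT a ha) (hAq a ha).symm
  have t6 := hB q hqT q' hq'T hqq
  rw [cavD_eq hK hq]
  have u4 := mul_le_mul_of_nonneg_left t4 (by linarith : (0 : ℝ) ≤ #A + 1)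
  have u5 := mul_le_mul_of_nonneg_left t5 hn
  have u6 := mul_le_mul_of_nonneg_left t6 (by positivity : (0 : ℝ) ≤ #A * (#A + 1))
  rw [← abs_of_nonneg (by linarith : (0 : ℝ) ≤ #A + 1), ← abs_mul,
    abs_of_nonneg (by linarith : (0 : ℝ) ≤ #A + 1)] at u4
  rw [show (#A : ℝ) * |∑ a ∈ A, cavK c J (ρ q) (ρ a)| = |#A * ∑ a ∈ A, cavK c J (ρ q) (ρ a)| by
    rw [abs_mul, abs_of_nonneg hn]] at u5
  rw [show (#A : ℝ) * (#A + 1) * |cavK c J (ρ q) (ρ q')| =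
    |#A * (#A + 1) * cavK c J (ρ q) (ρ q')| by
    rw [abs_mul, abs_of_nonneg (by positivity : (0 : ℝ) ≤ #A * (#A + 1))]] at u6
  rw [abs_le] at t1 t2 t3 u4 u5 u6 ⊢
  constructor <;> nlinarith


lemma le_of_hasDerivAt_mul {φ ψ : ℝ → ℝ} {m : ℝ} (hd : ∀ r, HasDerivAt φ (r * ψ r) r)
    (hm : ∀ r ∈ Set.Icc (0 : ℝ) 1, ψ r ≤ m) {r : ℝ} (hr : r ∈ Set.Icc (0 : ℝ) 1) :
    φ r ≤ φ 0 + m * r ^ 2 / 2 := by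
  have hd' : ∀ r, HasDerivAt (fun r => φ r - m * r ^ 2 / 2) (r * ψ r - m * r) r := by
    intro r
    refine ((hd r).sub ((((hasDerivAt_id r).pow 2).const_mul m).div_const 2)).congr_deriv ?_
    simp
    ring
  have hanti : AntitoneOn (fun r => φ r - m * r ^ 2 / 2) (Set.Icc 0 1) := by
    refine antitoneOn_of_deriv_nonpos (convex_Icc 0 1)
      (fun r _ => (hd' r).continuousAt.continuousWithinAt)
      (fun r _ => (hd' r).differentiableAt.differentiableWithinAt) fun r hr => ?_
    rw [interior_Icc] at hr
    rw [(hd' r).deriv]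
    nlinarith [hm r ⟨hr.1.le, hr.2.le⟩, hr.1]
  have := hanti (Set.left_mem_Icc.2 zero_le_one) hr hr.1
  simp only at this
  linarith

/-- The first `n` replicas. -/
def rep (n : ℕ) : Finset (Fin 10) := univ.filter fun a => (a : ℕ) < n

lemma mem_rep {n : ℕ} {a : Fin 10} : a ∈ rep n ↔ (a : ℕ) < n := by simp [rep]

/-- The sum of the kernel bounds over the first eight replicas. -/
def cavW (ω : S → S → ℝ) (ω₀ : S → ℝ) (ρ : Fin 10 → S) : ℝ :=
  ∑ a ∈ rep 8, ∑ b ∈ (rep 8).erase a, ω (ρ a) (ρ b) + ∑ a ∈ rep 8, ω₀ (ρ a)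

lemma CavBd.ω_nonneg (hK : CavBd c J k ω ω₀) (s t : S) : 0 ≤ ω s t :=
  (abs_nonneg _).trans (hK.off s t)

lemma CavBd.ω₀_nonneg (hK : CavBd c J k ω ω₀) (s : S) : 0 ≤ ω₀ s :=
  (abs_nonneg _).trans (hK.kle s)

lemma CavBd.cavW_nonneg (hK : CavBd c J k ω ω₀) (ρ : Fin 10 → S) : 0 ≤ cavW ω ω₀ ρ :=
  add_nonneg (Finset.sum_nonneg fun _ _ => Finset.sum_nonneg fun _ _ => hK.ω_nonneg _ _)
    (Finset.sum_nonneg fun _ _ => hK.ω₀_nonneg _)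

lemma CavBd.ω_le_cavW (hK : CavBd c J k ω ω₀) (ρ : Fin 10 → S) {a b : Fin 10} (ha : a ∈ rep 8)
    (hb : b ∈ rep 8) (hab : a ≠ b) : ω (ρ a) (ρ b) ≤ cavW ω ω₀ ρ := by
  have h1 : ω (ρ a) (ρ b) ≤ ∑ b ∈ (rep 8).erase a, ω (ρ a) (ρ b) :=
    Finset.single_le_sum (f := fun b => ω (ρ a) (ρ b)) (fun _ _ => hK.ω_nonneg _ _)
      (Finset.mem_erase.2 ⟨hab.symm, hb⟩)
  have h2 : ∑ b ∈ (rep 8).erase a, ω (ρ a) (ρ b) ≤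
      ∑ a ∈ rep 8, ∑ b ∈ (rep 8).erase a, ω (ρ a) (ρ b) :=
    Finset.single_le_sum (f := fun a => ∑ b ∈ (rep 8).erase a, ω (ρ a) (ρ b))
      (fun _ _ => Finset.sum_nonneg fun _ _ => hK.ω_nonneg _ _) ha
  have h3 : 0 ≤ ∑ a ∈ rep 8, ω₀ (ρ a) := Finset.sum_nonneg fun _ _ => hK.ω₀_nonneg _
  unfold cavW
  linarith

lemma CavBd.ω₀_le_cavW (hK : CavBd c J k ω ω₀) (ρ : Fin 10 → S) {a : Fin 10} (ha : a ∈ rep 8) :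
    ω₀ (ρ a) ≤ cavW ω ω₀ ρ := by
  have h1 : ω₀ (ρ a) ≤ ∑ a ∈ rep 8, ω₀ (ρ a) :=
    Finset.single_le_sum (f := fun a => ω₀ (ρ a)) (fun _ _ => hK.ω₀_nonneg _) ha
  have h2 : 0 ≤ ∑ a ∈ rep 8, ∑ b ∈ (rep 8).erase a, ω (ρ a) (ρ b) :=
    Finset.sum_nonneg fun _ _ => Finset.sum_nonneg fun _ _ => hK.ω_nonneg _ _
  unfold cavW
  linarith

lemma free_cavW {q : Fin 10} (hq : q ∉ rep 8) : Free (cavW ω ω₀ : (Fin 10 → S) → ℝ) q := by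
  intro ρ s
  have h : ∀ a ∈ rep 8, Function.update ρ q s a = ρ a := by
    intro a ha
    rw [Function.update_of_ne]
    rintro rfl
    exact hq ha
  unfold cavW
  congr 1
  · refine Finset.sum_congr rfl fun a ha => Finset.sum_congr rfl fun b hb => ?_
    rw [h a ha, h b (Finset.mem_of_mem_erase hb)]
  · exact Finset.sum_congr rfl fun a ha => by rw [h a ha]

/-- Averages of nonnegative functions at `r ∈ [0,1]` are controlled by those at `r = 1`. -/
lemma cphi_le_cphi_one (hK : CavBd c J k ω ω₀) {G : (Fin 10 → S) → ℝ} (hG : ∀ ρ, 0 ≤ G ρ)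
    (hf : ∀ l ∉ rep 8, Free G l) {r : ℝ} (hr : r ∈ Set.Icc (0 : ℝ) 1) :
    cphi c J G r ≤ exp 1184 * cphi c J G 1 := by
  have h8 : (8 : Fin 10) ∉ rep 8 := by simp [mem_rep]
  have h9 : (9 : Fin 10) ∉ insert 8 (rep 8) := by simp [mem_rep]
  have hcard : #(rep 8) = 8 := by decide
  have hd := hasDerivAt_cphi c J h8 h9 hf
  have hD : ∀ ρ : Fin 10 → S, |cavD c J (rep 8) 8 9 ρ| ≤ 1184 := by
    intro ρ
    have := abs_cavD_le hK h8 h9 (Finset.subset_univ _) ρ (B := 4)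
      (fun a _ b _ _ => (hK.off _ _).trans (hK.ωle _ _)) (fun a _ => (hK.kle _).trans (hK.ω₀le _))
    rw [hcard] at this
    norm_num at this
    exact this
  have hlow : ∀ r ∈ Set.Icc (0 : ℝ) 1,
      -(1184 * cphi c J G r) ≤ r * cphi c J (fun ρ => G ρ * cavD c J (rep 8) 8 9 ρ) r := by
    intro r hr
    have h1 : |cphi c J (fun ρ => G ρ * cavD c J (rep 8) 8 9 ρ) r| ≤ 1184 * cphi c J G r := by
      refine (abs_cphi_le _ r).trans ?_
      rw [← cphi_const_mul]
      refine cphi_mono (fun ρ => ?_) r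
      rw [abs_mul, abs_of_nonneg (hG ρ)]
      nlinarith [hD ρ, hG ρ]
    have h2 := (abs_le.1 h1).1
    have h3 : 0 ≤ cphi c J G r := cphi_nonneg hG r
    nlinarith [hr.1, hr.2]
  have hd' : ∀ r, HasDerivAt (fun r => exp (1184 * r) * cphi c J G r)
      (exp (1184 * r) * (1184 * cphi c J G r +
        r * cphi c J (fun ρ => G ρ * cavD c J (rep 8) 8 9 ρ) r)) r := by
    intro r
    refine (((hasDerivAt_id r).const_mul 1184).exp.mul (hd r)).congr_deriv ?_
    simp
    ring
  have hmono : MonotoneOn (fun r => exp (1184 * r) * cphi c J G r) (Set.Icc 0 1) := by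
    refine monotoneOn_of_deriv_nonneg (convex_Icc 0 1)
      (fun r _ => (hd' r).continuousAt.continuousWithinAt)
      (fun r _ => (hd' r).differentiableAt.differentiableWithinAt) fun r hr => ?_
    rw [interior_Icc] at hr
    rw [(hd' r).deriv]
    exact mul_nonneg (exp_pos _).le (by linarith [hlow r ⟨hr.1.le, hr.2.le⟩])
  have := hmono hr (Set.right_mem_Icc.2 zero_le_one) hr.2
  simp only [mul_one] at this
  have h3 : 0 ≤ cphi c J G r := cphi_nonneg hG r
  have h4 : 1 ≤ exp (1184 * r) := one_le_exp (by linarith [hr.1])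
  nlinarith

/-- The constant in the first-order cavity estimate. -/
def cavC : ℝ := 174 * exp 1184

lemma cavC_pos : 0 < cavC := by unfold cavC; positivity

lemma abs_cphi_sub_le (hK : CavBd c J k ω ω₀) {g : (Fin 10 → S) → ℝ}
    (hf : ∀ l ∉ rep 6, Free g l) {r : ℝ} (hr : r ∈ Set.Icc (0 : ℝ) 1) :
    |cphi c J g r - cphi c J g 0| ≤ cavC * cphi c J (fun ρ => |g ρ| * cavW ω ω₀ ρ) 1 := by
  have h8 : (6 : Fin 10) ∉ rep 6 := by simp [mem_rep]
  have h9 : (7 : Fin 10) ∉ insert 6 (rep 6) := by simp [mem_rep]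
  have hcard : #(rep 6) = 6 := by decide
  have hd := hasDerivAt_cphi c J h8 h9 hf
  have hT : insert 7 (insert 6 (rep 6)) ⊆ rep 8 := by decide
  set M := cavC * cphi c J (fun ρ => |g ρ| * cavW ω ω₀ ρ) 1 with hM
  have hG : ∀ ρ, 0 ≤ |g ρ| * cavW ω ω₀ ρ := fun ρ =>
    mul_nonneg (abs_nonneg _) (hK.cavW_nonneg ρ)
  have hM0 : 0 ≤ M := mul_nonneg cavC_pos.le (cphi_nonneg hG 1)
  have hD : ∀ ρ : Fin 10 → S, |cavD c J (rep 6) 6 7 ρ| ≤ 174 * cavW ω ω₀ ρ := by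
    intro ρ
    have := abs_cavD_le hK h8 h9 hT ρ (B := cavW ω ω₀ ρ)
      (fun a ha b hb hab => (hK.off _ _).trans (hK.ω_le_cavW ρ ha hb hab))
      (fun a ha => (hK.kle _).trans (hK.ω₀_le_cavW ρ ha))
    rw [hcard] at this
    norm_num at this
    exact this
  have hψ : ∀ r ∈ Set.Icc (0 : ℝ) 1,
      |cphi c J (fun ρ => g ρ * cavD c J (rep 6) 6 7 ρ) r| ≤ M := by
    intro r hr
    have h1 : |cphi c J (fun ρ => g ρ * cavD c J (rep 6) 6 7 ρ) r| ≤
        174 * cphi c J (fun ρ => |g ρ| * cavW ω ω₀ ρ) r := by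
      refine (abs_cphi_le _ r).trans ?_
      rw [← cphi_const_mul]
      refine cphi_mono (fun ρ => ?_) r
      rw [abs_mul]
      nlinarith [hD ρ, abs_nonneg (g ρ)]
    refine h1.trans ?_
    have h2 := cphi_le_cphi_one hK hG (fun l hl => (Free.abs (hf l fun h => hl (by
      rw [mem_rep] at *; omega))).mul (free_cavW hl)) hr
    rw [hM, cavC]
    linarith
  have hr2 : r ^ 2 / 2 ≤ 1 := by nlinarith [hr.1, hr.2]
  have hr0 : 0 ≤ r ^ 2 / 2 := by positivity
  have up := le_of_hasDerivAt_mul hd (fun r hr => (abs_le.1 (hψ r hr)).2) hr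
  have lo := le_of_hasDerivAt_mul (φ := fun r => - cphi c J g r)
    (ψ := fun r => - cphi c J (fun ρ => g ρ * cavD c J (rep 6) 6 7 ρ) r) (m := M)
    (fun r => (hd r).neg.congr_deriv (by ring))
    (fun r hr => by linarith [(abs_le.1 (hψ r hr)).1]) hr
  rw [abs_le]
  constructor <;> nlinarith

end CavityBounds

section CavityExpansion

variable {S E : Type*} [Fintype S] [Nonempty S] [Fintype E] [DecidableEq E]
variable {c : E → S → ℝ} {J : Finset E} {k : S → ℝ} {ω : S → S → ℝ} {ω₀ : S → ℝ}

lemma cphi_mul_cavD {ι : Type*} [Fintype ι] [DecidableEq ι] (hK : CavBd c J k ω ω₀) {A : Finset ι}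
    {q q' : ι} (hq : q ∉ A) (g : (ι → S) → ℝ) (r : ℝ) :
    cphi c J (fun ρ => g ρ * cavD c J A q q' ρ) r =
      ∑ a ∈ A, (cphi c J (fun ρ => g ρ * k (ρ a)) r - cphi c J (fun ρ => g ρ * k (ρ q)) r)
      + ∑ a ∈ A, ∑ b ∈ A.erase a, cphi c J (fun ρ => g ρ * cavK c J (ρ a) (ρ b)) r
      + ∑ a ∈ A, cphi c J (fun ρ => g ρ * cavK c J (ρ a) (ρ q)) r
      - (#A + 1) * ∑ a ∈ A, cphi c J (fun ρ => g ρ * cavK c J (ρ a) (ρ q')) r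
      - #A * ∑ a ∈ A, cphi c J (fun ρ => g ρ * cavK c J (ρ q) (ρ a)) r
      + #A * (#A + 1) * cphi c J (fun ρ => g ρ * cavK c J (ρ q) (ρ q')) r := by
  simp only [← cphi_sum, ← cphi_sub, ← cphi_const_mul, ← cphi_add]
  congr 1
  funext ρ
  rw [cavD_eq hK hq ρ]
  simp only [mul_add, mul_sub, Finset.mul_sum]
  congr 1
  · congr 1
    · congr 1
      refine Finset.sum_congr rfl fun a _ => by ring
    · refine Finset.sum_congr rfl fun a _ => by ring
  · ring

lemma Free.comp_pair {ι : Type*} [DecidableEq ι] (F : S → S → ℝ) {a b l : ι} (ha : a ≠ l) (hb : b ≠ l) :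
    Free (fun ρ : ι → S => F (ρ a) (ρ b)) l := by
  intro ρ s
  simp only [Function.update_of_ne ha, Function.update_of_ne hb]

lemma Free.comp_single {ι : Type*} [DecidableEq ι] (F : S → ℝ) {a l : ι} (ha : a ≠ l) :
    Free (fun ρ : ι → S => F (ρ a)) l := by
  intro ρ s
  simp only [Function.update_of_ne ha]

lemma abs_cphi_mul_sub_le (hK : CavBd c J k ω ω₀) {g h : (Fin 10 → S) → ℝ}
    (hg : ∀ l ∉ rep 6, Free g l) (hh : ∀ l ∉ rep 6, Free h l) (hle : ∀ ρ, |h ρ| ≤ cavW ω ω₀ ρ)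
    {r : ℝ} (hr : r ∈ Set.Icc (0 : ℝ) 1) :
    |cphi c J (fun ρ => g ρ * h ρ) r - cphi c J (fun ρ => g ρ * h ρ) 0| ≤
      cavC * cphi c J (fun ρ => |g ρ| * cavW ω ω₀ ρ ^ 2) 1 := by
  refine (abs_cphi_sub_le hK (fun l hl => (hg l hl).mul (hh l hl)) hr).trans ?_
  refine mul_le_mul_of_nonneg_left (cphi_mono (fun ρ => ?_) 1) cavC_pos.le
  rw [abs_mul, mul_assoc, sq]
  exact mul_le_mul_of_nonneg_left (mul_le_mul_of_nonneg_right (hle ρ) (hK.cavW_nonneg ρ))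
    (abs_nonneg _)

lemma abs_cphi_mul_cavK_sub_le (hK : CavBd c J k ω ω₀) {g : (Fin 10 → S) → ℝ}
    (hg : ∀ l ∉ rep 6, Free g l) {a b : Fin 10} (ha : a ∈ rep 6) (hb : b ∈ rep 6) (hab : a ≠ b)
    {r : ℝ} (hr : r ∈ Set.Icc (0 : ℝ) 1) :
    |cphi c J (fun ρ => g ρ * cavK c J (ρ a) (ρ b)) r -
        cphi c J (fun ρ => g ρ * cavK c J (ρ a) (ρ b)) 0| ≤
      cavC * cphi c J (fun ρ => |g ρ| * cavW ω ω₀ ρ ^ 2) 1 := by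
  have h8 : ∀ x ∈ rep 6, x ∈ rep 8 := fun x hx => by rw [mem_rep] at *; omega
  exact abs_cphi_mul_sub_le hK hg (fun l hl => Free.comp_pair _ (by rintro rfl; exact hl ha)
    (by rintro rfl; exact hl hb))
    (fun ρ => (hK.off _ _).trans (hK.ω_le_cavW ρ (h8 a ha) (h8 b hb) hab)) hr

lemma abs_cphi_mul_diag_sub_le (hK : CavBd c J k ω ω₀) {g : (Fin 10 → S) → ℝ}
    (hg : ∀ l ∉ rep 6, Free g l) {a : Fin 10} (ha : a ∈ rep 6)
    {r : ℝ} (hr : r ∈ Set.Icc (0 : ℝ) 1) :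
    |cphi c J (fun ρ => g ρ * k (ρ a)) r - cphi c J (fun ρ => g ρ * k (ρ a)) 0| ≤
      cavC * cphi c J (fun ρ => |g ρ| * cavW ω ω₀ ρ ^ 2) 1 := by
  have h8 : ∀ x ∈ rep 6, x ∈ rep 8 := fun x hx => by rw [mem_rep] at *; omega
  exact abs_cphi_mul_sub_le hK hg (fun l hl => Free.comp_single _ (by rintro rfl; exact hl ha))
    (fun ρ => (hK.kle _).trans (hK.ω₀_le_cavW ρ (h8 a ha))) hr

/-- Second-order lower bound along the cavity interpolation, when all first-order terms vanish or
have a favourable sign. -/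
lemma le_cphi_of_first_order (hK : CavBd c J 0 ω ω₀) {g : (Fin 10 → S) → ℝ}
    (hg : ∀ l ∉ rep 4, Free g l)
    (h0 : ∀ a ∈ rep 6, ∀ b ∈ rep 6, a ≠ b →
      cphi c J (fun ρ => g ρ * cavK c J (ρ a) (ρ b)) 0 = 0 ∨
      a ∈ rep 4 ∧ b ∈ rep 4 ∧ 0 ≤ cphi c J (fun ρ => g ρ * cavK c J (ρ a) (ρ b)) 0)
    {r : ℝ} (hr : r ∈ Set.Icc (0 : ℝ) 1) :
    cphi c J g 0 - 38 * cavC * cphi c J (fun ρ => |g ρ| * cavW ω ω₀ ρ ^ 2) 1 ≤ cphi c J g r := by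
  have h4 : (4 : Fin 10) ∉ rep 4 := by simp [mem_rep]
  have h5 : (5 : Fin 10) ∉ insert 4 (rep 4) := by simp [mem_rep]
  have hcard : #(rep 4) = 4 := by decide
  have h46 : ∀ x ∈ rep 4, x ∈ rep 6 := fun x hx => by rw [mem_rep] at *; omega
  have hg6 : ∀ l ∉ rep 6, Free g l := fun l hl => hg l fun h => hl (h46 l h)
  have hd := hasDerivAt_cphi c J h4 h5 hg
  set M := cavC * cphi c J (fun ρ => |g ρ| * cavW ω ω₀ ρ ^ 2) 1 with hM
  have hM0 : 0 ≤ M := mul_nonneg cavC_pos.le (cphi_nonneg (fun ρ => by positivity) 1)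
  have m4 : (4 : Fin 10) ∈ rep 6 := by decide
  have m5 : (5 : Fin 10) ∈ rep 6 := by decide
  have hψ : ∀ r ∈ Set.Icc (0 : ℝ) 1,
      -(76 * M) ≤ cphi c J (fun ρ => g ρ * cavD c J (rep 4) 4 5 ρ) r := by
    intro r hr
    have lo : ∀ a ∈ rep 6, ∀ b ∈ rep 6, a ≠ b →
        -M ≤ cphi c J (fun ρ => g ρ * cavK c J (ρ a) (ρ b)) r := by
      intro a ha b hb hab
      have h1 := (abs_le.1 (abs_cphi_mul_cavK_sub_le hK hg6 ha hb hab hr)).1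
      rcases h0 a ha b hb hab with h | h
      · rw [h] at h1; linarith
      · linarith [h.2.2]
    have up : ∀ a ∈ rep 6, ∀ b ∈ rep 6, a ≠ b → ¬ (a ∈ rep 4 ∧ b ∈ rep 4) →
        cphi c J (fun ρ => g ρ * cavK c J (ρ a) (ρ b)) r ≤ M := by
      intro a ha b hb hab hn
      have h1 := (abs_le.1 (abs_cphi_mul_cavK_sub_le hK hg6 ha hb hab hr)).2
      rcases h0 a ha b hb hab with h | h
      · rw [h] at h1; linarith
      · exact absurd ⟨h.1, h.2.1⟩ hn
    have ne4 : ∀ a ∈ rep 4, a ≠ 4 := by rintro a ha rfl; exact h4 ha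
    have ne5 : ∀ a ∈ rep 4, a ≠ 5 := by rintro a ha rfl; exact h5 (by simp [ha])
    have n5 : (5 : Fin 10) ∉ rep 4 := by simp [mem_rep]
    rw [cphi_mul_cavD hK h4, hcard]
    have s1 : -(12 * M) ≤ ∑ a ∈ rep 4, ∑ b ∈ (rep 4).erase a,
        cphi c J (fun ρ => g ρ * cavK c J (ρ a) (ρ b)) r := by
      have : ∑ a ∈ rep 4, ∑ b ∈ (rep 4).erase a, (-M) = -(12 * M) := by
        have : ∀ a ∈ rep 4, #((rep 4).erase a) = 3 := by decide
        rw [Finset.sum_congr rfl fun a ha => by rw [Finset.sum_const, this a ha]]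
        rw [Finset.sum_const, hcard]; simp; ring
      rw [← this]
      exact Finset.sum_le_sum fun a ha => Finset.sum_le_sum fun b hb =>
        lo a (h46 a ha) b (h46 b (Finset.mem_of_mem_erase hb)) (Finset.ne_of_mem_erase hb).symm
    have s2 : -(4 * M) ≤ ∑ a ∈ rep 4, cphi c J (fun ρ => g ρ * cavK c J (ρ a) (ρ 4)) r := by
      have := Finset.sum_le_sum fun a (ha : a ∈ rep 4) => lo a (h46 a ha) 4 m4 (ne4 a ha)
      rw [Finset.sum_const, hcard] at this
      simpa using this
    have s3 : ∑ a ∈ rep 4, cphi c J (fun ρ => g ρ * cavK c J (ρ a) (ρ 5)) r ≤ 4 * M := by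
      have := Finset.sum_le_sum fun a (ha : a ∈ rep 4) => up a (h46 a ha) 5 m5 (ne5 a ha)
        fun h => n5 h.2
      rw [Finset.sum_const, hcard] at this
      simpa using this
    have s4 : ∑ a ∈ rep 4, cphi c J (fun ρ => g ρ * cavK c J (ρ 4) (ρ a)) r ≤ 4 * M := by
      have := Finset.sum_le_sum fun a (ha : a ∈ rep 4) => up 4 m4 a (h46 a ha) (ne4 a ha).symm
        fun h => h4 h.1
      rw [Finset.sum_const, hcard] at this
      simpa using this
    have s5 := lo 4 m4 5 m5 (by decide)
    simp only [Pi.zero_apply, sub_self, Finset.sum_const_zero]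
    norm_num at *
    linarith
  have lo := le_of_hasDerivAt_mul (φ := fun r => - cphi c J g r)
    (ψ := fun r => - cphi c J (fun ρ => g ρ * cavD c J (rep 4) 4 5 ρ) r) (m := 76 * M)
    (fun r => (hd r).neg.congr_deriv (by ring))
    (fun r hr => by linarith [hψ r hr]) hr
  have hr2 : r ^ 2 ≤ 1 := by nlinarith [hr.1, hr.2]
  rw [mul_assoc, ← hM]
  nlinarith

end CavityExpansion

section CavityParity

variable {S E : Type*} [Fintype S] [Nonempty S] [Fintype E] [DecidableEq E]
variable {c : E → S → ℝ} {J : Finset E} {k : S → ℝ} {ω : S → S → ℝ} {ω₀ : S → ℝ}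

/-- `g` changes sign when `T` is applied to a replica in `P`, and is unchanged otherwise. -/
def HasPar (T : S → S) (P : Finset (Fin 10)) (g : (Fin 10 → S) → ℝ) : Prop :=
  ∀ l ρ, g (Function.update ρ l (T (ρ l))) = (if l ∈ P then -1 else 1) * g ρ

lemma HasPar.mul {T : S → S} {P Q R : Finset (Fin 10)} {g h : (Fin 10 → S) → ℝ}
    (hg : HasPar T P g) (hh : HasPar T Q h) (hR : R = symmDiff P Q) :
    HasPar T R fun ρ => g ρ * h ρ := by
  subst hR
  intro l ρ
  simp only [hg l ρ, hh l ρ]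
  by_cases h1 : l ∈ P <;> by_cases h2 : l ∈ Q <;> simp [h1, h2, Finset.mem_symmDiff]

lemma HasPar.const_mul {T : S → S} {P : Finset (Fin 10)} {g : (Fin 10 → S) → ℝ}
    (hg : HasPar T P g) (s : ℝ) : HasPar T P fun ρ => s * g ρ := by
  intro l ρ
  simp only [hg l ρ]
  ring

lemma HasPar.cphi_eq_zero {T : S → S} (hT : Function.Involutive T)
    (hc : ∀ e ∉ J, ∀ s, c e (T s) = c e s) {P : Finset (Fin 10)} {g : (Fin 10 → S) → ℝ}
    (hg : HasPar T P g) (hP : P ≠ ∅) : cphi c J g 0 = 0 := by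
  obtain ⟨l, hl⟩ := Finset.nonempty_of_ne_empty hP
  exact cphi_zero_of_odd hT hc l fun ρ => by rw [hg l ρ]; simp [hl]

lemma hasPar_cavK {T : S → S} (hKT : ∀ s t, cavK c J (T s) t = - cavK c J s t) {a b : Fin 10}
    (hab : a ≠ b) : HasPar T {a, b} fun ρ => cavK c J (ρ a) (ρ b) := by
  intro l ρ
  have hKT' : ∀ s t, cavK c J s (T t) = - cavK c J s t := fun s t => by
    rw [cavK_comm, hKT, cavK_comm]
  by_cases ha : l = a
  · subst ha
    simp [Function.update_of_ne hab.symm, hKT]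
  · by_cases hb : l = b
    · subst hb
      simp [Function.update_of_ne hab, hKT']
    · simp [Function.update_of_ne (Ne.symm ha), Function.update_of_ne (Ne.symm hb), ha, hb]

lemma HasPar.first_order {T : S → S} (hT : Function.Involutive T)
    (hc : ∀ e ∉ J, ∀ s, c e (T s) = c e s) (hKT : ∀ s t, cavK c J (T s) t = - cavK c J s t)
    {P : Finset (Fin 10)} {g : (Fin 10 → S) → ℝ} (hg : HasPar T P g) {a b : Fin 10} (hab : a ≠ b)
    (hP : P ≠ {a, b}) : cphi c J (fun ρ => g ρ * cavK c J (ρ a) (ρ b)) 0 = 0 :=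
  (hg.mul (hasPar_cavK hKT hab) rfl).cphi_eq_zero hT hc fun h => hP (symmDiff_eq_bot.1 h)

/-- The cavity inequality for `f = K(ρ⁰, ρ¹) V(ρ⁰, ρ¹)`: up to third-order errors only the
diagonal term survives. -/
lemma cphi_le_of_sign (hK : CavBd c J 0 ω ω₀) {T : S → S} (hT : Function.Involutive T)
    (hc : ∀ e ∉ J, ∀ s, c e (T s) = c e s) (hKT : ∀ s t, cavK c J (T s) t = - cavK c J s t)
    {V : S → S → ℝ} (hV : ∀ s t, V (T s) t = V s t) (hV' : ∀ s t, V s (T t) = V s t)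
    (hpos : ∀ b ∈ rep 4, 2 ≤ b → 0 ≤ cphi c J (fun ρ : Fin 10 → S =>
      cavK c J (ρ 0) (ρ 1) * V (ρ 0) (ρ 1) * cavK c J (ρ 0) (ρ b) * cavK c J (ρ 1) (ρ b)) 0) :
    cphi c J (fun ρ : Fin 10 → S => cavK c J (ρ 0) (ρ 1) * V (ρ 0) (ρ 1)) 1 ≤
      cphi c J (fun ρ : Fin 10 → S => cavK c J (ρ 0) (ρ 1) * V (ρ 0) (ρ 1) * cavK c J (ρ 0) (ρ 1)) 1
      + 342 * cavC * cphi c J (fun ρ : Fin 10 → S =>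
        |cavK c J (ρ 0) (ρ 1) * V (ρ 0) (ρ 1)| * cavW ω ω₀ ρ ^ 3) 1 := by
  set f : (Fin 10 → S) → ℝ := fun ρ => cavK c J (ρ 0) (ρ 1) * V (ρ 0) (ρ 1) with hfdef
  have hV2 : HasPar T ∅ fun ρ => V (ρ 0) (ρ 1) := by
    intro l ρ
    by_cases h0 : l = 0
    · subst h0; simp [hV]
    · by_cases h1 : l = 1
      · subst h1; simp [hV']
      · simp [Function.update_of_ne (Ne.symm h0), Function.update_of_ne (Ne.symm h1)]
  have hfP : HasPar T {0, 1} f := (hasPar_cavK hKT (by decide)).mul hV2 (by decide)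
  have hfF : ∀ l, l ≠ 0 → l ≠ 1 → Free f l := fun l h0 h1 =>
    Free.comp_pair (fun s t => cavK c J s t * V s t) h0.symm h1.symm
  have hfF2 : ∀ l ∉ ({0, 1} : Finset (Fin 10)), Free f l := fun l hl =>
    hfF l (fun h => hl (by simp [h])) (fun h => hl (by simp [h]))
  set D := 38 * cavC * cphi c J (fun ρ => |f ρ| * cavW ω ω₀ ρ ^ 3) 1 with hD
  -- second-order control of each `f * K`
  have key : ∀ (s : ℝ) (a b : Fin 10), (s = 1 ∨ s = -1) → a ∈ rep 4 → b ∈ rep 4 → a ≠ b →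
      (∀ x ∈ rep 6, ∀ y ∈ rep 6, x ≠ y →
        symmDiff ({0, 1} : Finset (Fin 10)) {a, b} ≠ {x, y} ∨ x ∈ rep 4 ∧ y ∈ rep 4 ∧
          0 ≤ cphi c J (fun ρ => s * (f ρ * cavK c J (ρ a) (ρ b)) * cavK c J (ρ x) (ρ y)) 0) →
      ∀ r ∈ Set.Icc (0 : ℝ) 1, s * cphi c J (fun ρ => f ρ * cavK c J (ρ a) (ρ b)) 0 - D ≤
        s * cphi c J (fun ρ => f ρ * cavK c J (ρ a) (ρ b)) r := by
    intro s a b hs ha hb hab h r hr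
    have hP : HasPar T (symmDiff {0, 1} {a, b}) (fun ρ => s * (f ρ * cavK c J (ρ a) (ρ b))) :=
      (hfP.mul (hasPar_cavK hKT hab) rfl).const_mul s
    have hFr : ∀ l ∉ rep 4, Free (fun ρ => s * (f ρ * cavK c J (ρ a) (ρ b))) l := by
      intro l hl ρ x
      have h1 := (hfF l (by rintro rfl; exact hl (by decide)) (by rintro rfl; exact hl (by decide))).mul
        (Free.comp_pair (cavK c J) (a := a) (b := b) (l := l) (by rintro rfl; exact hl ha)
          (by rintro rfl; exact hl hb)) ρ x
      simp only at h1 ⊢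
      rw [h1]
    have := le_cphi_of_first_order hK hFr (fun x hx y hy hxy => by
      rcases h x hx y hy hxy with h' | h'
      · exact Or.inl (hP.first_order hT hc hKT hxy h')
      · exact Or.inr h') hr
    rw [cphi_const_mul, cphi_const_mul] at this
    refine le_trans (sub_le_sub_left ?_ _) this
    refine mul_le_mul_of_nonneg_left (cphi_mono (fun ρ => ?_) 1) (by have := cavC_pos; positivity)
    have h8 : ∀ x ∈ rep 4, x ∈ rep 8 := fun x hx => by rw [mem_rep] at *; omega
    have hs1 : |s| = 1 := by rcases hs with h | h <;> simp [h]
    have hKW := (hK.off (ρ a) (ρ b)).trans (hK.ω_le_cavW ρ (h8 a ha) (h8 b hb) hab)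
    have hW := hK.cavW_nonneg ρ
    rw [abs_mul, abs_mul, hs1, one_mul, mul_assoc, pow_succ' _ 2]
    exact mul_le_mul_of_nonneg_left (mul_le_mul_of_nonneg_right hKW (by positivity)) (abs_nonneg _)
  have z : ∀ a ∈ rep 4, ∀ b ∈ rep 4, a ≠ b → ({0, 1} : Finset (Fin 10)) ≠ {a, b} →
      cphi c J (fun ρ => f ρ * cavK c J (ρ a) (ρ b)) 0 = 0 := fun a _ b _ hab h =>
    hfP.first_order hT hc hKT hab h
  have i1 : (1 : ℝ) ∈ Set.Icc (0 : ℝ) 1 := ⟨zero_le_one, le_rfl⟩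
  -- the pair `{0, 1}`
  have e01 : symmDiff ({0, 1} : Finset (Fin 10)) {0, 1} = ∅ := by decide
  have k01 : ∀ s : ℝ, (s = 1 ∨ s = -1) → ∀ r ∈ Set.Icc (0 : ℝ) 1,
      s * cphi c J (fun ρ => f ρ * cavK c J (ρ 0) (ρ 1)) 0 - D ≤
        s * cphi c J (fun ρ => f ρ * cavK c J (ρ 0) (ρ 1)) r := fun s hs r hr =>
    key s 0 1 hs (by decide) (by decide) (by decide) (fun x _ y _ _ => Or.inl (by
      rw [e01]; exact (Finset.insert_ne_empty _ _).symm)) r hr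
  -- the pair `{2, 3}`
  have k23 : ∀ s : ℝ, (s = 1 ∨ s = -1) → ∀ r ∈ Set.Icc (0 : ℝ) 1,
      s * cphi c J (fun ρ => f ρ * cavK c J (ρ 2) (ρ 3)) 0 - D ≤
        s * cphi c J (fun ρ => f ρ * cavK c J (ρ 2) (ρ 3)) r := fun s hs r hr =>
    key s 2 3 hs (by decide) (by decide) (by decide) (fun x _ y _ _ => Or.inl (by
      intro h
      have h1 : #(symmDiff ({0, 1} : Finset (Fin 10)) {2, 3}) = 4 := by decide
      rw [h] at h1
      have := Finset.card_le_two (a := x) (b := y)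
      omega)) r hr
  -- the mixed pairs
  have kmix : ∀ a b : Fin 10, (a = 0 ∨ a = 1) → (b = 2 ∨ b = 3) → ∀ r ∈ Set.Icc (0 : ℝ) 1,
      -D ≤ cphi c J (fun ρ => f ρ * cavK c J (ρ a) (ρ b)) r := by
    intro a b ha hb r hr
    have hb4 : b ∈ rep 4 := by rcases hb with rfl | rfl <;> decide
    have hb2 : 2 ≤ b := by rcases hb with rfl | rfl <;> decide
    have ha4 : a ∈ rep 4 := by rcases ha with rfl | rfl <;> decide
    have hab : a ≠ b := by rcases ha with rfl | rfl <;> rcases hb with rfl | rfl <;> decide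
    have hz := z a ha4 b hb4 hab (by
      rcases ha with rfl | rfl <;> rcases hb with rfl | rfl <;> decide)
    have hp := hpos b hb4 hb2
    have := key 1 a b (Or.inl rfl) ha4 hb4 hab (fun x hx y hy hxy => by
      by_cases hxy' : symmDiff ({0, 1} : Finset (Fin 10)) {a, b} = {x, y}
      · right
        have hsub : ({x, y} : Finset (Fin 10)) ⊆ rep 4 := by
          rw [← hxy']
          rcases ha with rfl | rfl <;> rcases hb with rfl | rfl <;> decide
        refine ⟨hsub (by simp), hsub (by simp), ?_⟩
        have hcase : ({x, y} : Finset (Fin 10)) = {1 - a, b} := by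
          rw [← hxy']
          rcases ha with rfl | rfl <;> rcases hb with rfl | rfl <;> decide
        have hKxy : ∀ ρ : Fin 10 → S, cavK c J (ρ x) (ρ y) = cavK c J (ρ (1 - a)) (ρ b) := by
          intro ρ
          have h1 : x ∈ ({1 - a, b} : Finset (Fin 10)) := by rw [← hcase]; simp
          have h2 : y ∈ ({1 - a, b} : Finset (Fin 10)) := by rw [← hcase]; simp
          simp only [Finset.mem_insert, Finset.mem_singleton] at h1 h2
          rcases h1 with rfl | rfl <;> rcases h2 with rfl | rfl
          · exact absurd rfl hxy
          · rfl
          · exact cavK_comm _ _ _ _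
          · exact absurd rfl hxy
        convert hp using 2
        funext ρ
        rw [hKxy]
        rcases ha with rfl | rfl
        · simp only [hfdef, sub_zero]; ring
        · simp only [hfdef, sub_self]; ring
      · exact Or.inl hxy') r hr
    rw [hz] at this
    simpa using this
  have hz23 := z 2 (by decide) 3 (by decide) (by decide) (by decide)
  have h2 : (2 : Fin 10) ∉ ({0, 1} : Finset (Fin 10)) := by decide
  have h3 : (3 : Fin 10) ∉ insert 2 ({0, 1} : Finset (Fin 10)) := by decide
  have hcard : #({0, 1} : Finset (Fin 10)) = 2 := by decide
  have hd := hasDerivAt_cphi c J h2 h3 hfF2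
  have hψ : ∀ r ∈ Set.Icc (0 : ℝ) 1, cphi c J (fun ρ => f ρ * cavD c J {0, 1} 2 3 ρ) r ≤
      2 * cphi c J (fun ρ => f ρ * cavK c J (ρ 0) (ρ 1)) 1 + 18 * D := by
    intro r hr
    have hcomm : ∀ a b : Fin 10, cphi c J (fun ρ => f ρ * cavK c J (ρ a) (ρ b)) r =
        cphi c J (fun ρ => f ρ * cavK c J (ρ b) (ρ a)) r := fun a b => by
      simp only [cavK_comm c J]
    rw [cphi_mul_cavD hK h2, hcard]
    have er0 : ({0, 1} : Finset (Fin 10)).erase 0 = {1} := by decide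
    have er1 : ({0, 1} : Finset (Fin 10)).erase 1 = {0} := by decide
    rw [Finset.sum_pair (by decide), Finset.sum_pair (by decide), Finset.sum_pair (by decide),
      Finset.sum_pair (by decide), Finset.sum_pair (by decide), er0, er1, Finset.sum_singleton,
      Finset.sum_singleton, hcomm 1 0, hcomm 2 0, hcomm 2 1]
    have a1 := k01 (-1) (Or.inr rfl) r hr
    have a2 := k01 1 (Or.inl rfl) 1 i1
    have a3 := k23 (-1) (Or.inr rfl) r hr
    rw [hz23] at a3
    have b1 := kmix 0 2 (by simp) (by simp) r hr
    have b2 := kmix 1 2 (by simp) (by simp) r hr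
    have b3 := kmix 0 3 (by simp) (by simp) r hr
    have b4 := kmix 1 3 (by simp) (by simp) r hr
    simp only [Pi.zero_apply]
    norm_num
    linarith
  have := le_of_hasDerivAt_mul hd hψ i1
  rw [hfP.cphi_eq_zero hT hc (by decide)] at this
  linarith

/-- First-order expansion when only the diagonal term of replica `0` survives. -/
lemma abs_cphi_sub_half_diag_le (hK : CavBd c J k ω ω₀) {f : (Fin 10 → S) → ℝ}
    (hf : ∀ l ∉ ({0, 1} : Finset (Fin 10)), Free f l) (h0 : cphi c J f 0 = 0)
    (hk1 : cphi c J (fun ρ => f ρ * k (ρ 1)) 0 = 0) (hk2 : cphi c J (fun ρ => f ρ * k (ρ 2)) 0 = 0)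
    (hKK : ∀ a ∈ rep 4, ∀ b ∈ rep 4, a ≠ b →
      cphi c J (fun ρ => f ρ * cavK c J (ρ a) (ρ b)) 0 = 0) :
    |cphi c J f 1 - 1 / 2 * cphi c J (fun ρ => f ρ * k (ρ 0)) 1| ≤
      11 * cavC * cphi c J (fun ρ => |f ρ| * cavW ω ω₀ ρ ^ 2) 1 := by
  set M := cavC * cphi c J (fun ρ => |f ρ| * cavW ω ω₀ ρ ^ 2) 1 with hM
  have hM0 : 0 ≤ M := mul_nonneg cavC_pos.le (cphi_nonneg (fun ρ => by positivity) 1)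
  have hf6 : ∀ l ∉ rep 6, Free f l := fun l hl => hf l fun h => hl (by
    have : ({0, 1} : Finset (Fin 10)) ⊆ rep 6 := by decide
    exact this h)
  have h46 : ∀ x ∈ rep 4, x ∈ rep 6 := fun x hx => by rw [mem_rep] at *; omega
  have i1 : (1 : ℝ) ∈ Set.Icc (0 : ℝ) 1 := ⟨zero_le_one, le_rfl⟩
  have h2 : (2 : Fin 10) ∉ ({0, 1} : Finset (Fin 10)) := by decide
  have h3 : (3 : Fin 10) ∉ insert 2 ({0, 1} : Finset (Fin 10)) := by decide
  have hcard : #({0, 1} : Finset (Fin 10)) = 2 := by decide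
  have hd := hasDerivAt_cphi c J h2 h3 hf
  have hψ : ∀ r ∈ Set.Icc (0 : ℝ) 1, |cphi c J (fun ρ => f ρ * cavD c J {0, 1} 2 3 ρ) r -
      cphi c J (fun ρ => f ρ * k (ρ 0)) 1| ≤ 21 * M := by
    intro r hr
    have hcomm : ∀ a b : Fin 10, cphi c J (fun ρ => f ρ * cavK c J (ρ a) (ρ b)) r =
        cphi c J (fun ρ => f ρ * cavK c J (ρ b) (ρ a)) r := fun a b => by
      simp only [cavK_comm c J]
    rw [cphi_mul_cavD hK h2, hcard]
    have er0 : ({0, 1} : Finset (Fin 10)).erase 0 = {1} := by decide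
    have er1 : ({0, 1} : Finset (Fin 10)).erase 1 = {0} := by decide
    rw [Finset.sum_pair (by decide), Finset.sum_pair (by decide), Finset.sum_pair (by decide),
      Finset.sum_pair (by decide), Finset.sum_pair (by decide), er0, er1, Finset.sum_singleton,
      Finset.sum_singleton, hcomm 1 0, hcomm 2 0, hcomm 2 1]
    have hKb : ∀ a ∈ rep 4, ∀ b ∈ rep 4, a ≠ b →
        |cphi c J (fun ρ => f ρ * cavK c J (ρ a) (ρ b)) r| ≤ M := by
      intro a ha b hb hab
      have := abs_cphi_mul_cavK_sub_le hK hf6 (h46 a ha) (h46 b hb) hab hr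
      rwa [hKK a ha b hb hab, sub_zero] at this
    have b1 := abs_le.1 (hKb 0 (by decide) 1 (by decide) (by decide))
    have b2 := abs_le.1 (hKb 0 (by decide) 2 (by decide) (by decide))
    have b3 := abs_le.1 (hKb 1 (by decide) 2 (by decide) (by decide))
    have b4 := abs_le.1 (hKb 0 (by decide) 3 (by decide) (by decide))
    have b5 := abs_le.1 (hKb 1 (by decide) 3 (by decide) (by decide))
    have b6 := abs_le.1 (hKb 2 (by decide) 3 (by decide) (by decide))
    have a0 := abs_le.1 (abs_cphi_mul_diag_sub_le hK hf6 (a := 0) (by decide) hr)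
    have a0' := abs_le.1 (abs_cphi_mul_diag_sub_le hK hf6 (a := 0) (by decide) i1)
    have a1 := abs_le.1 (abs_cphi_mul_diag_sub_le hK hf6 (a := 1) (by decide) hr)
    have a2 := abs_le.1 (abs_cphi_mul_diag_sub_le hK hf6 (a := 2) (by decide) hr)
    rw [hk1] at a1
    rw [hk2] at a2
    rw [abs_le]
    norm_num
    constructor <;> linarith [a0.1, a0.2, a0'.1, a0'.2, a1.1, a1.2, a2.1, a2.2]
  have up := le_of_hasDerivAt_mul hd (fun r hr => by
    have := (abs_le.1 (hψ r hr)).2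
    exact (sub_le_iff_le_add.1 this)) i1
  have lo := le_of_hasDerivAt_mul (φ := fun r => - cphi c J f r)
    (ψ := fun r => - cphi c J (fun ρ => f ρ * cavD c J {0, 1} 2 3 ρ) r)
    (m := 21 * M - cphi c J (fun ρ => f ρ * k (ρ 0)) 1)
    (fun r => (hd r).neg.congr_deriv (by ring))
    (fun r hr => by linarith [(abs_le.1 (hψ r hr)).1]) i1
  rw [h0] at up
  simp only [h0] at lo
  rw [mul_assoc, ← hM, abs_le]
  constructor <;> linarith

end CavityParity

section SKCombinatorics

lemma spin_mul_self (b : Bool) : spin b * spin b = 1 := by cases b <;> simp [spin]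

lemma spin_sq (b : Bool) : spin b ^ 2 = 1 := by rw [sq, spin_mul_self]

lemma abs_spin (b : Bool) : |spin b| = 1 := by cases b <;> simp [spin]

lemma spin_not (b : Bool) : spin (!b) = - spin b := by cases b <;> simp [spin]

/-- The overlap with site `i` removed. -/
def cavx {N : ℕ} (i : Fin N) (σ τ : Config N) : ℝ :=
  (∑ j ∈ univ.erase i, spin (σ j) * spin (τ j)) / N

/-- Flip the spin at site `i`. -/
def flipAt {N : ℕ} (i : Fin N) (σ : Config N) : Config N := Function.update σ i (!σ i)

variable {N : ℕ}

lemma flipAt_involutive (i : Fin N) : Function.Involutive (flipAt i) := by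
  intro σ
  simp [flipAt]

lemma spin_flipAt_self (i : Fin N) (σ : Config N) : spin (flipAt i σ i) = - spin (σ i) := by
  simp [flipAt, spin_not]

lemma flipAt_of_ne {i j : Fin N} (h : j ≠ i) (σ : Config N) : flipAt i σ j = σ j := by
  simp [flipAt, h]

lemma cavx_comm (i : Fin N) (σ τ : Config N) : cavx i σ τ = cavx i τ σ := by
  unfold cavx
  simp only [mul_comm]

lemma cavx_flipAt_left (i : Fin N) (σ τ : Config N) : cavx i (flipAt i σ) τ = cavx i σ τ := by
  unfold cavx
  congr 1
  exact Finset.sum_congr rfl fun j hj => by rw [flipAt_of_ne (Finset.ne_of_mem_erase hj)]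

lemma cavx_flipAt_right (i : Fin N) (σ τ : Config N) : cavx i σ (flipAt i τ) = cavx i σ τ := by
  rw [cavx_comm, cavx_flipAt_left, cavx_comm]

lemma ovlp_eq_cavx_add (i : Fin N) (σ τ : Config N) :
    ovlp N σ τ = cavx i σ τ + spin (σ i) * spin (τ i) / N := by
  unfold ovlp cavx
  rw [← Finset.add_sum_erase univ _ (mem_univ i)]
  ring

lemma abs_spin_mul (a b : Bool) : |spin a * spin b| = 1 := by rw [abs_mul, abs_spin, abs_spin, one_mul]

lemma abs_ovlp_le (σ τ : Config N) : |ovlp N σ τ| ≤ 1 := by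
  unfold ovlp
  rw [abs_div, Nat.abs_cast]
  refine div_le_one_of_le₀ ((Finset.abs_sum_le_sum_abs _ _).trans ?_) (Nat.cast_nonneg _)
  simp only [abs_spin_mul]
  simp

lemma abs_cavx_le (i : Fin N) (σ τ : Config N) : |cavx i σ τ| ≤ 1 := by
  unfold cavx
  rw [abs_div, Nat.abs_cast]
  refine div_le_one_of_le₀ ((Finset.abs_sum_le_sum_abs _ _).trans ?_) (Nat.cast_nonneg _)
  simp only [abs_spin_mul, Finset.sum_const, nsmul_eq_mul, mul_one]
  exact_mod_cast (Finset.card_erase_le).trans (by simp)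

lemma cavx_self (i : Fin N) (σ : Config N) : cavx i σ σ = (N - 1) / N := by
  unfold cavx
  simp only [spin_mul_self, Finset.sum_const, nsmul_eq_mul, mul_one]
  rw [Finset.card_erase_of_mem (mem_univ i), Finset.card_univ, Fintype.card_fin,
    Nat.cast_sub (Nat.one_le_iff_ne_zero.2 (Fin.pos i).ne'), Nat.cast_one]

/-- The pairs that involve site `i`. -/
def skJ (i : Fin N) : Finset (Fin N × Fin N) := univ.filter fun e => e.1 = i ∨ e.2 = i

lemma sum_skJ (i : Fin N) (h : Fin N → ℝ) :
    ∑ e ∈ skJ i, (if e.1 < e.2 then h e.1 * h e.2 else 0) = h i * ∑ j ∈ univ.erase i, h j := by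
  have h1 : ∀ e : Fin N × Fin N, (if e.1 = i ∨ e.2 = i then
      (if e.1 < e.2 then h e.1 * h e.2 else 0) else 0) =
      (if e.1 = i then (if i < e.2 then h i * h e.2 else 0) else 0) +
      (if e.2 = i then (if e.1 < i then h e.1 * h i else 0) else 0) := by
    intro ⟨a, b⟩
    by_cases ha : a = i <;> by_cases hb : b = i <;> simp [ha, hb]
  have h2 : ∀ j : Fin N, (if i < j then h i * h j else 0) + (if j < i then h j * h i else 0) =
      if j ≠ i then h i * h j else 0 := by
    intro j
    rcases lt_trichotomy i j with hj | hj | hj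
    · simp [hj, hj.not_gt, hj.ne']
    · simp [hj]
    · simp [hj, hj.not_gt, hj.ne, mul_comm]
  unfold skJ
  rw [Finset.sum_filter, Finset.sum_congr rfl fun e _ => h1 e, Finset.sum_add_distrib,
    Fintype.sum_prod_type, Fintype.sum_prod_type]
  simp only [Finset.sum_ite_irrel, Finset.sum_const_zero, Finset.sum_ite_eq', mem_univ, if_true]
  rw [← Finset.sum_add_distrib, Finset.sum_congr rfl fun j _ => h2 j, Finset.mul_sum,
    ← Finset.sum_filter]
  exact Finset.sum_congr (by ext; simp) fun _ _ => rfl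

/-- The couplings of the SK Hamiltonian. -/
def skc (N : ℕ) (β : ℝ) (e : Fin N × Fin N) (σ : Config N) : ℝ :=
  if e.1 < e.2 then β / √N * (spin (σ e.1) * spin (σ e.2)) else 0

lemma cavH_one_eq {S E : Type*} [Fintype E] [DecidableEq E] (c : E → S → ℝ) (J : Finset E)
    (g : E → ℝ) (s : S) : cavH c J 1 g s = ∑ e, g e * c e s := by
  simp [cavH]

lemma cavH_skc (β : ℝ) (J : Finset (Fin N × Fin N)) (g : Fin N × Fin N → ℝ) (σ : Config N) :
    cavH (skc N β) J 1 g σ = ham N β g σ := by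
  rw [cavH_one_eq]
  unfold skc ham
  rw [Finset.sum_filter, Finset.mul_sum]
  exact Finset.sum_congr rfl fun e _ => by split_ifs <;> ring

lemma sum_skJ_spin (i : Fin N) (β : ℝ) (σ τ : Config N) :
    ∑ e ∈ skJ i, skc N β e σ * skc N β e τ =
      β ^ 2 * (spin (σ i) * spin (τ i) * cavx i σ τ) := by
  have h0 : (β / √N) * (β / √N) = β ^ 2 / N := by
    rw [div_mul_div_comm, mul_self_sqrt (Nat.cast_nonneg _), sq]
  have h1 : ∀ e : Fin N × Fin N, skc N β e σ * skc N β e τ = β ^ 2 / N *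
      (if e.1 < e.2 then (spin (σ e.1) * spin (τ e.1)) * (spin (σ e.2) * spin (τ e.2)) else 0) := by
    intro e
    rw [← h0]
    unfold skc
    split_ifs <;> ring
  rw [Finset.sum_congr rfl fun e _ => h1 e, ← Finset.mul_sum,
    sum_skJ i fun j => spin (σ j) * spin (τ j)]
  unfold cavx
  ring

lemma cavK_skc (i : Fin N) (β : ℝ) (σ τ : Config N) :
    cavK (skc N β) (skJ i) σ τ = β ^ 2 * (spin (σ i) * spin (τ i) * cavx i σ τ) :=
  sum_skJ_spin i β σ τ

lemma skc_flipAt (i : Fin N) (β : ℝ) {e : Fin N × Fin N} (he : e ∉ skJ i) (σ : Config N) :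
    skc N β e (flipAt i σ) = skc N β e σ := by
  have : e.1 ≠ i ∧ e.2 ≠ i := by simpa [skJ, not_or] using he
  unfold skc
  rw [flipAt_of_ne this.1, flipAt_of_ne this.2]

lemma cavBd_skc (i : Fin N) {β : ℝ} (hβ : β ^ 2 ≤ 1) :
    CavBd (skc N β) (skJ i) 0 (fun σ τ => |cavx i σ τ|) 0 where
  diag := ⟨β ^ 2 * ((N - 1) / N), fun σ => by
    rw [cavK_skc, spin_mul_self, one_mul, cavx_self]; simp⟩
  off σ τ := by
    rw [cavK_skc, abs_mul, abs_mul, abs_spin_mul, one_mul, abs_of_nonneg (sq_nonneg β)]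
    nlinarith [abs_nonneg (cavx i σ τ)]
  kle := by simp
  ωle σ τ := (abs_cavx_le i σ τ).trans (by norm_num)
  ω₀le := by simp

/-- Powers of nonnegative overlap kernels are positive semidefinite. -/
lemma sum_sum_mul_overlap_pow_nonneg {S κ : Type*} [Fintype S] (J : Finset κ) (w : ℝ)
    (hw : 0 ≤ w) (v : κ → S → ℝ) (m : ℕ) (h : S → ℝ) :
    0 ≤ ∑ s, ∑ t, h s * h t * (w * ∑ j ∈ J, v j s * v j t) ^ m := by
  induction m generalizing h with
  | zero =>
    simp only [pow_zero, mul_one, ← Finset.mul_sum, ← Finset.sum_mul]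
    exact mul_self_nonneg _
  | succ m ih =>
    have : ∑ s, ∑ t, h s * h t * (w * ∑ j ∈ J, v j s * v j t) ^ (m + 1) =
        w * ∑ j ∈ J, ∑ s, ∑ t, (h s * v j s) * (h t * v j t) *
          (w * ∑ j ∈ J, v j s * v j t) ^ m := by
      have e : ∀ s t, h s * h t * (w * ∑ j ∈ J, v j s * v j t) ^ (m + 1) =
          ∑ j ∈ J, w * ((h s * v j s) * (h t * v j t) * (w * ∑ j ∈ J, v j s * v j t) ^ m) := by
        intro s t
        rw [← Finset.mul_sum, ← Finset.sum_mul, pow_succ]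
        have : ∑ j ∈ J, h s * v j s * (h t * v j t) = h s * h t * ∑ j ∈ J, v j s * v j t := by
          rw [Finset.mul_sum]
          exact Finset.sum_congr rfl fun j _ => by ring
        rw [this]
        ring
      simp_rw [e]
      rw [Finset.sum_congr rfl fun s _ => Finset.sum_comm, Finset.sum_comm]
      simp_rw [← Finset.mul_sum]
    rw [this]
    exact mul_nonneg hw (Finset.sum_nonneg fun j _ => ih _)

lemma sum_sum_mul_cavx_pow_nonneg (i : Fin N) (m : ℕ) (h : Config N → ℝ) :
    0 ≤ ∑ σ, ∑ τ, h σ * h τ * cavx i σ τ ^ m := by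
  have := sum_sum_mul_overlap_pow_nonneg (univ.erase i) (1 / N : ℝ) (by positivity)
    (fun j (σ : Config N) => spin (σ j)) m h
  simpa only [cavx, one_div, inv_mul_eq_div] using this

lemma sum_sum_mul_ovlp_pow_nonneg (m : ℕ) (h : Config N → ℝ) :
    0 ≤ ∑ σ, ∑ τ, h σ * h τ * ovlp N σ τ ^ m := by
  have := sum_sum_mul_overlap_pow_nonneg univ (1 / N : ℝ) (by positivity)
    (fun j (σ : Config N) => spin (σ j)) m h
  simpa only [ovlp, one_div, inv_mul_eq_div] using this

lemma av_cavx_triple_nonneg (i : Fin N) (m : ℕ) {p : Config N → ℝ} (hp : ∀ σ, 0 ≤ p σ)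
    (h1 : ∑ σ, p σ = 1) {b : Fin 10} (hb : 2 ≤ b) :
    0 ≤ av p (fun ρ : Fin 10 → Config N =>
      cavx i (ρ 0) (ρ 1) ^ m * cavx i (ρ 0) (ρ b) * cavx i (ρ 1) (ρ b)) := by
  have hb0 : (0 : Fin 10) ≠ b := by rintro rfl; revert hb; decide
  have hb1 : (1 : Fin 10) ≠ b := by rintro rfl; revert hb; decide
  rw [av_update h1 b, av_sum]
  refine Finset.sum_nonneg fun η _ => ?_
  simp only [Function.update_self, Function.update_of_ne hb0, Function.update_of_ne hb1]
  rw [av_const_mul, av_pair h1 (by decide : (0 : Fin 10) ≠ 1)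
    (fun σ τ => cavx i σ τ ^ m * cavx i σ η * cavx i τ η)]
  refine mul_nonneg (hp η) ?_
  have := sum_sum_mul_cavx_pow_nonneg i m fun σ => p σ * cavx i σ η
  refine this.trans_eq (Finset.sum_congr rfl fun σ _ => Finset.sum_congr rfl fun τ _ => by ring)

end SKCombinatorics

section PairAverages

variable {S E : Type*} [Fintype S] [Nonempty S] [Fintype E] [DecidableEq E]

/-- The disorder average of a function of two replicas at full coupling. -/
def E2 (c : E → S → ℝ) (F : S → S → ℝ) : ℝ :=
  ∫ g, ∑ s, ∑ t, softmax (fun s => ∑ e, g e * c e s) s *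
    softmax (fun s => ∑ e, g e * c e s) t * F s t ∂stdG E

variable {c : E → S → ℝ} {J : Finset E} {k : S → ℝ} {ω : S → S → ℝ} {ω₀ : S → ℝ}

lemma cphi_pair_one {ι : Type*} [Fintype ι] [DecidableEq ι] {a b : ι} (hab : a ≠ b)
    (F : S → S → ℝ) : cphi c J (fun ρ : ι → S => F (ρ a) (ρ b)) 1 = E2 c F := by
  unfold cphi E2
  refine integral_congr_ae (ae_of_all _ fun g => ?_)
  have : cavH c J 1 g = fun s => ∑ e, g e * c e s := funext fun s => cavH_one_eq c J g s
  simp only [this]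
  exact av_pair (sum_softmax _) hab F

lemma cphi_single_one {ι : Type*} [Fintype ι] [DecidableEq ι] {a b : ι} (hab : a ≠ b)
    (F : S → ℝ) : cphi c J (fun ρ : ι → S => F (ρ a)) 1 = E2 c fun s _ => F s :=
  cphi_pair_one (c := c) hab fun s _ => F s

lemma E2_eq_cphi (c : E → S → ℝ) (F : S → S → ℝ) :
    E2 c F = cphi c ∅ (fun ρ : Fin 2 → S => F (ρ 0) (ρ 1)) 1 :=
  (cphi_pair_one (by decide) F).symm

lemma E2_add (F G : S → S → ℝ) : E2 c (fun s t => F s t + G s t) = E2 c F + E2 c G := by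
  simp only [E2_eq_cphi, cphi_add]

lemma E2_const_mul (a : ℝ) (F : S → S → ℝ) : E2 c (fun s t => a * F s t) = a * E2 c F := by
  simp only [E2_eq_cphi, cphi_const_mul]

lemma E2_sum {κ : Type*} (t : Finset κ) (F : κ → S → S → ℝ) :
    E2 c (fun s s' => ∑ x ∈ t, F x s s') = ∑ x ∈ t, E2 c (F x) := by
  simp only [E2_eq_cphi, cphi_sum]

lemma E2_mono {F G : S → S → ℝ} (h : ∀ s t, F s t ≤ G s t) : E2 c F ≤ E2 c G := by
  simp only [E2_eq_cphi]
  exact cphi_mono (fun ρ => h _ _) 1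

lemma E2_nonneg {F : S → S → ℝ} (h : ∀ s t, 0 ≤ F s t) : 0 ≤ E2 c F := by
  simp only [E2_eq_cphi]
  exact cphi_nonneg (fun ρ => h _ _) 1

lemma E2_const (a : ℝ) : E2 c (fun _ _ => a) = a := by
  rw [E2_eq_cphi]
  unfold cphi
  simp [av_const (sum_softmax _)]

lemma cavW_eq_sum (ρ : Fin 10 → S) : cavW ω ω₀ ρ = ∑ p ∈ rep 8 ×ˢ rep 8,
    if p.1 = p.2 then ω₀ (ρ p.1) else ω (ρ p.1) (ρ p.2) := by
  rw [Finset.sum_product]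
  unfold cavW
  rw [← Finset.sum_add_distrib]
  refine Finset.sum_congr rfl fun a ha => ?_
  rw [← Finset.add_sum_erase _ _ ha, add_comm]
  simp only [if_true]
  congr 1
  exact Finset.sum_congr rfl fun b hb => by rw [if_neg (Finset.ne_of_mem_erase hb).symm]

lemma cphi_cavW_pow_le (hK : CavBd c J k ω ω₀) (M : ℕ) :
    cphi c J (fun ρ => cavW ω ω₀ ρ ^ (M + 1)) 1 ≤ 64 ^ (M + 1) *
      (E2 c (fun s t => ω s t ^ (M + 1)) + E2 c (fun s _ => ω₀ s ^ (M + 1))) := by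
  have hcard : #(rep 8 ×ˢ rep 8) = 64 := by decide
  have h1 : ∀ ρ : Fin 10 → S, cavW ω ω₀ ρ ^ (M + 1) ≤ 64 ^ M * ∑ p ∈ rep 8 ×ˢ rep 8,
      if p.1 = p.2 then ω₀ (ρ p.1) ^ (M + 1) else ω (ρ p.1) (ρ p.2) ^ (M + 1) := by
    intro ρ
    have := pow_sum_div_card_le_sum_pow (s := rep 8 ×ˢ rep 8)
      (f := fun p => if p.1 = p.2 then ω₀ (ρ p.1) else ω (ρ p.1) (ρ p.2)) (fun p _ => by
        split_ifs
        · exact hK.ω₀_nonneg _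
        · exact hK.ω_nonneg _ _) M
    rw [hcard, ← cavW_eq_sum, div_le_iff₀ (by positivity)] at this
    refine this.trans_eq ?_
    rw [mul_comm]
    push_cast
    congr 1
  refine (cphi_mono h1 1).trans ?_
  rw [cphi_const_mul, cphi_sum]
  have ha : 0 ≤ E2 c (fun s t => ω s t ^ (M + 1)) := E2_nonneg fun s t => pow_nonneg (hK.ω_nonneg _ _) _
  have hb : 0 ≤ E2 c (fun s _ => ω₀ s ^ (M + 1)) := E2_nonneg fun s t => pow_nonneg (hK.ω₀_nonneg _) _
  have h2 : ∀ p ∈ rep 8 ×ˢ rep 8, cphi c J (fun ρ => if p.1 = p.2 then ω₀ (ρ p.1) ^ (M + 1)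
      else ω (ρ p.1) (ρ p.2) ^ (M + 1)) 1 ≤
      E2 c (fun s t => ω s t ^ (M + 1)) + E2 c (fun s _ => ω₀ s ^ (M + 1)) := by
    intro p _
    by_cases h : p.1 = p.2
    · simp only [h, if_true]
      obtain ⟨b, hb'⟩ := exists_ne p.2
      rw [cphi_single_one hb'.symm fun s => ω₀ s ^ (M + 1)]
      linarith
    · simp only [h, if_false]
      rw [cphi_pair_one h fun s t => ω s t ^ (M + 1)]
      linarith
  have := Finset.sum_le_card_nsmul _ _ _ h2
  rw [hcard, nsmul_eq_mul] at this
  rw [pow_succ, mul_assoc]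
  exact mul_le_mul_of_nonneg_left (by exact_mod_cast this) (by positivity)

end PairAverages

section SingleMoments

variable {N : ℕ}

instance : Nonempty (Config N) := ⟨fun _ => true⟩

lemma abs_pow_mul_pow_le {x y : ℝ} (hy : 0 ≤ y) (m n : ℕ) :
    |x| ^ m * y ^ n ≤ |x| ^ (m + n) + y ^ (m + n) := by
  have hx := abs_nonneg x
  rcases le_total |x| y with h | h
  · calc |x| ^ m * y ^ n ≤ y ^ m * y ^ n := by gcongr
      _ = y ^ (m + n) := (pow_add _ _ _).symm
      _ ≤ _ := le_add_of_nonneg_left (by positivity)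
  · calc |x| ^ m * y ^ n ≤ |x| ^ m * |x| ^ n := by gcongr
      _ = |x| ^ (m + n) := (pow_add _ _ _).symm
      _ ≤ _ := le_add_of_nonneg_right (by positivity)

/-- The cavity inequality for odd moments of the reduced overlap. -/
lemma E2_spin_mul_cavx_pow_le (i : Fin N) {β : ℝ} (hβ0 : 0 < β) (hβ : β ^ 2 ≤ 1) (n : ℕ) :
    E2 (skc N β) (fun σ τ => spin (σ i) * spin (τ i) * cavx i σ τ ^ (2 * n + 1)) ≤
      β ^ 2 * E2 (skc N β) (fun σ τ => cavx i σ τ ^ (2 * n + 2)) +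
      342 * cavC * (1 + 64 ^ (2 * n + 4)) *
        E2 (skc N β) (fun σ τ => cavx i σ τ ^ (2 * n + 4)) := by
  set c := skc N β
  have hK := cavBd_skc i hβ
  have hu : 0 < β ^ 2 := by positivity
  have hsq : ∀ σ τ : Config N, (spin (σ i) * spin (τ i)) * (spin (σ i) * spin (τ i)) = 1 := by
    intro σ τ
    rw [mul_mul_mul_comm, spin_mul_self, spin_mul_self, one_mul]
  have key := cphi_le_of_sign hK (flipAt_involutive i) (fun e he σ => skc_flipAt i β he σ)
    (fun s t => by
      rw [cavK_skc, cavK_skc, spin_flipAt_self, cavx_flipAt_left]; ring)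
    (V := fun s t => cavx i s t ^ (2 * n))
    (fun s t => by simp only [cavx_flipAt_left]) (fun s t => by simp only [cavx_flipAt_right])
    (fun b hb hb2 => by
      refine integral_nonneg fun g => ?_
      have := av_cavx_triple_nonneg i (2 * n + 1) (softmax_nonneg (cavH (skc N β) (skJ i) 0 g))
        (sum_softmax _) hb2
      have h2 := mul_nonneg (pow_nonneg hu.le 3) this
      rw [← av_const_mul] at h2
      refine h2.trans_eq ?_
      congr 1
      funext ρ
      simp only [cavK_skc]
      have e0 := spin_mul_self (ρ 0 i)
      have e1 := spin_mul_self (ρ 1 i)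
      have eb := spin_mul_self (ρ b i)
      calc _ = (β ^ 2) ^ 3 * (cavx i (ρ 0) (ρ 1) ^ (2 * n + 1) * cavx i (ρ 0) (ρ b) *
            cavx i (ρ 1) (ρ b)) * ((spin (ρ 0 i) * spin (ρ 0 i)) *
            (spin (ρ 1 i) * spin (ρ 1 i)) * (spin (ρ b i) * spin (ρ b i))) := by
              rw [e0, e1, eb]; ring
        _ = _ := by ring)
  have hf : ∀ ρ : Fin 10 → Config N, cavK (skc N β) (skJ i) (ρ 0) (ρ 1) * cavx i (ρ 0) (ρ 1) ^ (2 * n) =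
      β ^ 2 * (spin (ρ 0 i) * spin (ρ 1 i) * cavx i (ρ 0) (ρ 1) ^ (2 * n + 1)) := by
    intro ρ
    rw [cavK_skc]; ring
  have hfK : ∀ ρ : Fin 10 → Config N, cavK (skc N β) (skJ i) (ρ 0) (ρ 1) *
      cavx i (ρ 0) (ρ 1) ^ (2 * n) * cavK (skc N β) (skJ i) (ρ 0) (ρ 1) =
      β ^ 2 * (β ^ 2 * cavx i (ρ 0) (ρ 1) ^ (2 * n + 2)) := by
    intro ρ
    rw [hf, cavK_skc]
    calc _ = β ^ 2 * (β ^ 2 * cavx i (ρ 0) (ρ 1) ^ (2 * n + 2)) *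
          ((spin (ρ 0 i) * spin (ρ 1 i)) * (spin (ρ 0 i) * spin (ρ 1 i))) := by ring
      _ = _ := by rw [hsq, mul_one]
  simp only [hfK] at key
  simp only [hf] at key
  have herr : cphi c (skJ i) (fun ρ : Fin 10 → Config N =>
      |β ^ 2 * (spin (ρ 0 i) * spin (ρ 1 i) * cavx i (ρ 0) (ρ 1) ^ (2 * n + 1))| *
        cavW (fun σ τ => |cavx i σ τ|) 0 ρ ^ 3) 1 ≤
      β ^ 2 * ((1 + 64 ^ (2 * n + 4)) * E2 c (fun σ τ => cavx i σ τ ^ (2 * n + 4))) := by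
    have hev : ∀ σ τ : Config N, |cavx i σ τ| ^ (2 * n + 4) = cavx i σ τ ^ (2 * n + 4) :=
      fun σ τ => Even.pow_abs (by exact ⟨n + 2, by ring⟩) _
    have h1 := cphi_cavW_pow_le hK (2 * n + 3)
    simp only [Pi.zero_apply, show 2 * n + 3 + 1 = 2 * n + 4 from rfl, hev] at h1
    rw [E2_const, zero_pow (by omega), add_zero] at h1
    rw [add_mul, one_mul]
    have h0 : cphi c (skJ i) (fun ρ : Fin 10 → Config N => cavx i (ρ 0) (ρ 1) ^ (2 * n + 4)) 1 =
      E2 c (fun σ τ => cavx i σ τ ^ (2 * n + 4)) :=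
        cphi_pair_one (by decide) fun σ τ => cavx i σ τ ^ (2 * n + 4)
    refine le_trans ?_ (mul_le_mul_of_nonneg_left (add_le_add h0.le h1) hu.le)
    rw [← cphi_add, ← cphi_const_mul]
    refine cphi_mono (fun ρ => ?_) 1
    rw [abs_mul, abs_mul, abs_spin_mul, one_mul, abs_of_nonneg hu.le, abs_pow, mul_assoc, ← hev]
    exact mul_le_mul_of_nonneg_left (abs_pow_mul_pow_le (hK.cavW_nonneg ρ) (2 * n + 1) 3) hu.le
  rw [cphi_const_mul, cphi_const_mul,
    cphi_pair_one (by decide) fun σ τ => spin (σ i) * spin (τ i) * cavx i σ τ ^ (2 * n + 1),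
    cphi_const_mul, cphi_pair_one (by decide) fun σ τ => cavx i σ τ ^ (2 * n + 2)] at key
  have := key.trans (add_le_add_right (mul_le_mul_of_nonneg_left herr
    (by have := cavC_pos; positivity)) _)
  refine le_of_mul_le_mul_left (this.trans_eq ?_) hu
  ring

end SingleMoments

section MomentRecursion

variable {N : ℕ}

/-- Comparison of powers of two nearby numbers. -/
lemma abs_pow_sub_pow_le_of_abs_sub_le {R x δ : ℝ} (hδ : 0 ≤ δ) (h : |R - x| ≤ δ) (m : ℕ) :
    |R ^ (m + 1) - x ^ (m + 1)| ≤ δ * ((m + 1) * 2 ^ m) * (|R| ^ m + δ ^ m) := by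
  have h1 := abs_pow_sub_pow_le R x (m + 1)
  rw [Nat.add_sub_cancel] at h1
  have h2 : max |R| |x| ≤ |R| + δ := by
    refine max_le (by linarith) ?_
    have : |x| ≤ |R| + |R - x| := by
      have := abs_sub_abs_le_abs_sub x R
      rw [abs_sub_comm] at this
      linarith
    linarith
  have h3 : (|R| + δ) ^ m ≤ 2 ^ m * (|R| ^ m + δ ^ m) := by
    refine (add_pow_le (abs_nonneg R) hδ m).trans ?_
    exact mul_le_mul_of_nonneg_right (pow_le_pow_right₀ one_le_two (Nat.sub_le m 1)) (by positivity)
  have h4 : max |R| |x| ^ m ≤ 2 ^ m * (|R| ^ m + δ ^ m) :=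
    (pow_le_pow_left₀ (le_max_of_le_left (abs_nonneg R)) h2 m).trans h3
  calc _ ≤ |R - x| * ↑(m + 1) * max |R| |x| ^ m := h1
    _ ≤ δ * ↑(m + 1) * (2 ^ m * (|R| ^ m + δ ^ m)) := by gcongr
    _ = _ := by push_cast; ring

lemma abs_ovlp_sub_cavx (i : Fin N) (σ τ : Config N) : |ovlp N σ τ - cavx i σ τ| ≤ 1 / N := by
  rw [ovlp_eq_cavx_add i, add_sub_cancel_left, abs_div, abs_spin_mul, Nat.abs_cast]

lemma cavx_pow_le (i : Fin N) (σ τ : Config N) (n : ℕ) :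
    cavx i σ τ ^ (2 * n) ≤ 2 ^ (2 * n) * (ovlp N σ τ ^ (2 * n) + (1 / N) ^ (2 * n)) := by
  have h1 : |cavx i σ τ| ≤ |ovlp N σ τ| + 1 / N := by
    have := abs_sub_abs_le_abs_sub (cavx i σ τ) (ovlp N σ τ)
    rw [abs_sub_comm] at this
    linarith [abs_ovlp_sub_cavx i σ τ]
  have h2 := pow_le_pow_left₀ (abs_nonneg _) h1 (2 * n)
  rw [Even.pow_abs (even_two_mul n)] at h2
  refine h2.trans ((add_pow_le (abs_nonneg _) (by positivity) _).trans ?_)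
  rw [Even.pow_abs (even_two_mul n)]
  have : 0 ≤ ovlp N σ τ ^ (2 * n) := Even.pow_nonneg (even_two_mul n) _
  exact mul_le_mul_of_nonneg_right (pow_le_pow_right₀ one_le_two (Nat.sub_le _ 1)) (by positivity)

/-- The overlap moments of the SK model. -/
def skMom (N : ℕ) (β : ℝ) (m : ℕ) : ℝ := E2 (skc N β) fun σ τ => ovlp N σ τ ^ m

lemma skMom_nonneg (β : ℝ) (n : ℕ) : 0 ≤ skMom N β (2 * n) :=
  E2_nonneg fun _ _ => Even.pow_nonneg (even_two_mul n) _

lemma skMom_zero (β : ℝ) : skMom N β 0 = 1 := by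
  unfold skMom
  simp only [pow_zero]
  exact E2_const 1

lemma pow_ovlp_eq_sum (m : ℕ) (σ τ : Config N) : ovlp N σ τ ^ (m + 1) =
    (1 / N : ℝ) * ∑ i, spin (σ i) * spin (τ i) * ovlp N σ τ ^ m := by
  rw [← Finset.sum_mul, pow_succ']
  unfold ovlp
  ring

/-- The constant in the moment recursion. -/
def momC (n : ℕ) : ℝ :=
  (2 * n + 1) * 2 ^ (2 * n) + (2 * n + 2) * 2 ^ (2 * n + 1) +
    342 * cavC * (1 + 64 ^ (2 * n + 4)) * 2 ^ (2 * n + 4)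

lemma momC_pos (n : ℕ) : 0 < momC n := by
  have := cavC_pos
  unfold momC
  positivity

lemma skMom_recursion (hN : 1 ≤ N) {β : ℝ} (hβ0 : 0 < β) (hβ : β ^ 2 ≤ 1) (n : ℕ) :
    (1 - β ^ 2) * skMom N β (2 * n + 2) ≤
      momC n * ((1 / N) * skMom N β (2 * n) + (1 / N) ^ (2 * n + 1) + skMom N β (2 * n + 4)) := by
  set δ : ℝ := 1 / N with hδ
  have hδ0 : 0 ≤ δ := by positivity
  have hN' : (1 : ℝ) ≤ N := by exact_mod_cast hN
  have hδ1 : δ ≤ 1 := by rw [hδ, div_le_one (by linarith)]; exact hN'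
  set c := skc N β
  have hcC := cavC_pos
  set C3 : ℝ := 342 * cavC * (1 + 64 ^ (2 * n + 4)) with hC3
  have hC30 : 0 ≤ C3 := by positivity
  set Q : ℝ := skMom N β (2 * n) + δ ^ (2 * n) with hQ
  have hQE : ∀ (a : ℝ), E2 c (fun σ τ => a * (ovlp N σ τ ^ (2 * n) + δ ^ (2 * n))) = a * Q := by
    intro a
    rw [E2_const_mul, E2_add, E2_const]; rfl
  have hQ0 : 0 ≤ Q := add_nonneg (skMom_nonneg β n) (by positivity)
  have hβ2 : 0 ≤ β ^ 2 := sq_nonneg β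
  have site : ∀ i : Fin N,
      E2 c (fun σ τ => spin (σ i) * spin (τ i) * ovlp N σ τ ^ (2 * n + 1)) ≤
      β ^ 2 * skMom N β (2 * n + 2) + δ * ((2 * n + 1) * 2 ^ (2 * n)) * Q
        + δ * ((2 * n + 2) * 2 ^ (2 * n + 1)) * Q
        + C3 * (2 ^ (2 * n + 4) * (skMom N β (2 * n + 4) + δ ^ (2 * n + 4))) := by
    intro i
    have p1 : E2 c (fun σ τ => spin (σ i) * spin (τ i) * ovlp N σ τ ^ (2 * n + 1)) ≤
        E2 c (fun σ τ => spin (σ i) * spin (τ i) * cavx i σ τ ^ (2 * n + 1)) +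
          δ * ((2 * n + 1) * 2 ^ (2 * n)) * Q := by
      rw [← hQE, ← E2_add]
      refine E2_mono fun σ τ => ?_
      have h1 := abs_pow_sub_pow_le_of_abs_sub_le hδ0 (abs_ovlp_sub_cavx i σ τ) (2 * n)
      rw [Even.pow_abs (even_two_mul n)] at h1
      push_cast at h1
      have h2 : spin (σ i) * spin (τ i) * (ovlp N σ τ ^ (2 * n + 1) - cavx i σ τ ^ (2 * n + 1)) ≤
          |ovlp N σ τ ^ (2 * n + 1) - cavx i σ τ ^ (2 * n + 1)| := by
        refine (le_abs_self _).trans ?_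
        rw [abs_mul, abs_spin_mul, one_mul]
      linarith
    have p2 : E2 c (fun σ τ => cavx i σ τ ^ (2 * n + 2)) ≤ skMom N β (2 * n + 2) +
        δ * ((2 * n + 2) * 2 ^ (2 * n + 1)) * Q := by
      rw [← hQE, skMom, ← E2_add]
      refine E2_mono fun σ τ => ?_
      have h1 := abs_pow_sub_pow_le_of_abs_sub_le hδ0 (abs_ovlp_sub_cavx i σ τ) (2 * n + 1)
      push_cast at h1
      have h3 : |ovlp N σ τ| ^ (2 * n + 1) ≤ ovlp N σ τ ^ (2 * n) := by
        rw [pow_succ, Even.pow_abs (even_two_mul n)]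
        exact mul_le_of_le_one_right (Even.pow_nonneg (even_two_mul n) _) (abs_ovlp_le σ τ)
      have h4 : δ ^ (2 * n + 1) ≤ δ ^ (2 * n) := pow_le_pow_of_le_one hδ0 hδ1 (by omega)
      have h5 := (neg_le_abs _).trans h1
      have h6 : δ * ((2 * n + 1 + 1) * 2 ^ (2 * n + 1)) *
          (|ovlp N σ τ| ^ (2 * n + 1) + δ ^ (2 * n + 1)) ≤ δ * ((2 * n + 1 + 1) * 2 ^ (2 * n + 1)) *
          (ovlp N σ τ ^ (2 * n) + δ ^ (2 * n)) := by gcongr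
      have h7 : (2 * (n : ℝ) + 2) = 2 * n + 1 + 1 := by ring
      rw [h7]
      have h8 : 2 * n + 1 + 1 = 2 * n + 2 := rfl
      rw [h8] at h5
      linarith
    have p3 : E2 c (fun σ τ => cavx i σ τ ^ (2 * n + 4)) ≤
        2 ^ (2 * n + 4) * (skMom N β (2 * n + 4) + δ ^ (2 * n + 4)) := by
      have : ∀ a : ℝ, a = E2 c fun _ _ => a := fun a => (E2_const a).symm
      rw [skMom, this (δ ^ (2 * n + 4)), ← E2_add, ← E2_const_mul]
      exact E2_mono fun σ τ => cavx_pow_le i σ τ (n + 2)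
    have := E2_spin_mul_cavx_pow_le i hβ0 hβ n
    have q2 := mul_le_mul_of_nonneg_left p2 hβ2
    have q3 := mul_le_mul_of_nonneg_left p3 hC30
    have q4 : β ^ 2 * (δ * ((2 * n + 2) * 2 ^ (2 * n + 1)) * Q) ≤
        δ * ((2 * n + 2) * 2 ^ (2 * n + 1)) * Q := mul_le_of_le_one_left (by positivity) hβ
    linarith
  have hsum : skMom N β (2 * n + 2) = δ * ∑ i : Fin N,
      E2 c (fun σ τ => spin (σ i) * spin (τ i) * ovlp N σ τ ^ (2 * n + 1)) := by
    rw [← E2_sum, ← E2_const_mul, skMom]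
    congr 1
    funext σ τ
    exact pow_ovlp_eq_sum (2 * n + 1) σ τ
  have hle := Finset.sum_le_card_nsmul univ _ _ fun i _ => site i
  rw [Finset.card_univ, Fintype.card_fin, nsmul_eq_mul] at hle
  have h2 := mul_le_mul_of_nonneg_left hle hδ0
  rw [← hsum, ← mul_assoc, show δ * (N : ℝ) = 1 by rw [hδ]; field_simp, one_mul] at h2
  have hd4 : δ ^ (2 * n + 4) ≤ δ ^ (2 * n + 1) := pow_le_pow_of_le_one hδ0 hδ1 (by omega)
  have hd1 : δ * δ ^ (2 * n) = δ ^ (2 * n + 1) := by ring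
  have hm4 : 0 ≤ skMom N β (2 * n + 4) := skMom_nonneg β (n + 2)
  have hm0 : 0 ≤ skMom N β (2 * n) := skMom_nonneg β n
  have e1 : δ * ((2 * n + 1) * 2 ^ (2 * n)) * Q =
    ((2 * n + 1) * 2 ^ (2 * n)) * (δ * skMom N β (2 * n) + δ ^ (2 * n + 1)) := by rw [hQ]; ring
  have e2 : δ * ((2 * n + 2) * 2 ^ (2 * n + 1)) * Q =
    ((2 * n + 2) * 2 ^ (2 * n + 1)) * (δ * skMom N β (2 * n) + δ ^ (2 * n + 1)) := by rw [hQ]; ring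
  rw [e1, e2] at h2
  have e3 : C3 * (2 ^ (2 * n + 4) * (skMom N β (2 * n + 4) + δ ^ (2 * n + 4))) ≤
      C3 * (2 ^ (2 * n + 4) * (skMom N β (2 * n + 4) + δ ^ (2 * n + 1))) := by gcongr
  have e4 : 0 ≤ ((2 * n + 1) * 2 ^ (2 * n) + (2 * n + 2) * 2 ^ (2 * n + 1)) *
    skMom N β (2 * n + 4) := by positivity
  have e5 : 0 ≤ C3 * 2 ^ (2 * n + 4) * (δ * skMom N β (2 * n)) := by positivity
  unfold momC
  rw [← hC3]
  nlinarith [h2, e3, e4, e5]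

end MomentRecursion

section OverlapTail

variable {N : ℕ}

/-- A common constant for the first five moment recursions. -/
def momD : ℝ := ∑ n ∈ range 5, momC n

lemma momD_pos : 0 < momD := sum_pos (fun n _ => momC_pos n) (by simp)

lemma momC_le_momD {n : ℕ} (hn : n < 5) : momC n ≤ momD :=
  single_le_sum (f := momC) (fun n _ => (momC_pos n).le) (by simpa using hn)

/-- The averaged Gibbs probability that the overlap of two replicas exceeds `r`. -/
def skTail (N : ℕ) (β r : ℝ) : ℝ :=
  E2 (skc N β) fun σ τ => if r < |ovlp N σ τ| then 1 else 0

lemma skMom_add_four_le (β : ℝ) {r : ℝ} (hr : 0 ≤ r) (n : ℕ) :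
    skMom N β (2 * n + 4) ≤ r ^ 2 * skMom N β (2 * n + 2) + skTail N β r := by
  unfold skMom skTail
  rw [← E2_const_mul, ← E2_add]
  refine E2_mono fun σ τ => ?_
  have h1 := abs_ovlp_le σ τ
  have e1 : ovlp N σ τ ^ (2 * n + 4) = (ovlp N σ τ ^ 2) ^ (n + 2) := by rw [← pow_mul]; ring_nf
  have e2 : ovlp N σ τ ^ (2 * n + 2) = (ovlp N σ τ ^ 2) ^ (n + 1) := by rw [← pow_mul]; ring_nf
  have h0 := sq_nonneg (ovlp N σ τ)
  have hs : ovlp N σ τ ^ 2 ≤ 1 := (sq_le_one_iff_abs_le_one _).2 h1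
  rw [e1, e2]
  split_ifs with h
  · have : (ovlp N σ τ ^ 2) ^ (n + 2) ≤ 1 := pow_le_one₀ h0 hs
    have : 0 ≤ r ^ 2 * (ovlp N σ τ ^ 2) ^ (n + 1) := by positivity
    linarith
  · have h2 : ovlp N σ τ ^ 2 ≤ r ^ 2 := sq_le_sq.2 (by rw [abs_of_nonneg hr]; exact not_lt.1 h)
    rw [pow_succ, add_zero, mul_comm]
    exact mul_le_mul_of_nonneg_right h2 (by positivity)

/-- Overlap moments are controlled at the scale `(N (1 - β²))⁻¹` once large overlaps are rare. -/
lemma skMom_le_of_tail (hN : 1 ≤ N) {β : ℝ} (hβ0 : 0 < β) (hβ1 : β < 1) {r : ℝ} (hr : 0 ≤ r)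
    (hD : momD * r ^ 2 ≤ (1 - β ^ 2) / 2) (ht : skTail N β r ≤ (1 / N : ℝ) ^ 5) {k : ℕ}
    (hk : k ≤ 5) :
    skMom N β (2 * k) ≤ (6 * momD + 1) ^ k * (1 / (N * (1 - β ^ 2))) ^ k := by
  have ha : 0 < 1 - β ^ 2 := by nlinarith
  have hN' : (1 : ℝ) ≤ N := by exact_mod_cast hN
  have hD0 := momD_pos
  set a := 1 - β ^ 2 with ha_def
  have ha1 : a ≤ 1 := by rw [ha_def]; nlinarith
  induction k with
  | zero => simp [skMom_zero]
  | succ n ih =>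
    have ih := ih (by omega)
    have hrec := skMom_recursion hN hβ0 (by nlinarith : β ^ 2 ≤ 1) n
    have h4 := skMom_add_four_le (N := N) β hr n
    have hm := momC_le_momD (show n < 5 by omega)
    have hmp := momC_pos n
    have hM : 0 ≤ skMom N β (2 * n + 2) := skMom_nonneg β (n + 1)
    have hq0 : (0 : ℝ) ≤ 1 / N := by positivity
    have hq1 : (1 : ℝ) / N ≤ 1 := by rw [div_le_one (by linarith)]; exact hN'
    have p1 : (1 / N : ℝ) ^ 5 ≤ (1 / N) ^ (n + 1) := pow_le_pow_of_le_one hq0 hq1 (by omega)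
    have p2 : (1 / N : ℝ) ^ (2 * n + 1) ≤ (1 / N) ^ (n + 1) :=
      pow_le_pow_of_le_one hq0 hq1 (by omega)
    have hz : (1 : ℝ) / N ≤ 1 / (N * a) :=
      one_div_le_one_div_of_le (by positivity) (by nlinarith)
    have p3 : (1 / N : ℝ) ^ n ≤ (1 / (N * a)) ^ n := pow_le_pow_left₀ hq0 hz n
    have p4 : (1 / N : ℝ) ^ (n + 1) = (1 / N) * (1 / N) ^ n := by ring
    have hC1 : 1 ≤ (6 * momD + 1) ^ n := one_le_pow₀ (by linarith)
    have hw : 0 ≤ (1 / (N * a)) ^ n := by positivity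
    have hX : 1 / (N : ℝ) * skMom N β (2 * n) + (1 / N) ^ (2 * n + 1) + skTail N β r ≤
        3 * (1 / N) * ((6 * momD + 1) ^ n * (1 / (N * a)) ^ n) := by
      have b1 : 1 / (N : ℝ) * skMom N β (2 * n) ≤
          1 / N * ((6 * momD + 1) ^ n * (1 / (N * a)) ^ n) := mul_le_mul_of_nonneg_left ih hq0
      have b2 : (1 / N : ℝ) ^ (n + 1) ≤ 1 / N * ((6 * momD + 1) ^ n * (1 / (N * a)) ^ n) := by
        rw [p4]
        refine mul_le_mul_of_nonneg_left (p3.trans ?_) hq0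
        nlinarith
      linarith
    have hmain : a / 2 * skMom N β (2 * n + 2) ≤
        momD * (3 * (1 / N) * ((6 * momD + 1) ^ n * (1 / (N * a)) ^ n)) := by
      have s1 : momC n * (r ^ 2 * skMom N β (2 * n + 2)) ≤ a / 2 * skMom N β (2 * n + 2) := by
        rw [← mul_assoc]
        exact mul_le_mul_of_nonneg_right
          ((mul_le_mul_of_nonneg_right hm (sq_nonneg r)).trans hD) hM
      have s2 : momC n * (1 / (N : ℝ) * skMom N β (2 * n) + (1 / N) ^ (2 * n + 1) +
          skMom N β (2 * n + 4)) ≤ momC n * (1 / (N : ℝ) * skMom N β (2 * n) +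
          (1 / N) ^ (2 * n + 1) + (r ^ 2 * skMom N β (2 * n + 2) + skTail N β r)) := by gcongr
      have s3 := mul_le_mul hm hX ?_ hD0.le
      · nlinarith
      · have := skMom_nonneg (N := N) β n
        have : 0 ≤ skTail N β r := E2_nonneg fun _ _ => by split_ifs <;> norm_num
        positivity
    have e : skMom N β (2 * (n + 1)) = (2 / a) * (a / 2 * skMom N β (2 * n + 2)) := by
      rw [show 2 * (n + 1) = 2 * n + 2 by ring]; field_simp
    rw [e]
    calc (2 / a) * (a / 2 * skMom N β (2 * n + 2)) ≤
        (2 / a) * (momD * (3 * (1 / N) * ((6 * momD + 1) ^ n * (1 / (N * a)) ^ n))) := by gcongr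
      _ = (6 * momD) * ((6 * momD + 1) ^ n * (1 / (N * a)) ^ n * (1 / (N * a))) := by
        field_simp; ring
      _ ≤ (6 * momD + 1) * ((6 * momD + 1) ^ n * (1 / (N * a)) ^ n * (1 / (N * a))) := by
        gcongr; linarith
      _ = _ := by ring

end OverlapTail

section GaussianRotation

variable {E : Type*} [Fintype E] [DecidableEq E]

instance isGaussian_stdG : IsGaussian (stdG E) := by
  have h : iIndepFun (fun (e : E) (x : E → ℝ) => x e) (stdG E) :=
    iIndepFun_pi (X := fun (e : E) (t : ℝ) => t) fun e => aemeasurable_id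
  have h2 : HasGaussianLaw (fun (x : E → ℝ) (e : E) => x e) (stdG E) := by
    refine h.hasGaussianLaw fun e => ⟨?_⟩
    rw [(measurePreserving_eval (fun _ : E => gaussianReal 0 1) e).map_eq]
    infer_instance
  simpa using h2.isGaussian_map

lemma integral_id_stdG : ∫ x, id x ∂stdG E = 0 := by
  have hi : Integrable (id : (E → ℝ) → E → ℝ) (stdG E) := IsGaussian.integrable_id
  ext e
  have := (ContinuousLinearMap.proj (R := ℝ) (φ := fun _ : E => ℝ) e).integral_comp_comm hi
  simp only [ContinuousLinearMap.proj_apply, id] at this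
  simp only [id, Pi.zero_apply]
  rw [← this]
  have h1 := (measurePreserving_eval (fun _ : E => gaussianReal 0 1) e)
  have := integral_map (μ := stdG E) (φ := Function.eval e) (f := fun t : ℝ => t)
    h1.measurable.aemeasurable (by fun_prop)
  rw [h1.map_eq] at this
  simp only [Function.eval] at this
  rw [← this, integral_id_gaussianReal]

lemma integral_rotate (f : (E → ℝ) × (E → ℝ) → ℝ) (hf : Measurable f) (θ : ℝ) :
    ∫ p, f (cos θ • p.1 + sin θ • p.2, -sin θ • p.1 + cos θ • p.2) ∂(stdG E).prod (stdG E) =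
      ∫ p, f p ∂(stdG E).prod (stdG E) := by
  conv_rhs => rw [← IsGaussian.map_rotation_eq_self integral_id_stdG θ]
  rw [integral_map (by fun_prop) hf.aestronglyMeasurable]
  rfl

/-- `F` is continuously differentiable with bounded partial derivatives `F'`. -/
structure HasGrad (F : (E → ℝ) → ℝ) (F' : (E → ℝ) → E → ℝ) (C : ℝ) : Prop where
  deriv : ∀ x, HasFDerivAt F
    (∑ e, F' x e • (ContinuousLinearMap.proj e : (E → ℝ) →L[ℝ] ℝ)) x
  cont : ∀ e, Continuous fun x => F' x e
  bdd : ∀ x e, |F' x e| ≤ C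

namespace HasGrad

variable {F G : (E → ℝ) → ℝ} {F' G' : (E → ℝ) → E → ℝ} {C D : ℝ}

lemma continuous (hF : HasGrad F F' C) : Continuous F :=
  continuous_iff_continuousAt.2 fun x => (hF.deriv x).continuousAt

lemma hasDerivAt_comp (hF : HasGrad F F' C) {x : ℝ → E → ℝ} {x' : E → ℝ} {t : ℝ}
    (hx : HasDerivAt x x' t) : HasDerivAt (fun s => F (x s)) (∑ e, F' (x t) e * x' e) t := by
  refine ((hF.deriv (x t)).comp_hasDerivAt t hx).congr_deriv ?_
  simp

lemma hasDerivAt_line (hF : HasGrad F F' C) (x y : E → ℝ) (t : ℝ) :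
    HasDerivAt (fun s => F (x + s • y)) (∑ e, F' (x + t • y) e * y e) t := by
  refine hF.hasDerivAt_comp (x := fun s => x + s • y) ?_
  simpa using ((hasDerivAt_id t).smul_const y).const_add x

lemma abs_sub_le (hF : HasGrad F F' C) (x y : E → ℝ) :
    |F (x + y) - F x| ≤ C * ∑ e, |y e| := by
  have h := Convex.norm_image_sub_le_of_norm_hasDerivWithin_le (s := Set.univ) (x := 0) (y := 1)
    (f := fun s : ℝ => F (x + s • y)) (C := C * ∑ e, |y e|)
    (fun t _ => (hF.hasDerivAt_line x y t).hasDerivWithinAt) (fun t _ => ?_) convex_univ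
    (Set.mem_univ _) (Set.mem_univ _)
  · simpa using h
  · rw [norm_eq_abs, mul_sum]
    refine (abs_sum_le_sum_abs _ _).trans (sum_le_sum fun e _ => ?_)
    rw [abs_mul]
    exact mul_le_mul_of_nonneg_right (hF.bdd _ _) (abs_nonneg _)

lemma abs_le (hF : HasGrad F F' C) (x : E → ℝ) : |F x| ≤ |F 0| + C * ∑ e, |x e| := by
  have h := hF.abs_sub_le 0 x
  rw [zero_add] at h
  have := abs_sub_abs_le_abs_sub (F x) (F 0)
  linarith

lemma integrable (hF : HasGrad F F' C) : Integrable F (stdG E) := by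
  refine Integrable.mono' (g := fun x => |F 0| + C * ∑ e, |x e|) ?_
    hF.continuous.aestronglyMeasurable (ae_of_all _ fun x => hF.abs_le x)
  exact (integrable_const _).add
    ((integrable_finsetSum _ fun e _ => (integrable_eval_stdG e).abs).const_mul _)

lemma bound_nonneg (hF : HasGrad F F' C) (e : E) : 0 ≤ C := (abs_nonneg _).trans (hF.bdd 0 e)

/-- Gaussian covariance along a rotation: the derivative of the correlation function. -/
lemma integral_mul_rotate_ibp (hF : HasGrad F F' C) (hG : HasGrad G G' D) {B : ℝ}
    (hB : ∀ x, |G x| ≤ B) (θ : ℝ) (e : E) :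
    ∫ p, G p.1 * F' (cos θ • p.1 + sin θ • p.2) e * ((-sin θ • p.1 + cos θ • p.2) e)
        ∂(stdG E).prod (stdG E) =
      -sin θ * ∫ p, G' p.1 e * F' (cos θ • p.1 + sin θ • p.2) e ∂(stdG E).prod (stdG E) := by
  have hGc := hG.continuous
  have hFc := hF.cont
  have hGc' := hG.cont
  have hrot : ∀ p : (E → ℝ) × (E → ℝ), p.1 = cos θ • (cos θ • p.1 + sin θ • p.2) -
      sin θ • (-sin θ • p.1 + cos θ • p.2) := by
    intro p; ext e
    simp only [Pi.add_apply, Pi.sub_apply, Pi.smul_apply, smul_eq_mul]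
    linear_combination (-(p.1 e)) * (sin_sq_add_cos_sq θ)
  have h1 := integral_rotate (E := E)
    (fun q => G (cos θ • q.1 - sin θ • q.2) * F' q.1 e * q.2 e) (by
      have := (hFc e).measurable; have := hGc.measurable; fun_prop) θ
  have h2 := integral_rotate (E := E)
    (fun q => G' (cos θ • q.1 - sin θ • q.2) e * F' q.1 e) (by
      have := (hFc e).measurable; have := (hGc' e).measurable; fun_prop) θ
  simp only [← hrot] at h1 h2
  rw [h1, h2, ← integral_const_mul]
  have hD := hG.bound_nonneg e
  have hC := hF.bound_nonneg e
  have hB0 : 0 ≤ B := (abs_nonneg _).trans (hB 0)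
  have hInt1 : Integrable (fun q : (E → ℝ) × (E → ℝ) =>
      G (cos θ • q.1 - sin θ • q.2) * F' q.1 e * q.2 e) ((stdG E).prod (stdG E)) := by
    have hq : Integrable (fun q : (E → ℝ) × (E → ℝ) => q.2 e) ((stdG E).prod (stdG E)) :=
      (integrable_eval_stdG e).comp_snd _
    refine hq.bdd_mul (c := B * C) (Continuous.aestronglyMeasurable ?_) (ae_of_all _ fun q => ?_)
    · have := hFc e; fun_prop
    · rw [norm_mul]
      exact mul_le_mul (hB _) (hF.bdd _ _) (abs_nonneg _) hB0
  have hInt2 : Integrable (fun q : (E → ℝ) × (E → ℝ) =>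
      -sin θ * (G' (cos θ • q.1 - sin θ • q.2) e * F' q.1 e)) ((stdG E).prod (stdG E)) := by
    refine (Integrable.of_bound (C := D * C) (Continuous.aestronglyMeasurable ?_)
      (ae_of_all _ fun q => ?_)).const_mul _
    · have := hFc e; have := hGc' e; fun_prop
    · rw [norm_mul]
      exact mul_le_mul (hG.bdd _ _) (hF.bdd _ _) (abs_nonneg _) hD
  rw [integral_prod _ hInt1, integral_prod _ hInt2]
  refine integral_congr_ae (ae_of_all _ fun x => ?_)
  simp only
  have := integral_stdG_mul_eq_deriv (E := E) e
    (Φ := fun y => G (cos θ • x - sin θ • y) * F' x e)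
    (Φ' := fun y => -sin θ * (G' (cos θ • x - sin θ • y) e * F' x e)) (C := max (B * C) (D * C))
    (by have := hGc.measurable; fun_prop)
    (by have := (hGc' e).measurable; fun_prop) ?_ ?_ ?_
  · rw [← this]
    exact integral_congr_ae (ae_of_all _ fun y => by ring)
  · intro y t
    have hu : HasDerivAt (fun s => cos θ • x - sin θ • Function.update y e s)
        (-(sin θ • Pi.single e 1)) t :=
      ((hasDerivAt_update y e t).const_smul (sin θ)).const_sub _
    refine ((hG.hasDerivAt_comp hu).mul_const _).congr_deriv ?_
    simp [Pi.single_apply]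
    ring
  · intro y
    rw [abs_mul]
    exact (mul_le_mul (hB _) (hF.bdd _ _) (abs_nonneg _) hB0).trans (le_max_left _ _)
  · intro y
    rw [abs_mul, abs_mul, abs_neg]
    refine le_trans ?_ (le_max_right _ _)
    have h3 : |G' (cos θ • x - sin θ • y) e| * |F' x e| ≤ D * C :=
      mul_le_mul (hG.bdd _ _) (hF.bdd _ _) (abs_nonneg _) hD
    calc _ ≤ 1 * (|G' (cos θ • x - sin θ • y) e| * |F' x e|) := by
          gcongr; exact abs_sin_le_one θ
      _ ≤ _ := by linarith

/-- The average over a correlated pair of Gaussian vectors of the inner product of gradients. -/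
def corr (F' G' : (E → ℝ) → E → ℝ) (θ : ℝ) : ℝ :=
  ∫ p, ∑ e, G' p.1 e * F' (cos θ • p.1 + sin θ • p.2) e ∂(stdG E).prod (stdG E)

lemma integrable_corr (hF : HasGrad F F' C) (hG : HasGrad G G' D) (θ : ℝ) (e : E) :
    Integrable (fun p : (E → ℝ) × (E → ℝ) => G' p.1 e * F' (cos θ • p.1 + sin θ • p.2) e)
      ((stdG E).prod (stdG E)) := by
  refine Integrable.of_bound (C := D * C) (Continuous.aestronglyMeasurable ?_)
    (ae_of_all _ fun q => ?_)
  · have := hF.cont e; have := hG.cont e; fun_prop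
  · rw [norm_mul]
    exact mul_le_mul (hG.bdd _ _) (hF.bdd _ _) (abs_nonneg _) (hG.bound_nonneg e)

lemma continuous_corr (hF : HasGrad F F' C) (hG : HasGrad G G' D) : Continuous (corr F' G') := by
  have : corr F' G' = fun θ => ∑ e, ∫ p, G' p.1 e * F' (cos θ • p.1 + sin θ • p.2) e
      ∂(stdG E).prod (stdG E) := by
    funext θ
    exact integral_finsetSum _ fun e _ => integrable_corr hF hG θ e
  rw [this]
  refine continuous_finsetSum _ fun e _ => continuous_of_dominated (bound := fun _ => D * C)
    (fun θ => (integrable_corr hF hG θ e).aestronglyMeasurable)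
    (fun θ => ae_of_all _ fun q => ?_) (integrable_const _) (ae_of_all _ fun q => ?_)
  · rw [norm_mul]
    exact mul_le_mul (hG.bdd _ _) (hF.bdd _ _) (abs_nonneg _) (hG.bound_nonneg e)
  · have := hF.cont e; fun_prop

lemma hasDerivAt_correlation (hF : HasGrad F F' C) (hG : HasGrad G G' D) {B : ℝ}
    (hB : ∀ x, |G x| ≤ B) (θ : ℝ) :
    HasDerivAt (fun θ => ∫ p, G p.1 * F (cos θ • p.1 + sin θ • p.2) ∂(stdG E).prod (stdG E))
      (-sin θ * corr F' G' θ) θ := by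
  have hGc := hG.continuous
  have hFc := hF.continuous
  have hFc' := hF.cont
  have hB0 : 0 ≤ B := (abs_nonneg _).trans (hB 0)
  have hx : ∀ e : E, Integrable (fun q : (E → ℝ) × (E → ℝ) => |q.1 e| + |q.2 e|)
      ((stdG E).prod (stdG E)) := fun e =>
    ((integrable_eval_stdG e).abs.comp_fst _).add ((integrable_eval_stdG e).abs.comp_snd _)
  have habs : ∀ (a b : ℝ) (c d : ℝ), |c| ≤ 1 → |d| ≤ 1 → |c * a + d * b| ≤ |a| + |b| := by
    intro a b c d hc hd
    refine (abs_add_le _ _).trans ?_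
    rw [abs_mul, abs_mul]
    nlinarith [abs_nonneg a, abs_nonneg b]
  have hInt : ∀ e, Integrable (fun p : (E → ℝ) × (E → ℝ) =>
      G p.1 * F' (cos θ • p.1 + sin θ • p.2) e * ((-sin θ • p.1 + cos θ • p.2) e))
      ((stdG E).prod (stdG E)) := by
    intro e
    refine Integrable.mono' ((hx e).const_mul (B * C)) (Continuous.aestronglyMeasurable ?_)
      (ae_of_all _ fun p => ?_)
    · have := hFc' e; fun_prop
    · rw [norm_mul, norm_mul]
      have := habs (p.1 e) (p.2 e) (-sin θ) (cos θ) (by rw [abs_neg]; exact abs_sin_le_one θ)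
        (abs_cos_le_one θ)
      exact mul_le_mul (mul_le_mul (hB _) (hF.bdd _ _) (abs_nonneg _) hB0) this (abs_nonneg _)
        (mul_nonneg hB0 (hF.bound_nonneg e))
  have h := (hasDerivAt_integral_of_dominated_loc_of_deriv_le (μ := (stdG E).prod (stdG E))
    (F := fun θ p => G p.1 * F (cos θ • p.1 + sin θ • p.2))
    (F' := fun θ p => ∑ e, G p.1 * F' (cos θ • p.1 + sin θ • p.2) e *
      ((-sin θ • p.1 + cos θ • p.2) e)) (x₀ := θ) (s := Set.univ)
    (bound := fun p => ∑ e, B * C * (|p.1 e| + |p.2 e|)) univ_mem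
    (Eventually.of_forall fun θ => Continuous.aestronglyMeasurable (by fun_prop)) ?_ ?_ ?_ ?_ ?_).2
  · refine h.congr_deriv ?_
    rw [integral_finsetSum _ fun e _ => hInt e, corr,
      integral_finsetSum _ fun e _ => integrable_corr hF hG θ e, mul_sum]
    exact sum_congr rfl fun e _ => integral_mul_rotate_ibp hF hG hB θ e
  · refine Integrable.mono' (g := fun p => B * (|F 0| + C * ∑ e, (|p.1 e| + |p.2 e|))) ?_
      (Continuous.aestronglyMeasurable (by fun_prop)) (ae_of_all _ fun p => ?_)
    · exact ((integrable_const _).add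
        ((integrable_finsetSum _ fun e _ => hx e).const_mul _)).const_mul _
    · rw [norm_mul]
      refine mul_le_mul (hB _) ((hF.abs_le _).trans ?_) (abs_nonneg _) hB0
      rcases isEmpty_or_nonempty E with hE | ⟨⟨e0⟩⟩
      · simp
      have := hF.bound_nonneg e0
      gcongr with e
      exact habs (p.1 e) (p.2 e) (cos θ) (sin θ) (abs_cos_le_one θ) (abs_sin_le_one θ)
  · exact Continuous.aestronglyMeasurable
      (continuous_finsetSum _ fun e _ => by have := hFc' e; fun_prop)
  · refine ae_of_all _ fun p t _ => (abs_sum_le_sum_abs _ _).trans (sum_le_sum fun e _ => ?_)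
    rw [abs_mul, abs_mul]
    have := habs (p.1 e) (p.2 e) (-sin t) (cos t) (by rw [abs_neg]; exact abs_sin_le_one t)
      (abs_cos_le_one t)
    exact mul_le_mul (mul_le_mul (hB _) (hF.bdd _ _) (abs_nonneg _) hB0) this (abs_nonneg _)
      (mul_nonneg hB0 (hF.bound_nonneg e))
  · exact integrable_finsetSum _ fun e _ => (hx e).const_mul _
  · refine ae_of_all _ fun p t _ => ?_
    have hu : HasDerivAt (fun s => cos s • p.1 + sin s • p.2) (-sin t • p.1 + cos t • p.2) t :=
      ((hasDerivAt_cos t).smul_const p.1).add ((hasDerivAt_sin t).smul_const p.2)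
    refine ((hF.hasDerivAt_comp hu).const_mul (G p.1)).congr_deriv ?_
    rw [mul_sum]
    exact sum_congr rfl fun e _ => by ring

/-- The Gaussian covariance identity. -/
lemma covariance_eq (hF : HasGrad F F' C) (hG : HasGrad G G' D) {B : ℝ} (hB : ∀ x, |G x| ≤ B) :
    ∫ x, G x * F x ∂stdG E - (∫ x, G x ∂stdG E) * ∫ x, F x ∂stdG E =
      ∫ θ in (0 : ℝ)..(π / 2), sin θ * corr F' G' θ := by
  have h := intervalIntegral.integral_eq_sub_of_hasDerivAt (a := 0) (b := π / 2)
    (fun θ _ => hasDerivAt_correlation hF hG hB θ)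
    ((continuous_sin.neg.mul (continuous_corr hF hG)).intervalIntegrable _ _)
  simp only [cos_pi_div_two, sin_pi_div_two, cos_zero, sin_zero, one_smul, zero_smul, zero_add,
    add_zero, neg_mul, intervalIntegral.integral_neg] at h
  rw [integral_prod_mul (μ := stdG E) (ν := stdG E) G F,
    integral_fun_fst (μ := stdG E) (ν := stdG E) (fun x => G x * F x)] at h
  simp only [probReal_univ, one_smul] at h
  linarith
end HasGrad

end GaussianRotation

/-- Two probability measures on the line which are close on continuous `[0,1]`-valued test
functions are close in total variation. -/
lemma abs_measureReal_sub_le_of_continuous {μ ν : Measure ℝ} [IsProbabilityMeasure μ]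
    [IsProbabilityMeasure ν] {δ : ℝ}
    (h : ∀ φ : ℝ → ℝ, Continuous φ → (∀ x, 0 ≤ φ x) → (∀ x, φ x ≤ 1) →
      |∫ x, φ x ∂μ - ∫ x, φ x ∂ν| ≤ δ) {A : Set ℝ} (hA : MeasurableSet A) :
    |μ.real A - ν.real A| ≤ δ := by
  refine le_of_forall_pos_le_add fun ε hε => ?_
  have hε' : ENNReal.ofReal (ε / 2) ≠ 0 := by simpa using hε
  obtain ⟨K, hKA, hK, hKε⟩ := hA.exists_isClosed_sdiff_lt (μ := μ + ν) (measure_ne_top _ _) hε'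
  obtain ⟨U, hAU, hU, -, hUε⟩ := hA.exists_isOpen_sdiff_lt (μ := μ + ν) (measure_ne_top _ _) hε'
  obtain ⟨φ, h0, h1, hφ⟩ := exists_continuous_zero_one_of_isClosed hU.isClosed_compl hK
    (Set.disjoint_left.2 fun x hx hx' => hx (hAU (hKA hx')))
  have key : ∀ m : Measure ℝ, IsProbabilityMeasure m → m ≤ μ + ν →
      m.real A - ε / 2 ≤ ∫ x, φ x ∂m ∧ ∫ x, φ x ∂m ≤ m.real A + ε / 2 := by
    intro m hm hle
    have hInt : Integrable φ m := Integrable.of_bound (C := 1) φ.continuous.aestronglyMeasurable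
      (ae_of_all _ fun x => by rw [norm_eq_abs, abs_of_nonneg (hφ x).1]; exact (hφ x).2)
    have a1 : m.real (A \ K) ≤ ε / 2 :=
      ENNReal.toReal_le_of_le_ofReal (by positivity) ((hle _).trans hKε.le)
    have a2 : m.real (U \ A) ≤ ε / 2 :=
      ENNReal.toReal_le_of_le_ofReal (by positivity) ((hle _).trans hUε.le)
    rw [measureReal_sdiff hKA hK.measurableSet] at a1
    rw [measureReal_sdiff hAU hA] at a2
    have b1 : m.real K ≤ ∫ x, φ x ∂m := by
      rw [← integral_indicator_one hK.measurableSet]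
      refine integral_mono ((integrable_const _).indicator hK.measurableSet) hInt fun x => ?_
      by_cases hx : x ∈ K
      · simp [hx, h1 hx]
      · simpa [hx] using (hφ x).1
    have b2 : ∫ x, φ x ∂m ≤ m.real U := by
      rw [← integral_indicator_one hU.measurableSet]
      refine integral_mono hInt ((integrable_const _).indicator hU.measurableSet) fun x => ?_
      by_cases hx : x ∈ U
      · simpa [hx] using (hφ x).2
      · simp [hx, h0 hx]
    constructor <;> linarith
  obtain ⟨m1, m2⟩ := key μ inferInstance (Measure.le_add_right le_rfl)
  obtain ⟨n1, n2⟩ := key ν inferInstance (Measure.le_add_left le_rfl)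
  have := abs_le.1 (h φ φ.continuous (fun x => (hφ x).1) fun x => (hφ x).2)
  rw [abs_le]
  constructor <;> linarith [this.1, this.2]

lemma hasDerivAt_exp_neg_half_sq (x : ℝ) :
    HasDerivAt (fun x : ℝ => exp (-(1 / 2) * x ^ 2)) (-(x * exp (-(1 / 2) * x ^ 2))) x := by
  have := (((hasDerivAt_id x).pow 2).const_mul (-(1 / 2 : ℝ))).exp
  refine this.congr_deriv ?_
  simp; ring

lemma tendsto_exp_neg_half_sq_cocompact :
    Tendsto (fun x : ℝ => exp (-(1 / 2) * x ^ 2)) (cocompact ℝ) (nhds 0) := by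
  refine tendsto_exp_atBot.comp ?_
  refine Tendsto.const_mul_atTop_of_neg (by norm_num) ?_
  have : (fun x : ℝ => x ^ 2) = fun x => ‖x‖ ^ 2 := by funext x; simp
  rw [this]
  exact (tendsto_pow_atTop (by norm_num)).comp tendsto_norm_cocompact_atTop

lemma integral_Ioi_mul_exp_neg_half_sq (w : ℝ) :
    ∫ x in Set.Ioi w, x * exp (-(1 / 2) * x ^ 2) = exp (-(1 / 2) * w ^ 2) := by
  have h := integral_Ioi_of_hasDerivAt_of_tendsto (a := w) (m := 0)
    (f := fun x : ℝ => exp (-(1 / 2) * x ^ 2)) (f' := fun x => -(x * exp (-(1 / 2) * x ^ 2)))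
    (by fun_prop) (fun x _ => hasDerivAt_exp_neg_half_sq x)
    (integrable_mul_exp_neg_mul_sq (by norm_num)).neg.integrableOn
    (tendsto_exp_neg_half_sq_cocompact.mono_left atTop_le_cocompact)
  rw [integral_neg] at h
  linarith

lemma integral_Iic_neg_mul_exp_neg_half_sq (w : ℝ) :
    ∫ x in Set.Iic w, -x * exp (-(1 / 2) * x ^ 2) = exp (-(1 / 2) * w ^ 2) := by
  have h := integral_Iic_of_hasDerivAt_of_tendsto (a := w) (m := 0)
    (f := fun x : ℝ => exp (-(1 / 2) * x ^ 2)) (f' := fun x => -(x * exp (-(1 / 2) * x ^ 2)))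
    (by fun_prop) (fun x _ => hasDerivAt_exp_neg_half_sq x)
    (integrable_mul_exp_neg_mul_sq (by norm_num)).neg.integrableOn
    (tendsto_exp_neg_half_sq_cocompact.mono_left atBot_le_cocompact)
  rw [sub_zero] at h
  rw [← h]
  exact integral_congr_ae (ae_of_all _ fun x => neg_mul x _)

/-- Solution of Stein's equation with bounded derivative. -/
lemma exists_stein_solution {h : ℝ → ℝ} (hc : Continuous h) (h0 : ∀ x, 0 ≤ h x)
    (h1 : ∀ x, h x ≤ 1) : ∃ (f f' : ℝ → ℝ) (B : ℝ), Continuous f' ∧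
      (∀ w, HasDerivAt f (f' w) w) ∧ (∀ w, |f w| ≤ B) ∧ (∀ w, |f' w| ≤ 2) ∧
      ∀ w, f' w - w * f w = h w - ∫ x, h x ∂gaussianReal 0 1 := by
  set m := ∫ x, h x ∂gaussianReal 0 1 with hm
  have hm0 : 0 ≤ m := integral_nonneg h0
  have hm1 : m ≤ 1 := by
    have := integral_mono (μ := gaussianReal 0 1) (f := h) (g := fun _ => 1)
      (Integrable.of_bound (C := 1) hc.aestronglyMeasurable
        (ae_of_all _ fun x => by rw [norm_eq_abs, abs_of_nonneg (h0 x)]; exact h1 x))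
      (integrable_const _) h1
    simpa using this
  have hd : ∀ x, |h x - m| ≤ 1 := fun x => abs_le.2 ⟨by linarith [h0 x], by linarith [h1 x]⟩
  set q : ℝ → ℝ := fun x => (h x - m) * exp (-(1 / 2) * x ^ 2) with hq
  have hqc : Continuous q := by fun_prop
  have hei : Integrable (fun x : ℝ => exp (-(1 / 2) * x ^ 2)) :=
    integrable_exp_neg_mul_sq (by norm_num)
  have hqi : Integrable q := hei.bdd_mul (c := 1) (by fun_prop) (ae_of_all _ hd)
  have hq0 : ∫ x, q x = 0 := by
    have e1 : ∫ x, (h x - m) ∂gaussianReal 0 1 = 0 := by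
      rw [integral_sub (Integrable.of_bound (C := 1) hc.aestronglyMeasurable
        (ae_of_all _ fun x => by rw [norm_eq_abs, abs_of_nonneg (h0 x)]; exact h1 x))
        (integrable_const _)]
      simp [hm]
    rw [integral_gaussianReal_eq_integral_smul one_ne_zero] at e1
    have e2 : ∀ x, gaussianPDFReal 0 1 x • (h x - m) = (√(2 * π))⁻¹ * q x := by
      intro x
      simp only [gaussianPDFReal_def, hq, smul_eq_mul, NNReal.coe_one, mul_one, sub_zero]
      rw [show -x ^ 2 / 2 = -(1 / 2) * x ^ 2 by ring]
      ring
    simp only [e2] at e1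
    rw [integral_const_mul] at e1
    exact (mul_eq_zero.1 e1).resolve_left (by positivity)
  set Q : ℝ → ℝ := fun w => ∫ x in Set.Iic w, q x with hQ
  have hQ' : ∀ w, Q w = -∫ x in Set.Ioi w, q x := by
    intro w
    have := intervalIntegral.integral_Iic_add_Ioi (b := w) hqi.integrableOn hqi.integrableOn
    rw [hq0] at this
    linarith
  have hQd : ∀ w, HasDerivAt Q (q w) w := by
    intro w
    have e : Q = fun w => (∫ x in (0 : ℝ)..w, q x) + Q 0 := by
      funext w
      rw [← intervalIntegral.integral_Iic_sub_Iic hqi.integrableOn hqi.integrableOn]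
      simp [hQ]
    rw [e]
    exact (intervalIntegral.integral_hasDerivAt_right (hqc.intervalIntegrable _ _)
      (hqc.stronglyMeasurableAtFilter _ _) hqc.continuousAt).add_const _
  have hmill : ∀ w, |w| * |Q w| ≤ exp (-(1 / 2) * w ^ 2) := by
    intro w
    have hxi : Integrable (fun x : ℝ => x * exp (-(1 / 2) * x ^ 2)) :=
      integrable_mul_exp_neg_mul_sq (by norm_num)
    rcases le_total 0 w with hw | hw
    · rw [hQ' w, abs_neg, ← abs_mul, ← integral_const_mul, ← integral_Ioi_mul_exp_neg_half_sq w]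
      refine norm_integral_le_of_norm_le (f := fun x => w * q x) hxi.integrableOn
        ((ae_restrict_iff' measurableSet_Ioi).2 (ae_of_all _ fun x hx => ?_))
      have hx : w < x := hx
      rw [norm_mul, norm_mul, norm_eq_abs, norm_eq_abs, norm_eq_abs, abs_of_nonneg hw, abs_exp,
        ← mul_assoc]
      refine mul_le_mul_of_nonneg_right ?_ (exp_pos _).le
      nlinarith [hd x, abs_nonneg (h x - m)]
    · rw [← abs_mul, ← integral_const_mul, ← integral_Iic_neg_mul_exp_neg_half_sq w]
      refine norm_integral_le_of_norm_le (f := fun x => w * q x)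
        (hxi.neg.integrableOn.congr (ae_of_all _ fun x => (neg_mul x _).symm))
        ((ae_restrict_iff' measurableSet_Iic).2 (ae_of_all _ fun x hx => ?_))
      have hx : x ≤ w := hx
      rw [norm_mul, norm_mul, norm_eq_abs, norm_eq_abs, norm_eq_abs, abs_of_nonpos hw, abs_exp,
        ← mul_assoc]
      refine mul_le_mul_of_nonneg_right ?_ (exp_pos _).le
      nlinarith [hd x, abs_nonneg (h x - m)]
  set f : ℝ → ℝ := fun w => exp (1 / 2 * w ^ 2) * Q w with hf
  have hee : ∀ w : ℝ, exp (1 / 2 * w ^ 2) * exp (-(1 / 2) * w ^ 2) = 1 := by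
    intro w; rw [← exp_add]; simp
  have hwf : ∀ w, |w| * |f w| ≤ 1 := by
    intro w
    rw [hf]
    simp only [abs_mul, abs_exp]
    calc |w| * (exp (1 / 2 * w ^ 2) * |Q w|) = exp (1 / 2 * w ^ 2) * (|w| * |Q w|) := by ring
      _ ≤ exp (1 / 2 * w ^ 2) * exp (-(1 / 2) * w ^ 2) := by gcongr; exact hmill w
      _ = 1 := hee w
  have hfd : ∀ w, HasDerivAt f (w * f w + (h w - m)) w := by
    intro w
    have hexp : HasDerivAt (fun w : ℝ => exp (1 / 2 * w ^ 2)) (w * exp (1 / 2 * w ^ 2)) w := by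
      refine (((hasDerivAt_id w).pow 2).const_mul (1 / 2 : ℝ)).exp.congr_deriv ?_
      simp; ring
    refine (hexp.mul (hQd w)).congr_deriv ?_
    simp only [hf, hq]
    linear_combination (h w - m) * hee w
  have hfc : Continuous f := continuous_iff_continuousAt.2 fun w => (hfd w).continuousAt
  obtain ⟨B, hB⟩ := (isCompact_Icc (a := (-1 : ℝ)) (b := 1)).exists_bound_of_continuousOn
    hfc.continuousOn
  refine ⟨f, fun w => w * f w + (h w - m), max B 1, by fun_prop, hfd, fun w => ?_, fun w => ?_,
    fun w => by ring⟩
  · by_cases hw : |w| ≤ 1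
    · exact (hB w (abs_le.1 hw)).trans (le_max_left _ _)
    · refine le_trans ?_ (le_max_right _ _)
      nlinarith [hwf w, abs_nonneg (f w)]
  · refine (abs_add_le _ _).trans ?_
    rw [abs_mul]
    linarith [hwf w, hd w]

section TotalVariation

variable {E : Type*} [Fintype E] [DecidableEq E]

namespace HasGrad

variable {F G : (E → ℝ) → ℝ} {F' G' : (E → ℝ) → E → ℝ} {C D : ℝ}

lemma comp_left (hF : HasGrad F F' C) {φ φ' : ℝ → ℝ} (hφ : ∀ t, HasDerivAt φ (φ' t) t)
    (hc : Continuous φ') (hb : ∀ x, |φ' (F x)| ≤ D) :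
    HasGrad (fun x => φ (F x)) (fun x e => φ' (F x) * F' x e) (D * C) where
  deriv x := by
    refine ((hφ (F x)).comp_hasFDerivAt x (hF.deriv x)).congr_fderiv ?_
    simp only [smul_sum, smul_smul]
  cont e := by have := hF.cont e; have := hF.continuous; fun_prop
  bdd x e := by
    rw [abs_mul]
    exact mul_le_mul (hb _) (hF.bdd _ _) (abs_nonneg _) ((abs_nonneg _).trans (hb 0))

/-- Second order Poincare bound in total variation for a function of Gaussian variables. -/
lemma abs_measureReal_sub_gaussian_le (hF : HasGrad F F' C) {b d : ℝ → ℝ} (hb : Continuous b)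
    (hd : Continuous d) {v : ℝ} (hv : 0 < v) (hbv : ∫ θ in (0 : ℝ)..(π / 2), sin θ * b θ = v)
    (h : ∀ θ ∈ Set.Icc 0 (π / 2), ∫ p, |∑ e, F' p.1 e * F' (cos θ • p.1 + sin θ • p.2) e - b θ|
      ∂(stdG E).prod (stdG E) ≤ d θ) {A : Set ℝ} (hA : MeasurableSet A) :
    |((stdG E) ((fun g => (F g - ∫ g', F g' ∂stdG E) / √v) ⁻¹' A)).toReal -
      ((gaussianReal 0 1) A).toReal| ≤ 2 / v * ∫ θ in (0 : ℝ)..(π / 2), sin θ * d θ := by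
  set M := ∫ g', F g' ∂stdG E with hM
  set W : (E → ℝ) → ℝ := fun g => (F g - M) / √v with hW
  have hsv : 0 < √v := sqrt_pos.2 hv
  have hFc := hF.continuous
  have hWc : Continuous W := by fun_prop
  have hWg : HasGrad W (fun x e => 1 / √v * F' x e) (1 / √v * C) :=
    hF.comp_left (φ := fun t => (t - M) / √v) (φ' := fun _ => 1 / √v)
      (fun t => ((hasDerivAt_id t).sub_const M).div_const _) continuous_const
      (fun _ => by rw [abs_of_pos (by positivity)])
  have hprob : IsProbabilityMeasure ((stdG E).map W) :=
    Measure.isProbabilityMeasure_map hWc.measurable.aemeasurable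
  rw [← Measure.map_apply hWc.measurable hA]
  refine abs_measureReal_sub_le_of_continuous (μ := (stdG E).map W) (ν := gaussianReal 0 1)
    (fun φ hφ h0 h1 => ?_) hA
  obtain ⟨f, f', B, hfc', hfd, hfB, hf2, hst⟩ := exists_stein_solution hφ h0 h1
  rw [integral_map hWc.measurable.aemeasurable hφ.aestronglyMeasurable]
  have hG := hWg.comp_left hfd hfc' fun x => hf2 _
  have hfc : Continuous f := continuous_iff_continuousAt.2 fun w => (hfd w).continuousAt
  have hcov := covariance_eq hF hG (B := B) fun x => hfB _
  have hi1 : Integrable (fun x => f' (W x)) (stdG E) := Integrable.of_bound (C := 2)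
    (by fun_prop) (ae_of_all _ fun x => hf2 _)
  have hi2 : Integrable (fun x => f (W x) * F x) (stdG E) := hF.integrable.bdd_mul (c := B)
    (by fun_prop) (ae_of_all _ fun x => hfB _)
  have hi3 : Integrable (fun x => f (W x)) (stdG E) := Integrable.of_bound (C := B)
    (by fun_prop) (ae_of_all _ fun x => hfB _)
  have e1 : ∫ x, φ (W x) ∂stdG E - ∫ x, φ x ∂gaussianReal 0 1 =
      ∫ x, f' (W x) ∂stdG E - 1 / √v * (∫ x, f (W x) * F x ∂stdG E -
        (∫ x, f (W x) ∂stdG E) * M) := by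
    have : ∀ x, φ (W x) = f' (W x) - 1 / √v * (f (W x) * F x - f (W x) * M) +
        ∫ x, φ x ∂gaussianReal 0 1 := by
      intro x
      have := hst (W x)
      simp only [hW] at this ⊢
      linear_combination -this
    simp only [this]
    rw [integral_add, integral_sub hi1, integral_const_mul, integral_sub hi2 (hi3.mul_const _),
      integral_mul_const]
    · simp
    · exact (hi2.sub (hi3.mul_const _)).const_mul _
    · exact hi1.sub ((hi2.sub (hi3.mul_const _)).const_mul _)
    · exact integrable_const _
  rw [e1, hcov]
  set S : ℝ → (E → ℝ) × (E → ℝ) → ℝ := fun θ p =>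
    ∑ e, F' p.1 e * F' (cos θ • p.1 + sin θ • p.2) e with hS
  have hSi : ∀ θ, Integrable (S θ) ((stdG E).prod (stdG E)) := fun θ =>
    integrable_finsetSum _ fun e _ => integrable_corr hF hF θ e
  have hbd : ∀ p : (E → ℝ) × (E → ℝ), ‖f' (W p.1)‖ ≤ 2 := fun p => hf2 _
  have hcorr : ∀ θ, corr F' (fun x e => f' (W x) * (1 / √v * F' x e)) θ =
      1 / √v * ∫ p, f' (W p.1) * S θ p ∂(stdG E).prod (stdG E) := by
    intro θ
    rw [corr, ← integral_const_mul]
    refine integral_congr_ae (ae_of_all _ fun p => ?_)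
    simp only [hS, mul_sum]
    exact sum_congr rfl fun e _ => by ring
  have hcc := continuous_corr hF hG
  have hfst : ∫ p : (E → ℝ) × (E → ℝ), f' (W p.1) ∂(stdG E).prod (stdG E) =
      ∫ x, f' (W x) ∂stdG E := by
    rw [integral_fun_fst (μ := stdG E) (ν := stdG E) (fun x => f' (W x))]
    simp
  have hmain : ∫ x, f' (W x) ∂stdG E - 1 / √v * ∫ θ in (0 : ℝ)..(π / 2),
      sin θ * corr F' (fun x e => f' (W x) * (1 / √v * F' x e)) θ =
      1 / v * ∫ θ in (0 : ℝ)..(π / 2), sin θ *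
        (b θ * (∫ x, f' (W x) ∂stdG E) -
          √v * corr F' (fun x e => f' (W x) * (1 / √v * F' x e)) θ) := by
    have : ∀ θ, sin θ * (b θ * (∫ x, f' (W x) ∂stdG E) -
          √v * corr F' (fun x e => f' (W x) * (1 / √v * F' x e)) θ) =
        sin θ * b θ * (∫ x, f' (W x) ∂stdG E) -
          √v * (sin θ * corr F' (fun x e => f' (W x) * (1 / √v * F' x e)) θ) := by
      intro θ; ring
    simp only [this]
    rw [intervalIntegral.integral_sub, intervalIntegral.integral_mul_const,
      intervalIntegral.integral_const_mul, hbv]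
    · have h1v : 1 / v * √v = 1 / √v := by field_simp; exact sq_sqrt hv.le
      rw [mul_sub, ← mul_assoc, ← mul_assoc, one_div_mul_cancel hv.ne', one_mul, h1v]
    · exact Continuous.intervalIntegrable (by fun_prop) _ _
    · exact Continuous.intervalIntegrable (by fun_prop) _ _
  rw [hmain, abs_mul, abs_of_pos (by positivity : 0 < 1 / v), show 2 / v = 1 / v * 2 by ring,
    mul_assoc]
  refine mul_le_mul_of_nonneg_left ?_ (by positivity)
  rw [← intervalIntegral.integral_const_mul]
  have hpi : (0 : ℝ) ≤ π / 2 := by positivity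
  have hgi : IntervalIntegrable (fun θ => 2 * (sin θ * d θ)) volume 0 (π / 2) :=
    Continuous.intervalIntegrable (by fun_prop) _ _
  rw [← norm_eq_abs]
  refine intervalIntegral.norm_integral_le_of_norm_le hpi (ae_of_all _ fun θ hθ => ?_) hgi
  have hθ' : θ ∈ Set.Icc 0 (π / 2) := ⟨hθ.1.le, hθ.2⟩
  have hs : 0 ≤ sin θ := sin_nonneg_of_nonneg_of_le_pi hθ'.1 (by linarith [hθ'.2, pi_pos])
  rw [norm_mul, norm_eq_abs, norm_eq_abs, abs_of_nonneg hs, mul_left_comm]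
  refine mul_le_mul_of_nonneg_left ?_ hs
  rw [hcorr, ← hfst, ← mul_assoc, mul_one_div_cancel hsv.ne', one_mul, ← integral_const_mul,
    ← integral_sub]
  · rw [← norm_eq_abs]
    refine (norm_integral_le_of_norm_le (g := fun p => 2 * |S θ p - b θ|)
      (((hSi θ).sub (integrable_const _)).abs.const_mul 2) (ae_of_all _ fun p => ?_)).trans ?_
    · rw [show b θ * f' (W p.1) - f' (W p.1) * S θ p = -(f' (W p.1) * (S θ p - b θ)) by ring,
        norm_neg, norm_mul]
      exact mul_le_mul_of_nonneg_right (hf2 _) (abs_nonneg _)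
    · rw [integral_const_mul]
      exact mul_le_mul_of_nonneg_left (h θ hθ') (by norm_num)
  · exact (hi1.comp_fst _).const_mul _
  · exact (hSi θ).bdd_mul (c := 2) (by fun_prop) (ae_of_all _ hbd)
end HasGrad

end TotalVariation

section GradientEstimates

variable {E : Type*} [Fintype E] [DecidableEq E]

lemma sum_mul_le_of_sum_sq_le {v w : E → ℝ} {K : ℝ} (hv : ∑ e, v e ^ 2 ≤ K)
    (hw : ∑ e, w e ^ 2 ≤ K) : ∑ e, v e * w e ≤ K := by
  have : ∑ e, v e * w e ≤ ∑ e, (v e ^ 2 + w e ^ 2) / 2 :=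
    sum_le_sum fun e _ => by nlinarith [sq_nonneg (v e - w e)]
  rw [← sum_div, sum_add_distrib] at this
  linarith

namespace HasGrad

variable {F : (E → ℝ) → ℝ} {F' : (E → ℝ) → E → ℝ} {C B K : ℝ}

/-- Gaussian concentration for bounded functions with bounded gradient. -/
lemma integral_exp_le (hF : HasGrad F F' C) (hB : ∀ x, |F x| ≤ B)
    (hK : ∀ x, ∑ e, F' x e ^ 2 ≤ K) {l : ℝ} (hl : 0 ≤ l) :
    ∫ x, exp (l * F x) ∂stdG E ≤ exp (l * ∫ x, F x ∂stdG E + l ^ 2 * K / 2) := by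
  set M := ∫ x, F x ∂stdG E with hM
  have hFc := hF.continuous
  have hB0 : 0 ≤ B := (abs_nonneg _).trans (hB 0)
  have hexpb : ∀ t x, |exp (t * F x)| ≤ exp (|t| * B) := fun t x => by
    rw [abs_exp, exp_le_exp]
    refine (le_abs_self _).trans ?_
    rw [abs_mul]
    exact mul_le_mul_of_nonneg_left (hB x) (abs_nonneg _)
  have hexpi : ∀ t, Integrable (fun x => exp (t * F x)) (stdG E) := fun t =>
    Integrable.of_bound (C := exp (|t| * B)) (by fun_prop) (ae_of_all _ (hexpb t))
  have hψ : ∀ t, HasDerivAt (fun t => ∫ x, exp (t * F x) ∂stdG E)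
      (∫ x, exp (t * F x) * F x ∂stdG E) t := by
    intro t
    refine (hasDerivAt_integral_of_dominated_loc_of_deriv_le (μ := stdG E)
      (F := fun t x => exp (t * F x)) (F' := fun t x => exp (t * F x) * F x) (x₀ := t)
      (s := Metric.ball t 1) (bound := fun _ => exp ((|t| + 1) * B) * B)
      (Metric.ball_mem_nhds t one_pos)
      (Eventually.of_forall fun s => (hexpi s).aestronglyMeasurable) (hexpi t) (by fun_prop)
      (ae_of_all _ fun x s hs => ?_) (integrable_const _) (ae_of_all _ fun x s _ => ?_)).2
    · rw [norm_mul]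
      refine mul_le_mul ((hexpb s x).trans (exp_le_exp.2 ?_)) (hB x) (abs_nonneg _) (exp_pos _).le
      refine mul_le_mul_of_nonneg_right ?_ hB0
      have h1 : |s - t| < 1 := by simpa [Real.dist_eq] using hs
      have := abs_sub_abs_le_abs_sub s t
      linarith
    · simpa using ((hasDerivAt_id s).mul_const (F x)).exp
  have hcov : ∀ t, 0 ≤ t → ∫ x, exp (t * F x) * F x ∂stdG E ≤
      (M + t * K) * ∫ x, exp (t * F x) ∂stdG E := by
    intro t ht
    have hG : HasGrad (fun x => exp (t * F x)) (fun x e => t * exp (t * F x) * F' x e)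
        (t * exp (|t| * B) * C) :=
      hF.comp_left (φ := fun s => exp (t * s)) (φ' := fun s => t * exp (t * s))
        (fun s => by simpa [mul_comm] using ((hasDerivAt_id s).const_mul t).exp) (by fun_prop)
        (fun x => by
          rw [abs_mul]
          exact mul_le_mul (abs_of_nonneg ht).le (hexpb t x) (abs_nonneg _) ht)
    have h := covariance_eq hF hG (hexpb t)
    have hc : ∀ θ, corr F' (fun x e => t * exp (t * F x) * F' x e) θ ≤
        t * K * ∫ x, exp (t * F x) ∂stdG E := by
      intro θ
      have e1 : ∫ p : (E → ℝ) × (E → ℝ), exp (t * F p.1) ∂(stdG E).prod (stdG E) =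
          ∫ x, exp (t * F x) ∂stdG E := by
        rw [integral_fun_fst (μ := stdG E) (ν := stdG E) (fun x => exp (t * F x))]
        simp
      rw [← e1, ← integral_const_mul, corr]
      refine integral_mono (integrable_finsetSum _ fun e _ => integrable_corr hF hG θ e)
        (((hexpi t).comp_fst _).const_mul _) fun p => ?_
      calc ∑ e, t * exp (t * F p.1) * F' p.1 e * F' (cos θ • p.1 + sin θ • p.2) e
          = t * exp (t * F p.1) * ∑ e, F' p.1 e * F' (cos θ • p.1 + sin θ • p.2) e := by
            rw [mul_sum]; exact sum_congr rfl fun e _ => by ring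
        _ ≤ t * exp (t * F p.1) * K :=
            mul_le_mul_of_nonneg_left (sum_mul_le_of_sum_sq_le (hK _) (hK _)) (by positivity)
        _ = t * K * exp (t * F p.1) := by ring
    have h2 : ∫ θ in (0 : ℝ)..(π / 2), sin θ * corr F' (fun x e => t * exp (t * F x) * F' x e) θ ≤
        ∫ θ in (0 : ℝ)..(π / 2), sin θ * (t * K * ∫ x, exp (t * F x) ∂stdG E) := by
      refine intervalIntegral.integral_mono_on (by positivity)
        ((continuous_sin.mul (continuous_corr hF hG)).intervalIntegrable _ _)
        (Continuous.intervalIntegrable (by fun_prop) _ _) fun θ hθ => ?_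
      exact mul_le_mul_of_nonneg_left (hc θ)
        (sin_nonneg_of_nonneg_of_le_pi hθ.1 (by linarith [hθ.2, pi_pos]))
    rw [intervalIntegral.integral_mul_const, integral_sin] at h2
    simp only [cos_zero, cos_pi_div_two, sub_zero, one_mul] at h2
    linarith
  have hχ : ∀ t, HasDerivAt (fun t => (∫ x, exp (t * F x) ∂stdG E) * exp (-(t * M + t ^ 2 * K / 2)))
      ((∫ x, exp (t * F x) * F x ∂stdG E - (M + t * K) * ∫ x, exp (t * F x) ∂stdG E) *
        exp (-(t * M + t ^ 2 * K / 2))) t := by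
    intro t
    have h1 : HasDerivAt (fun t => -(t * M + t ^ 2 * K / 2)) (-(M + t * K)) t := by
      have := (((hasDerivAt_id t).mul_const M).add
        ((((hasDerivAt_id t).pow 2).mul_const K).div_const 2)).neg
      refine this.congr_deriv ?_
      simp; ring
    refine ((hψ t).mul h1.exp).congr_deriv ?_
    ring
  have hanti : AntitoneOn (fun t => (∫ x, exp (t * F x) ∂stdG E) * exp (-(t * M + t ^ 2 * K / 2)))
      (Set.Ici 0) := by
    refine antitoneOn_of_deriv_nonpos (convex_Ici 0)
      (fun t _ => (hχ t).continuousAt.continuousWithinAt)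
      (fun t _ => (hχ t).differentiableAt.differentiableWithinAt) fun t ht => ?_
    rw [interior_Ici] at ht
    rw [(hχ t).deriv]
    exact mul_nonpos_of_nonpos_of_nonneg (by linarith [hcov t ht.le]) (exp_pos _).le
  have := hanti (Set.mem_Ici.2 le_rfl) (Set.mem_Ici.2 hl) hl
  simp only [zero_mul, exp_zero, integral_const, probReal_univ, smul_eq_mul, one_mul, ne_eq,
    OfNat.ofNat_ne_zero, not_false_eq_true, zero_pow, zero_div, add_zero, neg_zero] at this
  rwa [exp_neg, ← div_eq_mul_inv, div_le_one (exp_pos _)] at this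

lemma neg (hF : HasGrad F F' C) : HasGrad (fun x => -F x) (fun x e => -F' x e) C := by
  have := hF.comp_left (φ := fun t => -t) (φ' := fun _ => -1) (D := 1)
    (fun t => (hasDerivAt_id t).neg) continuous_const (fun x => by simp)
  simpa using this

lemma measureReal_ge_le (hF : HasGrad F F' C) (hB : ∀ x, |F x| ≤ B)
    (hK : ∀ x, ∑ e, F' x e ^ 2 ≤ K) (hK0 : 0 < K) {s : ℝ} (hs : 0 ≤ s) :
    (stdG E).real {x | (∫ x, F x ∂stdG E) + s ≤ F x} ≤ exp (-(s ^ 2 / (2 * K))) := by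
  set M := ∫ x, F x ∂stdG E with hM
  have hFc := hF.continuous
  have hl : 0 ≤ s / K := by positivity
  have h := hF.integral_exp_le hB hK hl
  have hi : Integrable (fun x => exp (s / K * F x)) (stdG E) :=
    Integrable.of_bound (C := exp (s / K * B)) (by fun_prop) (ae_of_all _ fun x => by
      rw [norm_eq_abs, abs_exp, exp_le_exp]
      exact mul_le_mul_of_nonneg_left ((le_abs_self _).trans (hB x)) hl)
  have hm := mul_meas_ge_le_integral_of_nonneg (μ := stdG E)
    (ae_of_all _ fun x => (exp_pos (s / K * F x)).le) hi (exp (s / K * (M + s)))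
  have hsub : {x | M + s ≤ F x} ⊆ {x | exp (s / K * (M + s)) ≤ exp (s / K * F x)} := fun x hx =>
    exp_le_exp.2 (mul_le_mul_of_nonneg_left hx hl)
  have h3 := measureReal_mono (μ := stdG E) hsub
  have h4 : exp (s / K * (M + s)) * (stdG E).real {x | M + s ≤ F x} ≤
      exp (s / K * M + (s / K) ^ 2 * K / 2) :=
    ((mul_le_mul_of_nonneg_left h3 (exp_pos _).le).trans hm).trans h
  have h5 : (stdG E).real {x | M + s ≤ F x} ≤
      exp (s / K * M + (s / K) ^ 2 * K / 2) / exp (s / K * (M + s)) := by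
    rw [le_div_iff₀ (exp_pos _), mul_comm]; exact h4
  refine h5.trans (le_of_eq ?_)
  rw [← exp_sub]
  congr 1
  field_simp
  ring

/-- If a function with small gradient is not too negative with probability `q`, then it is very
negative only with small probability. -/
lemma measureReal_le_neg_le (hF : HasGrad F F' C) (hB : ∀ x, |F x| ≤ B)
    (hK : ∀ x, ∑ e, F' x e ^ 2 ≤ K) (hK0 : 0 < K) {q m s r : ℝ} (hr : 0 ≤ r) (hs : 0 ≤ s)
    (hq : exp (-(r ^ 2 / (2 * K))) < q) (hqF : q ≤ (stdG E).real {x | -m ≤ F x}) :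
    (stdG E).real {x | F x ≤ -(m + r + s)} ≤ exp (-(s ^ 2 / (2 * K))) := by
  set M := ∫ x, F x ∂stdG E with hM
  have hMr : -m - r < M := by
    by_contra hcon
    have h1 := hF.measureReal_ge_le hB hK hK0 hr
    have : {x | -m ≤ F x} ⊆ {x | M + r ≤ F x} := fun x hx => by
      have : -m ≤ F x := hx
      show M + r ≤ F x
      linarith [not_lt.1 hcon]
    have := measureReal_mono (μ := stdG E) this
    linarith
  have h2 := hF.neg.measureReal_ge_le (B := B) (K := K) (fun x => by rw [abs_neg]; exact hB x)
    (fun x => by simpa using hK x) hK0 hs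
  refine le_trans (measureReal_mono fun x hx => ?_) h2
  have hx : F x ≤ -(m + r + s) := hx
  show (∫ x, -F x ∂stdG E) + s ≤ -F x
  rw [integral_neg]
  linarith
end HasGrad

end GradientEstimates

section Minorants

variable {E S : Type*} [Fintype E] [DecidableEq E] [Fintype S]

lemma abs_sum_softmax_mul_le [Nonempty S] (h f : S → ℝ) {C : ℝ} (hf : ∀ s, |f s| ≤ C) :
    |∑ s, softmax h s * f s| ≤ C := by
  refine (Finset.abs_sum_le_sum_abs _ _).trans ?_
  calc ∑ s, |softmax h s * f s| ≤ ∑ s, softmax h s * C := Finset.sum_le_sum fun s _ => by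
        rw [abs_mul, abs_of_nonneg (softmax_nonneg h s)]
        exact mul_le_mul_of_nonneg_left (hf s) (softmax_nonneg h s)
    _ = C := by rw [← Finset.sum_mul, sum_softmax, one_mul]

/-- The log-partition function of a linear Hamiltonian has bounded gradient. -/
lemma hasGrad_log_sum_exp [Nonempty S] (c : E → S → ℝ) (b : S → ℝ) {C : ℝ}
    (hC : ∀ e s, |c e s| ≤ C) :
    HasGrad (fun x => log (∑ s, exp (b s + ∑ e, x e * c e s)))
      (fun x e => ∑ s, softmax (fun s => b s + ∑ e, x e * c e s) s * c e s) C where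
  deriv x := by
    have h1 : ∀ s, HasFDerivAt (fun x : E → ℝ => b s + ∑ e, x e * c e s)
        (∑ e, c e s • ContinuousLinearMap.proj (R := ℝ) (φ := fun _ : E => ℝ) e) x := fun s => by
      refine HasFDerivAt.const_add _ (HasFDerivAt.fun_sum fun e _ => ?_)
      exact (ContinuousLinearMap.proj (R := ℝ) (φ := fun _ : E => ℝ) e).hasFDerivAt.mul_const _
    have h2 := (HasFDerivAt.fun_sum fun s (_ : s ∈ Finset.univ) => (h1 s).exp).log
      (sum_exp_pos _).ne'
    refine h2.congr_fderiv ?_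
    ext v
    simp only [smul_apply, _root_.sum_apply,
      ContinuousLinearMap.proj_apply, smul_eq_mul, softmax, Finset.mul_sum, Finset.sum_mul]
    rw [Finset.sum_comm]
    exact Finset.sum_congr rfl fun e _ => Finset.sum_congr rfl fun s _ => by ring
  cont e := by
    refine continuous_finsetSum _ fun s _ => Continuous.mul ?_ continuous_const
    unfold softmax
    exact Continuous.div (by fun_prop) (by fun_prop) fun x => (sum_exp_pos _).ne'
  bdd x e := abs_sum_softmax_mul_le _ _ (hC e)

/-- The soft maximum of finitely many affine functions of small slope, truncated smoothly. -/
lemma measureReal_softMax_le [Nonempty S] (ℓ : S → ℝ) (w : E → S → ℝ) {K : ℝ}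
    (hK : ∀ s, ∑ e, w e s ^ 2 ≤ K) (hK0 : 0 < K) {k x m q r s : ℝ} (hk : 0 < k) (hx : 0 < x)
    (hm : 0 ≤ m) (hr : 0 ≤ r) (hs : 0 ≤ s) (hrq : exp (-(r ^ 2 / (2 * K))) < q)
    (hmx : m + r + s ≤ 3 / 4 * x)
    (hq : q ≤ (stdG E).real {z | -m ≤ 1 / k * (log (∑ i, exp (k * ℓ i + ∑ e, z e * (k * w e i)))
      - log (Fintype.card S))}) :
    (stdG E).real {z | 1 / k * (log (∑ i, exp (k * ℓ i + ∑ e, z e * (k * w e i)))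
      - log (Fintype.card S)) < -x} ≤ exp (-(s ^ 2 / (2 * K))) := by
  obtain ⟨C, hC⟩ : ∃ C, ∀ e i, |k * w e i| ≤ C := by
    obtain ⟨C, hC⟩ := (Set.finite_range fun p : E × S => |k * w p.1 p.2|).bddAbove
    exact ⟨C, fun e i => hC ⟨(e, i), rfl⟩⟩
  set L : (E → ℝ) → ℝ := fun z => log (∑ i, exp (k * ℓ i + ∑ e, z e * (k * w e i)))
  set φ : ℝ → ℝ := fun t => x * arctan (1 / k * (t - log (Fintype.card S)) / x) with hφ
  have hGL := hasGrad_log_sum_exp (fun e i => k * w e i) (fun i => k * ℓ i) hC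
  have hd : ∀ t, HasDerivAt φ
      (1 / k * (1 / (1 + (1 / k * (t - log (Fintype.card S)) / x) ^ 2))) t := fun t => by
    have h1 : HasDerivAt (fun t => 1 / k * (t - log (Fintype.card S)) / x) (1 / k / x) t := by
      simpa using ((((hasDerivAt_id t).sub_const (log (Fintype.card S))).const_mul (1 / k)).div_const x)
    refine (h1.arctan.const_mul x).congr_deriv ?_
    field_simp
  have hpos : ∀ t, 0 < 1 + (1 / k * (t - log (Fintype.card S)) / x) ^ 2 := fun t => by positivity
  have hle : ∀ t, |1 / (1 + (1 / k * (t - log (Fintype.card S)) / x) ^ 2)| ≤ 1 := fun t => by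
    rw [abs_of_pos (one_div_pos.2 (hpos t)), div_le_one (hpos t)]
    nlinarith [sq_nonneg (1 / k * (t - log (Fintype.card S)) / x)]
  have hG := hGL.comp_left (D := 1 / k) hd
    (continuous_const.mul (Continuous.div (by fun_prop) (by fun_prop) fun t => (hpos t).ne'))
    (fun z => by
      rw [abs_mul, abs_of_pos (one_div_pos.2 hk)]
      exact mul_le_of_le_one_right (one_div_pos.2 hk).le (hle _))
  have hbd : ∀ z, |(φ ∘ L) z| ≤ x * (π / 2) := fun z => by
    simp only [Function.comp, hφ, abs_mul, abs_of_pos hx]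
    exact mul_le_mul_of_nonneg_left
      (abs_le.2 ⟨(neg_pi_div_two_lt_arctan _).le, (arctan_lt_pi_div_two _).le⟩) hx.le
  have hgr : ∀ z, ∑ e, (1 / k * (1 / (1 + (1 / k * (L z - log (Fintype.card S)) / x) ^ 2)) *
      ∑ i, softmax (fun i => k * ℓ i + ∑ e, z e * (k * w e i)) i * (k * w e i)) ^ 2 ≤ K := by
    intro z
    set p := softmax fun i => k * ℓ i + ∑ e, z e * (k * w e i)
    set a := 1 / (1 + (1 / k * (L z - log (Fintype.card S)) / x) ^ 2) with ha
    have h0 : ∀ e, ∑ i, p i * (k * w e i) = k * ∑ i, p i * w e i := fun e => by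
      rw [Finset.mul_sum]; exact Finset.sum_congr rfl fun i _ => by ring
    have h1 : ∀ e, (∑ i, p i * w e i) ^ 2 ≤ ∑ i, p i * w e i ^ 2 := fun e => by
      have h2 : 0 ≤ ∑ i, p i * (w e i - ∑ j, p j * w e j) ^ 2 :=
        Finset.sum_nonneg fun i _ => mul_nonneg (softmax_nonneg _ i) (sq_nonneg _)
      set M := ∑ j, p j * w e j with hM
      have h3 : ∑ i, p i * (w e i - M) ^ 2 = ∑ i, p i * w e i ^ 2 - M ^ 2 := by
        have : ∀ i, p i * (w e i - M) ^ 2 = p i * w e i ^ 2 - 2 * M * (p i * w e i) + M ^ 2 * p i :=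
          fun i => by ring
        simp only [this, Finset.sum_add_distrib, Finset.sum_sub_distrib, ← Finset.mul_sum, ← hM]
        rw [show ∑ i, p i = 1 from sum_softmax _]
        ring
      linarith
    have ha1 : a ^ 2 ≤ 1 := by
      rw [← sq_abs]; exact pow_le_one₀ (abs_nonneg _) (hle _)
    calc ∑ e, (1 / k * a * ∑ i, p i * (k * w e i)) ^ 2
        = ∑ e, a ^ 2 * (∑ i, p i * w e i) ^ 2 := Finset.sum_congr rfl fun e _ => by
          rw [h0]; field_simp
      _ ≤ ∑ e, ∑ i, p i * w e i ^ 2 := Finset.sum_le_sum fun e _ =>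
          (mul_le_of_le_one_left (sq_nonneg _) ha1).trans (h1 e)
      _ = ∑ i, p i * ∑ e, w e i ^ 2 := by
          rw [Finset.sum_comm]; simp only [Finset.mul_sum]
      _ ≤ ∑ i, p i * K := Finset.sum_le_sum fun i _ =>
          mul_le_mul_of_nonneg_left (hK i) (softmax_nonneg _ i)
      _ = K := by rw [← Finset.sum_mul, show ∑ i, p i = 1 from sum_softmax _, one_mul]
  have harc : ∀ t : ℝ, t ≤ 0 → t ≤ arctan t := fun t ht => by
    have h := le_tan (arctan_nonneg.2 (neg_nonneg.2 ht)) (arctan_lt_pi_div_two _)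
    rw [tan_arctan, arctan_neg] at h; linarith
  refine le_trans (measureReal_mono fun z hz => ?_)
    (hG.measureReal_le_neg_le (m := m) hbd hgr hK0 hr hs hrq (hq.trans (measureReal_mono fun z hz => ?_)))
  · have hz : 1 / k * (L z - log (Fintype.card S)) < -x := hz
    show φ (L z) ≤ -(m + r + s)
    have h1 : 1 / k * (L z - log (Fintype.card S)) / x ≤ -1 := by
      rw [div_le_iff₀ hx]; linarith
    have h2 := arctan_strictMono.monotone h1
    rw [arctan_neg, arctan_one] at h2
    have : x * arctan (1 / k * (L z - log (Fintype.card S)) / x) ≤ x * -(π / 4) :=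
      mul_le_mul_of_nonneg_left h2 hx.le
    have h3 := pi_gt_three
    simp only [hφ]
    nlinarith
  · have hz : -m ≤ 1 / k * (L z - log (Fintype.card S)) := hz
    show -m ≤ φ (L z)
    have h1 : -m / x ≤ 1 / k * (L z - log (Fintype.card S)) / x := by gcongr
    have h2 := (harc (-m / x) (div_nonpos_of_nonpos_of_nonneg (by linarith) hx.le)).trans
      (arctan_strictMono.monotone h1)
    rw [div_le_iff₀ hx] at h2
    simp only [hφ]; linarith

/-- A function with affine minorants of small slope at the points of a set `A` of non-negligible
probability, on which it is not too negative, is very negative only with small probability. -/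
lemma measureReal_lt_neg_le_of_minorants {P : (E → ℝ) → ℝ} {A : Set (E → ℝ)}
    (hA : MeasurableSet A) {v : (E → ℝ) → E → ℝ} {K m q r s x : ℝ}
    (hv : ∀ y ∈ A, ∀ z, P y + ∑ e, (z e - y e) * v y e ≤ P z)
    (hK : ∀ y ∈ A, ∑ e, v y e ^ 2 ≤ K) (hK0 : 0 < K) (hm : 0 ≤ m) (hmP : ∀ y ∈ A, -m ≤ P y)
    (hq0 : 0 < q) (hq : q ≤ (stdG E).real A) (hr : 0 ≤ r) (hs : 0 ≤ s)
    (hrq : exp (-(r ^ 2 / (2 * K))) < q / 2) (hx : 0 < x) (hmx : m + 1 + r + s ≤ 3 / 4 * x) :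
    (stdG E).real {z | P z < -x} ≤ exp (-(s ^ 2 / (2 * K))) := by
  have hlt : ENNReal.ofReal (q / 2) < stdG E A := by
    rw [ENNReal.ofReal_lt_iff_lt_toReal (by linarith) (measure_ne_top _ _)]
    exact lt_of_lt_of_le (by linarith) hq
  obtain ⟨B, hBA, hBc, hB⟩ := hA.exists_lt_isCompact hlt
  have hBq : q / 2 ≤ (stdG E).real B :=
    ((ENNReal.ofReal_lt_iff_lt_toReal (by linarith) (measure_ne_top _ _)).1 hB).le
  set δ : ℝ := 1 / (Fintype.card E + K) with hδ
  have hδ0 : 0 < δ := by positivity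
  obtain ⟨t, htB, hBt⟩ := hBc.elim_nhds_subcover (fun y => Metric.ball y δ)
    fun y _ => Metric.ball_mem_nhds y hδ0
  have htne : Nonempty t := by
    by_contra hne
    rw [not_nonempty_iff, isEmpty_subtype] at hne
    have : B = ∅ := by
      refine Set.eq_empty_of_subset_empty (hBt.trans ?_)
      simp [Finset.eq_empty_of_forall_notMem hne]
    rw [this, measureReal_empty] at hBq
    linarith
  set n : ℝ := ((Fintype.card t : ℕ) : ℝ) with hn
  have hn1 : 1 ≤ n := by rw [hn]; exact_mod_cast Fintype.card_pos
  set k : ℝ := 2 * log n + 1 with hk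
  have hk0 : 0 < k := by have := log_nonneg hn1; linarith
  set ℓ : t → ℝ := fun y => P y - ∑ e, (y : E → ℝ) e * v y e
  have hlin : ∀ (y : t) (z : E → ℝ), k * ℓ y + ∑ e, z e * (k * v y e) =
      k * (P y + ∑ e, (z e - (y : E → ℝ) e) * v y e) := fun y z => by
    simp only [ℓ, sub_mul, Finset.sum_sub_distrib, mul_add, mul_sub, Finset.mul_sum]
    have : ∑ e, z e * (k * v y e) = ∑ e, k * (z e * v y e) :=
      Finset.sum_congr rfl fun e _ => by ring
    rw [this]; ring
  have key := measureReal_softMax_le (E := E) (S := t) ℓ (fun e y => v y e)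
    (fun y => hK y (hBA (htB y y.2))) hK0 hk0 hx (by linarith : 0 ≤ m + 1) hr hs hrq hmx
    (hBq.trans (measureReal_mono fun z hz => ?_))
  · refine (measureReal_mono fun z hz => ?_).trans key
    refine lt_of_le_of_lt ?_ (show P z < -x from hz)
    have : ∑ y : t, exp (k * ℓ y + ∑ e, z e * (k * v y e)) ≤ n * exp (k * P z) := by
      calc _ ≤ ∑ y : t, exp (k * P z) := Finset.sum_le_sum fun y _ => by
            rw [hlin, exp_le_exp]
            exact mul_le_mul_of_nonneg_left (hv y (hBA (htB y y.2)) z) hk0.le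
        _ = _ := by simp [hn]
    have h2 := log_le_log (sum_exp_pos _) this
    rw [log_mul (by positivity) (exp_pos _).ne', log_exp] at h2
    rw [one_div, inv_mul_le_iff₀ hk0]
    linarith
  · obtain ⟨y, hyt, hzy⟩ := Set.mem_iUnion₂.1 (hBt hz)
    have hyA := hBA (htB y hyt)
    have h1 : exp (k * (P y + ∑ e, (z e - y e) * v y e)) ≤
        ∑ y : t, exp (k * ℓ y + ∑ e, z e * (k * v y e)) := by
      rw [← hlin ⟨y, hyt⟩]
      exact Finset.single_le_sum (f := fun y : t => exp (k * ℓ y + ∑ e, z e * (k * v y e)))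
        (fun _ _ => (exp_pos _).le) (Finset.mem_univ (⟨y, hyt⟩ : t))
    have h2 := log_le_log (exp_pos _) h1
    rw [log_exp] at h2
    have h3 : |∑ e, (z e - y e) * v y e| ≤ 1 / 2 := by
      calc |∑ e, (z e - y e) * v y e| ≤ ∑ e, δ * ((1 + v y e ^ 2) / 2) := by
            refine (Finset.abs_sum_le_sum_abs _ _).trans (Finset.sum_le_sum fun e _ => ?_)
            rw [abs_mul]
            refine mul_le_mul ?_ ?_ (abs_nonneg _) hδ0.le
            · exact (dist_le_pi_dist z y e).trans (Metric.mem_ball.1 hzy).le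
            · rw [← sq_abs]; nlinarith [sq_nonneg (|v y e| - 1)]
        _ = δ * ((Fintype.card E + ∑ e, v y e ^ 2) / 2) := by
            rw [← Finset.mul_sum, ← Finset.sum_div, Finset.sum_add_distrib]; simp
        _ ≤ δ * ((Fintype.card E + K) / 2) := by gcongr; exact hK y hyA
        _ = 1 / 2 := by rw [hδ]; field_simp
    show -(m + 1) ≤ 1 / k * (_ - log n)
    rw [one_div, le_inv_mul_iff₀ hk0]
    have h4 := hmP y hyA
    have h5 := (abs_le.1 h3).1
    have h6 : k * (-m - 1 / 2) ≤ k * (P y + ∑ e, (z e - y e) * v y e) :=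
      mul_le_mul_of_nonneg_left (by linarith) hk0.le
    linarith

end Minorants

section Annealed

variable {E : Type*} [Fintype E] [DecidableEq E] {N : ℕ}

lemma integrable_exp_sum_mul (a : E → ℝ) :
    Integrable (fun x => exp (∑ e, x e * a e)) (stdG E) := by
  simp only [exp_sum]
  refine Integrable.fintype_prod (f := fun e t => exp (t * a e)) fun e => ?_
  simpa only [mul_comm] using integrable_exp_mul_gaussianReal (μ := 0) (v := 1) (a e)

lemma integral_exp_sum_mul (a : E → ℝ) :
    ∫ x, exp (∑ e, x e * a e) ∂stdG E = exp (∑ e, a e ^ 2 / 2) := by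
  simp only [exp_sum]
  rw [integral_fintype_prod_eq_prod (fun e t => exp (t * a e))]
  refine Finset.prod_congr rfl fun e _ => ?_
  have h := congrFun (mgf_id_gaussianReal (μ := 0) (v := 1)) (a e)
  simp only [mgf, id, zero_mul, zero_add, NNReal.coe_one, one_mul] at h
  simpa only [mul_comm] using h

lemma integral_exp_sq_gaussianReal {v : ℝ} (hv : v < 1) :
    Integrable (fun z => exp (v * z ^ 2 / 2)) (gaussianReal 0 1) ∧
      ∫ z, exp (v * z ^ 2 / 2) ∂gaussianReal 0 1 = 1 / √(1 - v) := by
  have hpdf : ∀ z, gaussianPDFReal 0 1 z • exp (v * z ^ 2 / 2) =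
      (√(2 * π))⁻¹ * exp (-((1 - v) / 2) * z ^ 2) := fun z => by
    rw [gaussianPDFReal, smul_eq_mul, mul_assoc, ← exp_add]
    simp only [NNReal.coe_one, mul_one, sub_zero]
    congr 2
    ring
  constructor
  · rw [gaussianReal_of_var_ne_zero _ one_ne_zero,
      integrable_withDensity_iff_integrable_smul' (measurable_gaussianPDF 0 1)
        (ae_of_all _ fun z => gaussianPDF_lt_top)]
    simp only [toReal_gaussianPDF]
    simp_rw [hpdf]
    exact (integrable_exp_neg_mul_sq (by linarith)).const_mul _
  · rw [integral_gaussianReal_eq_integral_smul one_ne_zero]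
    simp_rw [hpdf]
    rw [integral_const_mul, integral_gaussian, ← sqrt_inv, ← sqrt_mul (by positivity), one_div,
      ← sqrt_inv]
    congr 1
    have : (1 - v) ≠ 0 := by linarith
    field_simp

lemma integral_exp_mul_gaussianReal (s : ℝ) :
    ∫ z, exp (s * z) ∂gaussianReal 0 1 = exp (s ^ 2 / 2) := by
  have h := congrFun (mgf_id_gaussianReal (μ := 0) (v := 1)) s
  simpa [mgf] using h

lemma sum_exp_mul_spin (σ : Config N) (t : ℝ) :
    ∑ τ : Config N, exp (t * ∑ i, spin (σ i) * spin (τ i)) = (2 * cosh t) ^ N := by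
  simp only [Finset.mul_sum, exp_sum]
  rw [← Fintype.prod_sum (fun (i : Fin N) (b : Bool) => exp (t * (spin (σ i) * spin b)))]
  have : ∀ i, ∑ b : Bool, exp (t * (spin (σ i) * spin b)) = 2 * cosh t := fun i => by
    rw [Fintype.sum_bool, cosh_eq]
    cases σ i <;> simp [spin] <;> ring
  simp only [this, Finset.prod_const, Finset.card_univ, Fintype.card_fin]

/-- The overlap of two independent uniform configurations is sub-Gaussian. -/
lemma sum_exp_ovlp_sq_le (hN : 1 ≤ N) {v : ℝ} (hv0 : 0 ≤ v) (hv : v < 1) (σ : Config N) :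
    ∑ τ : Config N, exp (v * (N * ovlp N σ τ ^ 2) / 2) ≤ 2 ^ N * (1 / √(1 - v)) := by
  have hN0 : (0 : ℝ) < N := by exact_mod_cast hN
  have h1 : ∀ τ : Config N, exp (v * (N * ovlp N σ τ ^ 2) / 2) =
      ∫ z, exp (√(v / N) * (∑ i, spin (σ i) * spin (τ i)) * z) ∂gaussianReal 0 1 := fun τ => by
    rw [integral_exp_mul_gaussianReal, mul_pow, sq_sqrt (by positivity), ovlp]
    congr 1
    field_simp
  simp only [h1]
  rw [← integral_finsetSum _ fun τ _ => integrable_exp_mul_gaussianReal _]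
  have h2 : ∀ z, ∑ τ : Config N, exp (√(v / N) * (∑ i, spin (σ i) * spin (τ i)) * z) ≤
      2 ^ N * exp (v * z ^ 2 / 2) := fun z => by
    calc ∑ τ : Config N, exp (√(v / N) * (∑ i, spin (σ i) * spin (τ i)) * z)
        = (2 * cosh (√(v / N) * z)) ^ N := by
          rw [← sum_exp_mul_spin σ]
          exact Finset.sum_congr rfl fun τ _ => by congr 1; ring
      _ ≤ (2 * exp ((√(v / N) * z) ^ 2 / 2)) ^ N := by
          have := cosh_pos (√(v / N) * z)
          have := cosh_le_exp_half_sq (√(v / N) * z)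
          gcongr
      _ = 2 ^ N * exp (v * z ^ 2 / 2) := by
          rw [mul_pow, ← exp_nat_mul, mul_pow, sq_sqrt (by positivity)]
          congr 2
          field_simp
  rw [← (integral_exp_sq_gaussianReal hv).2, ← integral_const_mul]
  exact integral_mono (integrable_finsetSum _ fun τ _ => integrable_exp_mul_gaussianReal _)
    ((integral_exp_sq_gaussianReal hv).1.const_mul _) h2

lemma sum_skc_mul (hN : 1 ≤ N) (β : ℝ) (σ τ : Config N) :
    ∑ e, skc N β e σ * skc N β e τ = β ^ 2 * (N * ovlp N σ τ ^ 2 - 1) / 2 := by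
  have hN0 : (0 : ℝ) < N := by exact_mod_cast hN
  set a : Fin N → ℝ := fun i => spin (σ i) * spin (τ i) with ha
  have h1 : ∀ e : Fin N × Fin N, skc N β e σ * skc N β e τ =
      β ^ 2 / N * (if e.1 < e.2 then a e.1 * a e.2 else 0) := fun e => by
    unfold skc
    split_ifs
    · simp only [ha]
      have : (β / √N) * (β / √N) = β ^ 2 / N := by
        rw [div_mul_div_comm, mul_self_sqrt hN0.le, sq]
      rw [← this]; ring
    · simp
  have h2 : (∑ i, a i) ^ 2 = N + 2 * ∑ e : Fin N × Fin N, if e.1 < e.2 then a e.1 * a e.2 else 0 := by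
    have hs : ∑ e : Fin N × Fin N, (if e.2 < e.1 then a e.1 * a e.2 else 0) =
        ∑ e : Fin N × Fin N, if e.1 < e.2 then a e.1 * a e.2 else 0 :=
      Fintype.sum_equiv (Equiv.prodComm _ _) _ _ fun e => by simp [mul_comm]
    have hd : ∑ e : Fin N × Fin N, (if e.1 = e.2 then a e.1 * a e.2 else 0) = N := by
      rw [Fintype.sum_prod_type]
      have : ∀ i, a i * a i = 1 := fun i => by
        simp only [ha]
        rw [mul_mul_mul_comm, spin_mul_self, spin_mul_self, one_mul]
      simp [this]
    rw [sq, Finset.sum_mul_sum, ← Fintype.sum_prod_type', ← hd, two_mul]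
    nth_rw 2 [← hs]
    rw [← Finset.sum_add_distrib, ← Finset.sum_add_distrib]
    refine Finset.sum_congr rfl fun e _ => ?_
    rcases lt_trichotomy e.1 e.2 with h | h | h
    · simp [h, h.ne, h.not_gt]
    · simp [h]
    · simp [h, h.ne', h.not_gt]
  simp only [h1, ← Finset.mul_sum]
  rw [ovlp, div_pow]
  change _ = β ^ 2 * (N * ((∑ i, a i) ^ 2 / N ^ 2) - 1) / 2
  rw [h2]
  field_simp
  ring

/-- The normalized two-replica partition function with weight `Φ`. -/
def skY (N : ℕ) (β : ℝ) (Φ : Config N → Config N → ℝ) (g : Fin N × Fin N → ℝ) : ℝ :=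
  ∑ σ, ∑ τ, (1 / 4 ^ N : ℝ) * (exp (ham N β g σ + ham N β g τ - β ^ 2 * (N - 1) / 2) * Φ σ τ)

/-- The partition function normalized to have mean one. -/
def skZ (N : ℕ) (β : ℝ) (g : Fin N × Fin N → ℝ) : ℝ :=
  ∑ σ, (1 / 2 ^ N : ℝ) * exp (ham N β g σ - β ^ 2 * (N - 1) / 4)

lemma ham_eq_sum (β : ℝ) (g : Fin N × Fin N → ℝ) (σ : Config N) :
    ham N β g σ = ∑ e, g e * skc N β e σ := by
  rw [← cavH_skc β ∅, cavH_one_eq]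

lemma sum_skc_sq (hN : 1 ≤ N) (β : ℝ) (σ : Config N) :
    ∑ e, skc N β e σ ^ 2 = β ^ 2 * (N - 1) / 2 := by
  have h := sum_skc_mul hN β σ σ
  have : ovlp N σ σ = 1 := by
    have hN0 : (N : ℝ) ≠ 0 := by positivity
    simp [ovlp, spin_mul_self, hN0]
  simp only [← sq] at h
  rw [h, this]; ring

lemma exp_ham_sub_eq (β κ : ℝ) (g : Fin N × Fin N → ℝ) (σ : Config N) :
    exp (ham N β g σ - κ) = exp (-κ) * exp (∑ e, g e * skc N β e σ) := by
  rw [← exp_add, ham_eq_sum]; ring_nf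

lemma exp_ham_add_ham_sub_eq (β κ : ℝ) (g : Fin N × Fin N → ℝ) (σ τ : Config N) :
    exp (ham N β g σ + ham N β g τ - κ) =
      exp (-κ) * exp (∑ e, g e * (skc N β e σ + skc N β e τ)) := by
  rw [← exp_add, ham_eq_sum, ham_eq_sum]
  simp only [mul_add, Finset.sum_add_distrib]
  ring_nf

lemma integrable_skZ (β : ℝ) : Integrable (skZ N β) (stdG (Fin N × Fin N)) := by
  unfold skZ
  refine integrable_finsetSum _ fun σ _ => Integrable.const_mul ?_ _
  simp only [exp_ham_sub_eq]
  exact (integrable_exp_sum_mul _).const_mul _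

lemma integral_skZ (hN : 1 ≤ N) (β : ℝ) : ∫ g, skZ N β g ∂stdG (Fin N × Fin N) = 1 := by
  unfold skZ
  simp only [exp_ham_sub_eq]
  rw [integral_finsetSum _ fun σ _ => ((integrable_exp_sum_mul _).const_mul _).const_mul _]
  simp only [integral_const_mul, integral_exp_sum_mul]
  have : ∀ σ : Config N, (1 / 2 ^ N : ℝ) * (exp (-(β ^ 2 * (N - 1) / 4)) *
      exp (∑ e, skc N β e σ ^ 2 / 2)) = 1 / 2 ^ N := fun σ => by
    rw [← exp_add, ← Finset.sum_div, sum_skc_sq hN]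
    ring_nf
    simp
  simp only [this]
  simp [Config]

lemma integrable_skY (β : ℝ) (Φ : Config N → Config N → ℝ) :
    Integrable (skY N β Φ) (stdG (Fin N × Fin N)) := by
  unfold skY
  refine integrable_finsetSum _ fun σ _ => integrable_finsetSum _ fun τ _ =>
    Integrable.const_mul (Integrable.mul_const ?_ _) _
  simp only [exp_ham_add_ham_sub_eq]
  exact (integrable_exp_sum_mul _).const_mul _

lemma integral_skY (hN : 1 ≤ N) (β : ℝ) (Φ : Config N → Config N → ℝ) :
    ∫ g, skY N β Φ g ∂stdG (Fin N × Fin N) =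
      ∑ σ, ∑ τ, (1 / 4 ^ N : ℝ) * (exp (β ^ 2 * (N * ovlp N σ τ ^ 2 - 1) / 2) * Φ σ τ) := by
  unfold skY
  simp only [exp_ham_add_ham_sub_eq]
  have hi : ∀ σ τ : Config N, Integrable (fun g : Fin N × Fin N → ℝ => (1 / 4 ^ N : ℝ) *
      (exp (-(β ^ 2 * (N - 1) / 2)) * exp (∑ e, g e * (skc N β e σ + skc N β e τ)) * Φ σ τ))
      (stdG (Fin N × Fin N)) := fun σ τ =>
    (((integrable_exp_sum_mul _).const_mul _).mul_const _).const_mul _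
  rw [integral_finsetSum _ fun σ _ => integrable_finsetSum _ fun τ _ => hi σ τ]
  refine Finset.sum_congr rfl fun σ _ => ?_
  rw [integral_finsetSum _ fun τ _ => hi σ τ]
  refine Finset.sum_congr rfl fun τ _ => ?_
  rw [integral_const_mul, integral_mul_const, integral_const_mul, integral_exp_sum_mul, ← exp_add]
  congr 3
  have : ∑ e, (skc N β e σ + skc N β e τ) ^ 2 / 2 =
      (∑ e, skc N β e σ ^ 2) / 2 + (∑ e, skc N β e τ ^ 2) / 2 +
        ∑ e, skc N β e σ * skc N β e τ := by
    rw [Finset.sum_div, Finset.sum_div, ← Finset.sum_add_distrib, ← Finset.sum_add_distrib]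
    exact Finset.sum_congr rfl fun e _ => by ring
  rw [this, sum_skc_sq hN, sum_skc_sq hN, sum_skc_mul hN]
  ring

lemma integral_skY_exp_le (hN : 1 ≤ N) {β v : ℝ} (hv : 0 ≤ v) (hv1 : β ^ 2 + v < 1) :
    ∫ g, skY N β (fun σ τ => exp (v * (N * ovlp N σ τ ^ 2) / 2)) g ∂stdG (Fin N × Fin N) ≤
      1 / √(1 - (β ^ 2 + v)) := by
  rw [integral_skY hN]
  calc ∑ σ : Config N, ∑ τ : Config N, (1 / 4 ^ N : ℝ) *
        (exp (β ^ 2 * (N * ovlp N σ τ ^ 2 - 1) / 2) * exp (v * (N * ovlp N σ τ ^ 2) / 2))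
      ≤ ∑ σ : Config N, (1 / 4 ^ N : ℝ) *
          ∑ τ : Config N, exp ((β ^ 2 + v) * (N * ovlp N σ τ ^ 2) / 2) := by
        refine Finset.sum_le_sum fun σ _ => ?_
        rw [Finset.mul_sum]
        refine Finset.sum_le_sum fun τ _ => mul_le_mul_of_nonneg_left ?_ (by positivity)
        rw [← exp_add, exp_le_exp]
        nlinarith [sq_nonneg β]
    _ ≤ ∑ σ : Config N, (1 / 4 ^ N : ℝ) * (2 ^ N * (1 / √(1 - (β ^ 2 + v)))) :=
        Finset.sum_le_sum fun σ _ => mul_le_mul_of_nonneg_left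
          (sum_exp_ovlp_sq_le hN (by positivity) hv1 σ) (by positivity)
    _ = 1 / √(1 - (β ^ 2 + v)) := by
        rw [Finset.sum_const, Finset.card_univ, nsmul_eq_mul]
        have h4 : (4 : ℝ) ^ N = 2 ^ N * 2 ^ N := by rw [← mul_pow]; norm_num
        have : (Fintype.card (Config N) : ℝ) = 2 ^ N := by simp [Config]
        rw [this, h4]
        field_simp

/-- The two-replica Gibbs average. -/
def skAv (N : ℕ) (β : ℝ) (Φ : Config N → Config N → ℝ) (g : Fin N × Fin N → ℝ) : ℝ :=
  ∑ σ, ∑ τ, softmax (ham N β g) σ * softmax (ham N β g) τ * Φ σ τ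

lemma skZ_eq (β : ℝ) (g : Fin N × Fin N → ℝ) :
    skZ N β g = 1 / 2 ^ N * exp (-(β ^ 2 * (N - 1) / 4)) * ∑ σ, exp (ham N β g σ) := by
  unfold skZ
  rw [Finset.mul_sum]
  refine Finset.sum_congr rfl fun σ _ => ?_
  rw [sub_eq_add_neg, exp_add]; ring

lemma skZ_pos (β : ℝ) (g : Fin N × Fin N → ℝ) : 0 < skZ N β g := by
  rw [skZ_eq]
  have := sum_exp_pos (ham N β g)
  positivity

lemma skY_eq (β : ℝ) (Φ : Config N → Config N → ℝ) (g : Fin N × Fin N → ℝ) :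
    skY N β Φ g = skZ N β g ^ 2 * skAv N β Φ g := by
  have hp := (sum_exp_pos (ham N β g)).ne'
  rw [skZ_eq]
  unfold skY skAv softmax
  simp only [Finset.mul_sum]
  refine Finset.sum_congr rfl fun σ _ => Finset.sum_congr rfl fun τ _ => ?_
  have h4 : (4 : ℝ) ^ N = 2 ^ N * 2 ^ N := by rw [← mul_pow]; norm_num
  have h5 : exp (ham N β g σ + ham N β g τ - β ^ 2 * (N - 1) / 2) =
      exp (-(β ^ 2 * (N - 1) / 4)) ^ 2 * (exp (ham N β g σ) * exp (ham N β g τ)) := by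
    rw [← exp_nat_mul, ← exp_add, ← exp_add]; congr 1; push_cast; ring
  rw [h5, h4, ← Finset.mul_sum]
  field_simp

lemma continuous_skZ (β : ℝ) : Continuous (skZ N β) := by
  unfold skZ; simp only [ham_eq_sum]; fun_prop

lemma continuous_skY (β : ℝ) (Φ : Config N → Config N → ℝ) : Continuous (skY N β Φ) := by
  unfold skY; simp only [ham_eq_sum]; fun_prop

/-- Jensen's inequality for the log-partition function. -/
lemma log_skZ_ge (β : ℝ) (y z : Fin N × Fin N → ℝ) :
    log (skZ N β y) + ∑ e, (z e - y e) * ∑ σ, softmax (ham N β y) σ * skc N β e σ ≤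
      log (skZ N β z) := by
  have hy := sum_exp_pos (ham N β y)
  have hz := sum_exp_pos (ham N β z)
  set p := softmax (ham N β y) with hp
  have h1 : ∑ e, (z e - y e) * ∑ σ, p σ * skc N β e σ =
      ∑ σ, p σ * (ham N β z σ - ham N β y σ) := by
    simp only [ham_eq_sum, Finset.mul_sum, ← Finset.sum_sub_distrib]
    rw [Finset.sum_comm]
    exact Finset.sum_congr rfl fun σ _ => Finset.sum_congr rfl fun e _ => by ring
  have h2 : exp (∑ σ, p σ * (ham N β z σ - ham N β y σ)) ≤
      ∑ σ, p σ * exp (ham N β z σ - ham N β y σ) := by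
    have := convexOn_exp.map_sum_le (t := Finset.univ) (w := p)
      (p := fun σ => ham N β z σ - ham N β y σ) (fun σ _ => softmax_nonneg _ σ) (sum_softmax _)
      (fun _ _ => Set.mem_univ _)
    simpa using this
  have h3 : ∑ σ, p σ * exp (ham N β z σ - ham N β y σ) = skZ N β z / skZ N β y := by
    rw [skZ_eq, skZ_eq, mul_div_mul_left _ _ (by positivity), Finset.sum_div]
    refine Finset.sum_congr rfl fun σ _ => ?_
    rw [hp, softmax, exp_sub]
    field_simp
  rw [h1]
  rw [h3] at h2
  have h4 := log_le_log (exp_pos _) h2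
  rw [log_exp, log_div (skZ_pos β z).ne' (skZ_pos β y).ne'] at h4
  linarith

lemma sum_slope_mul (hN : 1 ≤ N) (β : ℝ) (p q : Config N → ℝ) :
    ∑ e, (∑ σ, p σ * skc N β e σ) * (∑ σ, q σ * skc N β e σ) =
      ∑ σ, ∑ τ, p σ * q τ * (β ^ 2 * (N * ovlp N σ τ ^ 2 - 1) / 2) := by
  have h1 : ∀ e, (∑ σ, p σ * skc N β e σ) * (∑ σ, q σ * skc N β e σ) =
      ∑ σ, ∑ τ, p σ * q τ * (skc N β e σ * skc N β e τ) := fun e => by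
    rw [Finset.sum_mul_sum]
    exact Finset.sum_congr rfl fun σ _ => Finset.sum_congr rfl fun τ _ => by ring
  rw [Finset.sum_congr rfl fun e _ => h1 e, Finset.sum_comm]
  refine Finset.sum_congr rfl fun σ _ => ?_
  rw [Finset.sum_comm]
  exact Finset.sum_congr rfl fun τ _ => by rw [← Finset.mul_sum, sum_skc_mul hN]

end Annealed

section LowerTail

variable {N : ℕ}

lemma skAv_mono {β : ℝ} {Φ Ψ : Config N → Config N → ℝ} (h : ∀ σ τ, Φ σ τ ≤ Ψ σ τ)
    (g : Fin N × Fin N → ℝ) : skAv N β Φ g ≤ skAv N β Ψ g :=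
  Finset.sum_le_sum fun σ _ => Finset.sum_le_sum fun τ _ => mul_le_mul_of_nonneg_left (h σ τ)
    (mul_nonneg (softmax_nonneg _ _) (softmax_nonneg _ _))

lemma skAv_const_mul (β b : ℝ) (Φ : Config N → Config N → ℝ) (g : Fin N × Fin N → ℝ) :
    skAv N β (fun σ τ => b * Φ σ τ) g = b * skAv N β Φ g := by
  simp only [skAv, Finset.mul_sum]
  exact Finset.sum_congr rfl fun σ _ => Finset.sum_congr rfl fun τ _ => by ring

lemma skAv_const (β b : ℝ) (g : Fin N × Fin N → ℝ) : skAv N β (fun _ _ => b) g = b := by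
  simp only [skAv, ← Finset.sum_mul, ← Finset.mul_sum, sum_softmax, mul_one, one_mul]

lemma skAv_nonneg {β : ℝ} {Φ : Config N → Config N → ℝ} (h : ∀ σ τ, 0 ≤ Φ σ τ)
    (g : Fin N × Fin N → ℝ) : 0 ≤ skAv N β Φ g := by
  have := skAv_mono (β := β) h g
  rwa [skAv_const] at this

/-- Jensen's inequality for the two-replica Gibbs average. -/
lemma exp_skAv_le (β : ℝ) (Φ : Config N → Config N → ℝ) (g : Fin N × Fin N → ℝ) :
    exp (skAv N β Φ g) ≤ skAv N β (fun σ τ => exp (Φ σ τ)) g := by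
  set p := softmax (ham N β g) with hp
  have := convexOn_exp.map_sum_le (t := (Finset.univ : Finset (Config N × Config N)))
    (w := fun x => p x.1 * p x.2) (p := fun x => Φ x.1 x.2)
    (fun x _ => mul_nonneg (softmax_nonneg _ _) (softmax_nonneg _ _))
    (by rw [Fintype.sum_prod_type, ← Finset.sum_mul_sum, hp, sum_softmax, one_mul])
    (fun _ _ => Set.mem_univ _)
  simpa only [Fintype.sum_prod_type, smul_eq_mul, skAv] using this

lemma skZ_sq_eq (β : ℝ) (g : Fin N × Fin N → ℝ) :
    skZ N β g ^ 2 = skY N β (fun _ _ => 1) g := by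
  rw [skY_eq, skAv_const, mul_one]

lemma integral_skZ_sq_le (hN : 1 ≤ N) {β : ℝ} (hβ : β ^ 2 < 1) :
    ∫ g, skZ N β g ^ 2 ∂stdG (Fin N × Fin N) ≤ 1 / √(1 - β ^ 2) := by
  have := integral_skY_exp_le hN (β := β) le_rfl (by simpa using hβ)
  simpa [skZ_sq_eq] using this

/-- The exponential overlap weight at half the distance to criticality. -/
def skGood (N : ℕ) (β : ℝ) : Set (Fin N × Fin N → ℝ) :=
  {g | 1 / 2 ≤ skZ N β g ∧
    skY N β (fun σ τ => exp ((1 - β ^ 2) / 2 * (N * ovlp N σ τ ^ 2) / 2)) g ≤ 16 / (1 - β ^ 2)}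

lemma measurableSet_skGood (β : ℝ) : MeasurableSet (skGood N β) :=
  (measurableSet_le measurable_const (continuous_skZ β).measurable).inter
    (measurableSet_le (continuous_skY β _).measurable measurable_const)

lemma le_measureReal_skGood (hN : 1 ≤ N) {β : ℝ} (hβ : β ^ 2 < 1) :
    √(1 - β ^ 2) / 8 ≤ (stdG (Fin N × Fin N)).real (skGood N β) := by
  set a := 1 - β ^ 2 with ha
  have ha0 : 0 < a := by linarith
  set Y := skY N β (fun σ τ => exp (a / 2 * (N * ovlp N σ τ ^ 2) / 2)) with hY
  set t := √a / 2 with ht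
  have hs : 0 < √a := sqrt_pos.2 ha0
  have ht0 : 0 < t := by positivity
  set G := skGood N β with hG
  set I : (Fin N × Fin N → ℝ) → ℝ := G.indicator fun _ => 1 with hI
  have hYnn : ∀ g, 0 ≤ Y g := fun g => by
    rw [hY, skY_eq]
    exact mul_nonneg (sq_nonneg _) (skAv_nonneg (fun _ _ => (exp_pos _).le) g)
  have hpt : ∀ g, skZ N β g ≤ 1 / 2 + (t / 2 * skZ N β g ^ 2 +
      (1 / (2 * t)) * (I g + a / 16 * Y g)) := fun g => by
    have hz := skZ_pos β g
    have hind : 0 ≤ I g := Set.indicator_nonneg (fun _ _ => zero_le_one) g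
    have hpos : 0 ≤ I g + a / 16 * Y g := by have := hYnn g; positivity
    by_cases h1 : 1 / 2 ≤ skZ N β g
    · have hge : 1 ≤ I g + a / 16 * Y g := by
        by_cases h2 : Y g ≤ 16 / a
        · have : g ∈ G := ⟨h1, h2⟩
          rw [hI, Set.indicator_of_mem this]
          have := hYnn g
          have : 0 ≤ a / 16 * Y g := by positivity
          linarith
        · have h3 : 16 / a < Y g := not_le.1 h2
          rw [div_lt_iff₀ ha0] at h3
          linarith
      have h4 : 1 / (2 * t) ≤ (1 / (2 * t)) * (I g + a / 16 * Y g) :=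
        le_mul_of_one_le_right (by positivity) hge
      have h5 : skZ N β g ≤ t / 2 * skZ N β g ^ 2 + 1 / (2 * t) := by
        have : t / 2 * skZ N β g ^ 2 + 1 / (2 * t) - skZ N β g = (t * skZ N β g - 1) ^ 2 / (2 * t) := by
          field_simp; ring
        have h6 : 0 ≤ (t * skZ N β g - 1) ^ 2 / (2 * t) := by positivity
        linarith
      linarith
    · have : 0 ≤ (1 / (2 * t)) * (I g + a / 16 * Y g) := by positivity
      have : 0 ≤ t / 2 * skZ N β g ^ 2 := by positivity
      linarith [not_le.1 h1]
  have hGm : MeasurableSet G := measurableSet_skGood β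
  have hi1 : Integrable (fun g => skZ N β g ^ 2) (stdG (Fin N × Fin N)) := by
    simp only [skZ_sq_eq]; exact integrable_skY β _
  have hi2 : Integrable I (stdG (Fin N × Fin N)) :=
    (integrable_const (1 : ℝ)).indicator hGm
  have hi3 : Integrable Y (stdG (Fin N × Fin N)) := integrable_skY β _
  have hi4 : Integrable (fun g => a / 16 * Y g) (stdG (Fin N × Fin N)) := hi3.const_mul _
  have hi5 : Integrable (fun g => 1 / (2 * t) * (I g + a / 16 * Y g)) (stdG (Fin N × Fin N)) :=
    (hi2.add hi4).const_mul _
  have hi6 : Integrable (fun g => t / 2 * skZ N β g ^ 2) (stdG (Fin N × Fin N)) := hi1.const_mul _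
  have hi7 : Integrable (fun g => t / 2 * skZ N β g ^ 2 + 1 / (2 * t) * (I g + a / 16 * Y g))
    (stdG (Fin N × Fin N)) := hi6.add hi5
  have hInt := integral_mono (integrable_skZ β) ((integrable_const (1 / 2 : ℝ)).add hi7) hpt
  rw [integral_skZ hN] at hInt
  have hIi : ∫ g, I g ∂stdG (Fin N × Fin N) = (stdG (Fin N × Fin N)).real G := by
    rw [hI, integral_indicator hGm]; simp [hG]
  have heq : ∫ g, (1 / 2 + (t / 2 * skZ N β g ^ 2 + (1 / (2 * t)) * (I g + a / 16 * Y g)))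
      ∂stdG (Fin N × Fin N) =
      1 / 2 + (t / 2 * (∫ g, skZ N β g ^ 2 ∂stdG (Fin N × Fin N)) +
        1 / (2 * t) * ((stdG (Fin N × Fin N)).real G + a / 16 * ∫ g, Y g ∂stdG (Fin N × Fin N))) := by
    rw [integral_add (integrable_const _) hi7, integral_add hi6 hi5, integral_const_mul,
      integral_const_mul, integral_add hi2 hi4, integral_const_mul, hIi]
    simp
  replace hInt := hInt.trans_eq heq
  have hZ2 := integral_skZ_sq_le hN hβ
  have hYi : ∫ g, Y g ∂stdG (Fin N × Fin N) ≤ 2 / √a := by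
    refine (integral_skY_exp_le hN (by positivity) (by linarith)).trans ?_
    have h1 : 1 - (β ^ 2 + a / 2) = a / 2 := by rw [ha]; ring
    rw [h1, div_le_div_iff₀ (sqrt_pos.2 (by positivity)) hs, one_mul]
    have : √a = √2 * √(a / 2) := by
      rw [← sqrt_mul (by norm_num)]; congr 1; ring
    rw [this]
    exact mul_le_mul_of_nonneg_right (by rw [sqrt_le_left (by norm_num)]; norm_num)
      (sqrt_nonneg _)
  have e1 : t / 2 * (∫ g, skZ N β g ^ 2 ∂stdG (Fin N × Fin N)) ≤ 1 / 4 := by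
    refine (mul_le_mul_of_nonneg_left hZ2 (by positivity)).trans (le_of_eq ?_)
    rw [← ha, ht]; field_simp; norm_num
  have e2 : a / 16 * ∫ g, Y g ∂stdG (Fin N × Fin N) ≤ √a / 8 := by
    refine (mul_le_mul_of_nonneg_left hYi (by positivity)).trans (le_of_eq ?_)
    have : a = √a * √a := (mul_self_sqrt ha0.le).symm
    nth_rw 1 [this]; field_simp; norm_num
  have e3 : 1 / 4 ≤ 1 / (2 * t) *
      ((stdG (Fin N × Fin N)).real G + a / 16 * ∫ g, Y g ∂stdG (Fin N × Fin N)) := by linarith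
  have e4 : 1 / (2 * t) = 1 / √a := by rw [ht]; congr 1; ring
  rw [e4, one_div_mul_eq_div, le_div_iff₀ hs] at e3
  linarith

lemma log_skZ_slope_le (hN : 1 ≤ N) {β : ℝ} (hβ : β ^ 2 < 1) {g : Fin N × Fin N → ℝ}
    (hg : g ∈ skGood N β) :
    ∑ e, (∑ σ, softmax (ham N β g) σ * skc N β e σ) ^ 2 ≤
      2 / (1 - β ^ 2) * log (64 / (1 - β ^ 2)) := by
  set a := 1 - β ^ 2 with ha
  have ha0 : 0 < a := by linarith
  obtain ⟨h1, h2⟩ := hg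
  rw [← ha, skY_eq] at h2
  set M := skAv N β (fun σ τ => exp (a / 2 * (N * ovlp N σ τ ^ 2) / 2)) g with hM
  have hM0 : 0 ≤ M := skAv_nonneg (fun _ _ => (exp_pos _).le) g
  have hM1 : M ≤ 64 / a := by
    have : 1 / 4 * M ≤ skZ N β g ^ 2 * M := mul_le_mul_of_nonneg_right (by nlinarith) hM0
    have e : 64 / a = 4 * (16 / a) := by ring
    linarith
  have h3 := (exp_skAv_le β (fun σ τ => a / 2 * (N * ovlp N σ τ ^ 2) / 2) g).trans hM1
  have h4 := log_le_log (exp_pos _) h3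
  rw [log_exp] at h4
  have h5 : skAv N β (fun σ τ => a / 2 * (N * ovlp N σ τ ^ 2) / 2) g =
      a / 4 * skAv N β (fun σ τ => N * ovlp N σ τ ^ 2) g := by
    rw [← skAv_const_mul]; congr 1; ext σ τ; ring
  have h6 : ∑ e, (∑ σ, softmax (ham N β g) σ * skc N β e σ) ^ 2 ≤
      1 / 2 * skAv N β (fun σ τ => N * ovlp N σ τ ^ 2) g := by
    simp only [sq (∑ σ, _)]
    rw [sum_slope_mul hN, ← skAv_const_mul]
    refine skAv_mono (fun σ τ => ?_) g
    have : 0 ≤ N * ovlp N σ τ ^ 2 := by positivity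
    nlinarith [sq_nonneg β]
  rw [h5] at h4
  refine h6.trans ?_
  have : 1 / 2 * skAv N β (fun σ τ => N * ovlp N σ τ ^ 2) g =
      2 / a * (a / 4 * skAv N β (fun σ τ => N * ovlp N σ τ ^ 2) g) := by field_simp; ring
  rw [this]
  exact mul_le_mul_of_nonneg_left h4 (by positivity)

end LowerTail

section Tail

variable {N : ℕ}

/-- The lower tail of the normalized partition function. -/
lemma measureReal_skZ_lt_le (hN : 1 ≤ N) {β M : ℝ} (hβ0 : 0 < β) (hβ : β ^ 2 < 1)
    (hM : log (64 / (1 - β ^ 2)) ≤ M) :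
    (stdG (Fin N × Fin N)).real {g | log (skZ N β g) < -(8 * M / √(1 - β ^ 2))} ≤ exp (-M) := by
  set a := 1 - β ^ 2 with ha
  have ha0 : 0 < a := by linarith
  have ha1 : a < 1 := by rw [ha]; nlinarith
  have hs : 0 < √a := sqrt_pos.2 ha0
  have hs1 : √a ≤ 1 := sqrt_le_one.2 ha1.le
  have haa : √a * √a = a := mul_self_sqrt ha0.le
  set Λ := log (64 / a) with hΛ
  have hΛ1 : 2 ≤ Λ := by
    rw [hΛ, le_log_iff_exp_le (by positivity)]
    have h1 : exp 2 ≤ 64 := by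
      have := exp_one_lt_d9
      have h2 : exp 2 = exp 1 * exp 1 := by rw [← exp_add]; norm_num
      rw [h2]; nlinarith [exp_pos 1]
    refine h1.trans ?_
    rw [le_div_iff₀ ha0]; nlinarith
  have hM0 : 0 < M := by linarith
  have key := measureReal_lt_neg_le_of_minorants (E := Fin N × Fin N)
    (P := fun g => log (skZ N β g)) (A := skGood N β) (measurableSet_skGood β)
    (v := fun g e => ∑ σ, softmax (ham N β g) σ * skc N β e σ) (K := 2 / a * Λ) (m := 1)
    (q := √a / 8) (r := 2 * Λ / √a) (s := 2 * M / √a) (x := 8 * M / √a)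
    (fun y _ z => log_skZ_ge β y z) (fun y hy => log_skZ_slope_le hN hβ hy) (by positivity)
    zero_le_one ?_ (by positivity) (le_measureReal_skGood hN hβ) (by positivity) (by positivity)
    ?_ (by positivity) ?_
  · refine key.trans (exp_le_exp.2 (neg_le_neg ?_))
    rw [le_div_iff₀ (by positivity), div_pow, sq √a, haa, le_div_iff₀ ha0]
    have : M * (2 * (2 / a * Λ)) * a = 4 * (M * Λ) := by field_simp; ring
    rw [this]
    nlinarith
  · intro y hy
    have h1 := log_le_log (by norm_num) hy.1
    have h2 : log (1 / 2) = -log 2 := by rw [one_div, log_inv]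
    have := log_two_lt_d9
    show -1 ≤ log (skZ N β y)
    linarith
  · have h1 : (2 * Λ / √a) ^ 2 / (2 * (2 / a * Λ)) = Λ := by
      rw [div_pow, sq √a, haa]; field_simp
    rw [h1, exp_neg, hΛ, exp_log (by positivity), inv_div, div_div, div_lt_div_iff₀ (by norm_num)
      (by norm_num)]
    nlinarith
  · have h1 : 1 ≤ M / √a := by rw [le_div_iff₀ hs]; nlinarith
    have h2 : 2 * Λ / √a ≤ 2 * (M / √a) := by
      rw [mul_div_assoc]; gcongr
    have h3 : 2 * M / √a = 2 * (M / √a) := by ring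
    have h4 : 3 / 4 * (8 * M / √a) = 6 * (M / √a) := by ring
    rw [h3, h4]
    linarith

lemma skTail_eq (β r : ℝ) : skTail N β r =
    ∫ g, skAv N β (fun σ τ => if r < |ovlp N σ τ| then 1 else 0) g ∂stdG (Fin N × Fin N) := by
  have : ∀ g : Fin N × Fin N → ℝ, (fun σ => ∑ e, g e * skc N β e σ) = ham N β g := fun g =>
    funext fun σ => (ham_eq_sum β g σ).symm
  simp only [skTail, E2, skAv, this]

lemma continuous_skAv (β : ℝ) (Φ : Config N → Config N → ℝ) : Continuous (skAv N β Φ) := by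
  have : skAv N β Φ = fun g => skY N β Φ g / skZ N β g ^ 2 := funext fun g => by
    rw [skY_eq, mul_div_cancel_left₀ _ (pow_ne_zero _ (skZ_pos β g).ne')]
  rw [this]
  exact (continuous_skY β Φ).div ((continuous_skZ β).pow 2) fun g =>
    pow_ne_zero _ (skZ_pos β g).ne'

/-- Large overlaps are unlikely, in terms of the lower tail of the partition function. -/
lemma skTail_le (hN : 1 ≤ N) {β M r : ℝ} (hβ0 : 0 < β) (hβ : β ^ 2 < 1) (hr : 0 ≤ r)
    (hM : log (64 / (1 - β ^ 2)) ≤ M) :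
    skTail N β r ≤ exp (-M) + exp (17 * M / √(1 - β ^ 2) - (1 - β ^ 2) * N * r ^ 2 / 4) := by
  set a := 1 - β ^ 2 with ha
  have ha0 : 0 < a := by linarith
  have ha1 : a < 1 := by rw [ha]; nlinarith
  have hs : 0 < √a := sqrt_pos.2 ha0
  have hs1 : √a ≤ 1 := sqrt_le_one.2 ha1.le
  have haa : √a * √a = a := mul_self_sqrt ha0.le
  set x := 8 * M / √a with hx
  set B := {g | log (skZ N β g) < -x} with hB
  have hBm : MeasurableSet B :=
    measurableSet_lt ((continuous_skZ β).measurable.log) measurable_const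
  set Y := skY N β (fun σ τ => exp (a / 2 * (N * ovlp N σ τ ^ 2) / 2)) with hY
  set κ := exp (-(a * N * r ^ 2 / 4)) with hκ
  have hpt : ∀ g, skAv N β (fun σ τ => if r < |ovlp N σ τ| then 1 else 0) g ≤
      B.indicator (fun _ => 1) g + exp (2 * x) * κ * Y g := fun g => by
    have hYnn : 0 ≤ Y g := by
      rw [hY, skY_eq]
      exact mul_nonneg (sq_nonneg _) (skAv_nonneg (fun _ _ => (exp_pos _).le) g)
    by_cases hg : g ∈ B
    · rw [Set.indicator_of_mem hg]
      have h1 : skAv N β (fun σ τ => if r < |ovlp N σ τ| then 1 else 0) g ≤ 1 := by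
        refine (skAv_mono (Ψ := fun _ _ => 1) (fun σ τ => ?_) g).trans_eq (skAv_const β 1 g)
        split_ifs <;> norm_num
      have : 0 ≤ exp (2 * x) * κ * Y g := by positivity
      linarith
    · rw [Set.indicator_of_notMem hg, zero_add]
      have h1 : -x ≤ log (skZ N β g) := not_lt.1 hg
      have h2 : 1 ≤ exp (2 * x) * skZ N β g ^ 2 := by
        rw [le_log_iff_exp_le (skZ_pos β g)] at h1
        have h3 : exp (-x) ^ 2 ≤ skZ N β g ^ 2 := pow_le_pow_left₀ (exp_pos _).le h1 2
        have h4 : exp (2 * x) * exp (-x) ^ 2 = 1 := by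
          rw [← exp_nat_mul, ← exp_add]; simp
        rw [← h4]
        exact mul_le_mul_of_nonneg_left h3 (exp_pos _).le
      have h3 : skAv N β (fun σ τ => if r < |ovlp N σ τ| then 1 else 0) g ≤
          κ * skAv N β (fun σ τ => exp (a / 2 * (N * ovlp N σ τ ^ 2) / 2)) g := by
        rw [← skAv_const_mul]
        refine skAv_mono (fun σ τ => ?_) g
        split_ifs with h
        · rw [hκ, ← exp_add]
          refine one_le_exp ?_
          have : r ^ 2 ≤ ovlp N σ τ ^ 2 := by rw [← sq_abs (ovlp N σ τ)]; gcongr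
          have : a * N * r ^ 2 ≤ a * N * ovlp N σ τ ^ 2 := by gcongr
          linarith
        · positivity
      have h5 : 0 ≤ κ * skAv N β (fun σ τ => exp (a / 2 * (N * ovlp N σ τ ^ 2) / 2)) g :=
        mul_nonneg (exp_pos _).le (skAv_nonneg (fun _ _ => (exp_pos _).le) g)
      rw [hY, skY_eq]
      calc _ ≤ 1 * (κ * skAv N β (fun σ τ => exp (a / 2 * (N * ovlp N σ τ ^ 2) / 2)) g) := by
            rw [one_mul]; exact h3
        _ ≤ (exp (2 * x) * skZ N β g ^ 2) *
            (κ * skAv N β (fun σ τ => exp (a / 2 * (N * ovlp N σ τ ^ 2) / 2)) g) :=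
            mul_le_mul_of_nonneg_right h2 h5
        _ = _ := by ring
  have hi1 : Integrable (B.indicator fun _ => (1 : ℝ)) (stdG (Fin N × Fin N)) :=
    (integrable_const (1 : ℝ)).indicator hBm
  have hi2 : Integrable (fun g => exp (2 * x) * κ * Y g) (stdG (Fin N × Fin N)) :=
    (integrable_skY β _).const_mul _
  have hi3 : Integrable (skAv N β (fun σ τ => if r < |ovlp N σ τ| then 1 else 0))
      (stdG (Fin N × Fin N)) :=
    Integrable.mono' (hi1.add hi2) (continuous_skAv β _).aestronglyMeasurable
      (ae_of_all _ fun g => by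
        rw [norm_eq_abs, abs_of_nonneg (skAv_nonneg (fun σ τ => by split_ifs <;> norm_num) g)]
        exact hpt g)
  have hInt := integral_mono hi3 (hi1.add hi2) hpt
  have heq : ∫ g, (B.indicator (fun _ => 1) g + exp (2 * x) * κ * Y g) ∂stdG (Fin N × Fin N) =
      (stdG (Fin N × Fin N)).real B + exp (2 * x) * κ * ∫ g, Y g ∂stdG (Fin N × Fin N) := by
    rw [integral_add hi1 hi2, integral_const_mul, integral_indicator hBm]; simp
  replace hInt := hInt.trans_eq heq
  rw [← skTail_eq] at hInt
  refine hInt.trans (add_le_add (measureReal_skZ_lt_le hN hβ0 hβ hM) ?_)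
  have hYi : ∫ g, Y g ∂stdG (Fin N × Fin N) ≤ exp (M / √a) := by
    refine (integral_skY_exp_le hN (by positivity) (by linarith)).trans ?_
    have h1 : 1 - (β ^ 2 + a / 2) = a / 2 := by rw [ha]; ring
    rw [h1]
    have hM2 : log (64 / a) ≤ M / √a := by
      have h0 : 0 ≤ log (64 / a) := log_nonneg (by rw [le_div_iff₀ ha0]; linarith)
      exact hM.trans (by rw [le_div_iff₀ hs]; nlinarith)
    have h2 : 64 / a ≤ exp (M / √a) := by
      rw [← exp_log (show 0 < 64 / a by positivity)]; exact exp_le_exp.2 hM2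
    refine le_trans ?_ h2
    rw [div_le_div_iff₀ (sqrt_pos.2 (by positivity)) ha0, one_mul]
    have h3 : a / 2 ≤ √(a / 2) := le_sqrt_of_sq_le (by nlinarith)
    linarith
  calc exp (2 * x) * κ * ∫ g, Y g ∂stdG (Fin N × Fin N) ≤ exp (2 * x) * κ * exp (M / √a) :=
        mul_le_mul_of_nonneg_left hYi (by positivity)
    _ = _ := by
        rw [hκ, ← exp_add, ← exp_add, hx]; congr 1; ring

/-- The even moments of the overlap have the scale given by the distance to criticality. -/
theorem eventually_skMom_le {c₀ : ℝ} (hc : 0 < c₀) : ∀ᶠ N : ℕ in atTop, ∀ β : ℝ, 0 < β → β < 1 →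
    c₀ ≤ N * (1 - β ^ 2) ^ 3 → ∀ k ≤ 5,
      skMom N β (2 * k) ≤ (6 * momD + 1) ^ k * (1 / (N * (1 - β ^ 2))) ^ k := by
  have hD := momD_pos
  set D := momD with hDdef
  have hlog : ∀ᶠ N : ℕ in atTop, 144 * D * (log 64 + (log N - log c₀) / 3 + 6 * log N) ≤
      (c₀ ^ 5 * N) ^ ((1 : ℝ) / 6) := by
    have h1 : (fun y : ℝ => log y) =o[atTop] fun y => y ^ ((1 : ℝ) / 6) :=
      isLittleO_log_rpow_atTop (by norm_num)
    have h2 : (fun _ : ℝ => (1 : ℝ)) =o[atTop] fun y => y ^ ((1 : ℝ) / 6) :=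
      (Asymptotics.isLittleO_const_left.2 <| Or.inr <| tendsto_norm_atTop_atTop.comp <|
        tendsto_rpow_atTop (by norm_num))
    have h3 : (fun y : ℝ => 144 * D * (19 / 3) * log y + 144 * D * (log 64 - log c₀ / 3) * 1) =o[atTop]
        fun y => y ^ ((1 : ℝ) / 6) := (h1.const_mul_left _).add (h2.const_mul_left _)
    have h4 := (h3.bound (show 0 < (c₀ ^ 5) ^ ((1 : ℝ) / 6) by positivity))
    filter_upwards [tendsto_natCast_atTop_atTop.eventually h4] with N hN
    have hNN : (0 : ℝ) ≤ N := Nat.cast_nonneg N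
    rw [mul_rpow (by positivity) hNN]
    rw [norm_eq_abs, norm_eq_abs, abs_of_nonneg (rpow_nonneg hNN _)] at hN
    refine le_trans (le_of_eq ?_) ((le_abs_self _).trans hN)
    ring
  filter_upwards [hlog, eventually_ge_atTop 2] with N hN hN2 β hβ0 hβ1 hc0 k hk
  have hN1 : 1 ≤ N := by omega
  have hNN : (2 : ℝ) ≤ N := by exact_mod_cast hN2
  have hβ : β ^ 2 < 1 := by nlinarith
  set a := 1 - β ^ 2 with ha
  have ha0 : 0 < a := by linarith
  have ha1 : a < 1 := by rw [ha]; nlinarith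
  have hs : 0 < √a := sqrt_pos.2 ha0
  have hs1 : √a ≤ 1 := sqrt_le_one.2 ha1.le
  have haa : √a * √a = a := mul_self_sqrt ha0.le
  have hl0 : 0 ≤ log N := log_nonneg (by linarith)
  set M := log (64 / a) + 6 * log N with hM
  have hΛ0 : 0 ≤ log (64 / a) := log_nonneg (by rw [le_div_iff₀ ha0]; linarith)
  have hMle : M ≤ log 64 + (log N - log c₀) / 3 + 6 * log N := by
    have h1 : log c₀ ≤ log N + 3 * log a := by
      have := log_le_log hc hc0
      rwa [log_mul (by positivity) (by positivity), log_pow, Nat.cast_ofNat] at this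
    rw [hM, log_div (by norm_num) ha0.ne']
    linarith
  have hbig : 144 * D * M ≤ a ^ 2 * √a * N := by
    refine (mul_le_mul_of_nonneg_left hMle (by positivity)).trans (hN.trans ?_)
    rw [← pow_le_pow_iff_left₀ (by positivity) (by positivity) (show 6 ≠ 0 by norm_num),
      ← rpow_natCast, ← rpow_mul (by positivity)]
    norm_num
    have h1 : (a ^ 2 * √a * N) ^ 6 = (N * a ^ 3) ^ 5 * N := by
      have : √a ^ 6 = a ^ 3 := by
        rw [show √a ^ 6 = (√a * √a) ^ 3 by ring, haa]
      rw [mul_pow, mul_pow, this]; ring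
    rw [h1]
    gcongr
  set r := √(a / (2 * D)) with hr
  have hr2 : r ^ 2 = a / (2 * D) := sq_sqrt (by positivity)
  refine skMom_le_of_tail hN1 hβ0 hβ1 (sqrt_nonneg (a / (2 * D))) ?_ ?_ hk
  · rw [← hr, hr2, ← hDdef, ← ha]
    refine le_of_eq ?_
    field_simp
  · rw [← hr]
    refine (skTail_le hN1 hβ0 hβ (sqrt_nonneg _) (M := M) (by linarith)).trans ?_
    rw [← ha, ← hr]
    have hexp : exp (-(6 * log N)) = (1 / N : ℝ) ^ 6 := by
      rw [exp_neg, show 6 * log (N : ℝ) = (6 : ℕ) * log N by norm_num, exp_nat_mul,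
        exp_log (by positivity), one_div, inv_pow]
    have e1 : exp (-M) ≤ (1 / N : ℝ) ^ 6 := by
      rw [← hexp, exp_le_exp]; linarith
    have e2 : exp (17 * M / √a - a * N * r ^ 2 / 4) ≤ (1 / N : ℝ) ^ 6 := by
      rw [← hexp, exp_le_exp, hr2]
      have h1 : a * N * (a / (2 * D)) / 4 = a ^ 2 * N / (8 * D) := by field_simp; ring
      have h2 : 18 * M / √a ≤ a ^ 2 * N / (8 * D) := by
        rw [div_le_div_iff₀ hs (by positivity)]; linarith
      have h3 : 6 * log N ≤ M / √a := by
        have : 6 * log N ≤ M := by linarith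
        exact this.trans (by rw [le_div_iff₀ hs]; nlinarith)
      have h4 : 18 * M / √a = 17 * M / √a + M / √a := by ring
      rw [h1]; linarith
    have e3 : (1 / N : ℝ) ≤ 1 / 2 := by gcongr
    calc _ ≤ (1 / N : ℝ) ^ 6 + (1 / N : ℝ) ^ 6 := add_le_add e1 e2
      _ = 2 * (1 / N : ℝ) * (1 / N : ℝ) ^ 5 := by ring
      _ ≤ 1 * (1 / N : ℝ) ^ 5 := by gcongr; linarith
      _ = _ := one_mul _

end Tail

section CoupledCavity

variable {N : ℕ}

/-- The couplings of two SK systems whose disorders have correlation `cos θ`. -/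
def cpl (N : ℕ) (β θ : ℝ) :
    (Fin N × Fin N) ⊕ (Fin N × Fin N) → Config N × Config N → ℝ
  | .inl e, s => skc N β e s.1 + cos θ * skc N β e s.2
  | .inr e, s => sin θ * skc N β e s.2

/-- The disorder variables of both systems that involve site `i`. -/
def cplJ (i : Fin N) : Finset ((Fin N × Fin N) ⊕ (Fin N × Fin N)) := (skJ i).disjSum (skJ i)

/-- The local field of the cross overlap at site `i`. -/
def cplY (i : Fin N) (s : Config N × Config N) : ℝ :=
  spin (s.1 i) * spin (s.2 i) * cavx i s.1 s.2

/-- The size of the off-diagonal coupled cavity covariances. -/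
def cplω (i : Fin N) (s t : Config N × Config N) : ℝ :=
  |cavx i s.1 t.1| + |cavx i s.2 t.2| + |cavx i s.1 t.2| + |cavx i s.2 t.1|

/-- The size of the fluctuating part of the diagonal coupled cavity covariance. -/
def cplω₀ (i : Fin N) (s : Config N × Config N) : ℝ := 2 * |cavx i s.1 s.2|

lemma cavK_cpl (i : Fin N) (β θ : ℝ) (s t : Config N × Config N) :
    cavK (cpl N β θ) (cplJ i) s t = β ^ 2 * (spin (s.1 i) * spin (t.1 i) * cavx i s.1 t.1 +
      spin (s.2 i) * spin (t.2 i) * cavx i s.2 t.2 +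
      cos θ * (spin (s.1 i) * spin (t.2 i) * cavx i s.1 t.2 +
        spin (s.2 i) * spin (t.1 i) * cavx i s.2 t.1)) := by
  unfold cavK cplJ
  rw [Finset.sum_disjSum]
  simp only [cpl]
  have h1 : ∀ e, (skc N β e s.1 + cos θ * skc N β e s.2) * (skc N β e t.1 + cos θ * skc N β e t.2) =
      skc N β e s.1 * skc N β e t.1 + cos θ * (skc N β e s.1 * skc N β e t.2) +
      cos θ * (skc N β e s.2 * skc N β e t.1) + cos θ ^ 2 * (skc N β e s.2 * skc N β e t.2) :=
    fun e => by ring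
  have h2 : ∀ e, sin θ * skc N β e s.2 * (sin θ * skc N β e t.2) =
      sin θ ^ 2 * (skc N β e s.2 * skc N β e t.2) := fun e => by ring
  simp only [h1, h2, Finset.sum_add_distrib, ← Finset.mul_sum, sum_skJ_spin]
  have := sin_sq_add_cos_sq θ
  linear_combination (β ^ 2 * (spin (s.2 i) * spin (t.2 i) * cavx i s.2 t.2)) * this

lemma cpl_fst_flipAt (i : Fin N) (β θ : ℝ) {e : (Fin N × Fin N) ⊕ (Fin N × Fin N)}
    (he : e ∉ cplJ i) (s : Config N × Config N) :
    cpl N β θ e (flipAt i s.1, s.2) = cpl N β θ e s := by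
  rcases e with e | e
  · have : e ∉ skJ i := by simpa [cplJ] using he
    simp only [cpl, skc_flipAt i β this]
  · rfl

lemma cpl_flipAt (i : Fin N) (β θ : ℝ) {e : (Fin N × Fin N) ⊕ (Fin N × Fin N)}
    (he : e ∉ cplJ i) (s : Config N × Config N) :
    cpl N β θ e (flipAt i s.1, flipAt i s.2) = cpl N β θ e s := by
  rcases e with e | e <;>
  · have : e ∉ skJ i := by simpa [cplJ] using he
    simp only [cpl, skc_flipAt i β this]

lemma cplY_sq (i : Fin N) (s : Config N × Config N) : cplY i s ^ 2 = cavx i s.1 s.2 ^ 2 := by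
  unfold cplY
  rw [mul_pow, mul_pow, spin_sq, spin_sq, one_mul, one_mul]

lemma abs_cplY (i : Fin N) (s : Config N × Config N) : |cplY i s| = |cavx i s.1 s.2| := by
  rw [← sq_eq_sq₀ (abs_nonneg _) (abs_nonneg _), sq_abs, sq_abs, cplY_sq]

lemma cavBd_cpl (i : Fin N) {β θ : ℝ} (hβ : β ^ 2 ≤ 1) :
    CavBd (cpl N β θ) (cplJ i) (fun s => 2 * (β ^ 2 * cos θ) * cplY i s) (cplω i) (cplω₀ i) where
  diag := ⟨2 * β ^ 2 * ((N - 1) / N), fun s => by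
    rw [cavK_cpl, spin_mul_self, spin_mul_self, cavx_self, cavx_self, cavx_comm i s.2 s.1, cplY]
    ring⟩
  off s t := by
    have hc := abs_cos_le_one θ
    have hb : |β ^ 2| ≤ 1 := by rwa [abs_of_nonneg (sq_nonneg β)]
    rw [cavK_cpl, abs_mul]
    refine (mul_le_of_le_one_left (abs_nonneg _) hb).trans ?_
    have e : ∀ (a b : Bool) (x : ℝ), |spin a * spin b * x| = |x| := fun a b x => by
      rw [abs_mul, abs_spin_mul, one_mul]
    refine (abs_add_le _ _).trans ?_
    have h1 := (abs_add_le (spin (s.1 i) * spin (t.1 i) * cavx i s.1 t.1)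
      (spin (s.2 i) * spin (t.2 i) * cavx i s.2 t.2))
    have h2 := (abs_add_le (spin (s.1 i) * spin (t.2 i) * cavx i s.1 t.2)
      (spin (s.2 i) * spin (t.1 i) * cavx i s.2 t.1))
    rw [e, e] at h1 h2
    rw [abs_mul]
    have h3 := mul_le_of_le_one_left (abs_nonneg (spin (s.1 i) * spin (t.2 i) * cavx i s.1 t.2 +
      spin (s.2 i) * spin (t.1 i) * cavx i s.2 t.1)) hc
    unfold cplω
    linarith
  kle s := by
    have hb : |β ^ 2 * cos θ| ≤ 1 := by
      rw [abs_mul, abs_of_nonneg (sq_nonneg β)]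
      exact mul_le_one₀ hβ (abs_nonneg _) (abs_cos_le_one θ)
    rw [abs_mul, abs_mul, abs_cplY, abs_two, cplω₀]
    nlinarith [abs_nonneg (cavx i s.1 s.2)]
  ωle s t := by
    unfold cplω
    linarith [abs_cavx_le i s.1 t.1, abs_cavx_le i s.2 t.2, abs_cavx_le i s.1 t.2,
      abs_cavx_le i s.2 t.1]
  ω₀le s := by
    unfold cplω₀
    linarith [abs_cavx_le i s.1 s.2]

/-- First-order cavity expansion of the cross overlap of the coupled systems. -/
lemma abs_E2_cplY_sub_le (i : Fin N) {β θ : ℝ} (hβ : β ^ 2 ≤ 1) {V : Config N × Config N → ℝ}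
    (hV0 : ∀ s, 0 ≤ V s) (hV : ∀ s, V (flipAt i s.1, flipAt i s.2) = V s) :
    |E2 (cpl N β θ) (fun s t => cplY i s * V t) -
        β ^ 2 * cos θ * E2 (cpl N β θ) (fun s t => cavx i s.1 s.2 ^ 2 * V t)| ≤
      11 * cavC * cphi (cpl N β θ) (cplJ i) (fun ρ : Fin 10 → Config N × Config N =>
        |cavx i (ρ 0).1 (ρ 0).2| * V (ρ 1) * cavW (cplω i) (cplω₀ i) ρ ^ 2) 1 := by
  have hK := cavBd_cpl (θ := θ) i hβ
  set T : Config N × Config N → Config N × Config N := fun s => (flipAt i s.1, flipAt i s.2) with hT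
  set T' : Config N × Config N → Config N × Config N := fun s => (flipAt i s.1, s.2) with hT'
  have hTi : Function.Involutive T := fun s => by simp [hT, flipAt_involutive i _]
  have hTi' : Function.Involutive T' := fun s => by simp [hT', flipAt_involutive i _]
  have hYT : ∀ s, cplY i (T s) = cplY i s := fun s => by
    simp only [cplY, hT, spin_flipAt_self, cavx_flipAt_left, cavx_flipAt_right]; ring
  have hYT' : ∀ s, cplY i (T' s) = - cplY i s := fun s => by
    simp only [cplY, hT', spin_flipAt_self, cavx_flipAt_left]; ring
  have hKT : ∀ s t, cavK (cpl N β θ) (cplJ i) (T s) t = - cavK (cpl N β θ) (cplJ i) s t := by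
    intro s t
    simp only [cavK_cpl, hT, spin_flipAt_self, cavx_flipAt_left]; ring
  set f : (Fin 10 → Config N × Config N) → ℝ := fun ρ => cplY i (ρ 0) * V (ρ 1) with hf
  have hfP : HasPar T ∅ f := by
    intro l ρ
    by_cases h0 : l = 0
    · subst h0; simp [hf, hYT]
    · by_cases h1 : l = 1
      · subst h1; simp [hf, T, hV]
      · simp [hf, Function.update_of_ne (Ne.symm h0), Function.update_of_ne (Ne.symm h1)]
  have odd : ∀ h : (Fin 10 → Config N × Config N) → ℝ,
      (∀ ρ, h (Function.update ρ 0 (T' (ρ 0))) = h ρ) →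
      cphi (cpl N β θ) (cplJ i) (fun ρ => f ρ * h ρ) 0 = 0 := by
    intro h hh
    refine cphi_zero_of_odd hTi' (fun e he s => cpl_fst_flipAt i β θ he s) 0 fun ρ => ?_
    rw [hh]
    simp [hf, hYT']
  have main := abs_cphi_sub_half_diag_le hK (f := f)
    (fun l hl => Free.comp_pair (fun s t => cplY i s * V t) (by rintro rfl; simp at hl)
      (by rintro rfl; simp at hl))
    (by simpa using odd (fun _ => 1) fun _ => rfl)
    (odd _ fun ρ => by simp) (odd _ fun ρ => by simp)
    (fun a _ b _ hab => hfP.first_order hTi (fun e he s => cpl_flipAt i β θ he s) hKT hab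
      (Finset.insert_ne_empty _ _).symm)
  have e1 : cphi (cpl N β θ) (cplJ i) f 1 = E2 (cpl N β θ) (fun s t => cplY i s * V t) :=
    cphi_pair_one (by decide) fun s t => cplY i s * V t
  have e2 : cphi (cpl N β θ) (cplJ i) (fun ρ => f ρ * (2 * (β ^ 2 * cos θ) * cplY i (ρ 0))) 1 =
      2 * (β ^ 2 * cos θ) * E2 (cpl N β θ) (fun s t => cavx i s.1 s.2 ^ 2 * V t) := by
    rw [← E2_const_mul, ← cphi_pair_one (J := cplJ i) (a := (0 : Fin 10)) (b := 1) (by decide)]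
    congr 1
    funext ρ
    rw [← cplY_sq]
    simp only [hf]
    ring
  rw [e1, e2] at main
  have e3 : ∀ ρ, |f ρ| = |cavx i (ρ 0).1 (ρ 0).2| * V (ρ 1) := fun ρ => by
    simp only [hf]
    rw [abs_mul, abs_cplY, abs_of_nonneg (hV0 _)]
  simp only [e3] at main
  convert main using 3
  ring

end CoupledCavity

section CoupledMoments

variable {N : ℕ}

/-- The Gibbs average of a function of one configuration of each of the two coupled systems. -/
def skX (N : ℕ) (β θ : ℝ) (h : Config N → Config N → ℝ)
    (p : (Fin N × Fin N → ℝ) × (Fin N × Fin N → ℝ)) : ℝ :=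
  ∑ σ, ∑ τ, softmax (ham N β p.1) σ * softmax (ham N β (cos θ • p.1 + sin θ • p.2)) τ * h σ τ

lemma sum_exp_mul_sum_exp {S S' : Type*} [Fintype S] [Fintype S'] (a : S → ℝ) (b : S' → ℝ) :
    ∑ s : S × S', exp (a s.1 + b s.2) = (∑ s, exp (a s)) * ∑ s, exp (b s) := by
  simp only [exp_add, Fintype.sum_prod_type, Finset.sum_mul_sum]

lemma softmax_add {S S' : Type*} [Fintype S] [Fintype S'] (a : S → ℝ) (b : S' → ℝ) (s : S × S') :
    softmax (fun s : S × S' => a s.1 + b s.2) s = softmax a s.1 * softmax b s.2 := by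
  unfold softmax
  rw [sum_exp_mul_sum_exp, exp_add, div_mul_div_comm]

lemma sum_cpl (β θ : ℝ) (g : (Fin N × Fin N) ⊕ (Fin N × Fin N) → ℝ) (s : Config N × Config N) :
    ∑ e, g e * cpl N β θ e s = ham N β (fun e => g (.inl e)) s.1 +
      ham N β (cos θ • (fun e => g (.inl e)) + sin θ • fun e => g (.inr e)) s.2 := by
  rw [Fintype.sum_sum_type, ham_eq_sum, ham_eq_sum, ← Finset.sum_add_distrib,
    ← Finset.sum_add_distrib]
  refine Finset.sum_congr rfl fun e _ => ?_
  simp only [cpl, Pi.add_apply, Pi.smul_apply, smul_eq_mul]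
  ring

lemma E2_cpl (β θ : ℝ) (F : Config N × Config N → Config N × Config N → ℝ) :
    E2 (cpl N β θ) F = ∫ p, ∑ s : Config N × Config N, ∑ t : Config N × Config N,
      (softmax (ham N β p.1) s.1 * softmax (ham N β (cos θ • p.1 + sin θ • p.2)) s.2) *
      (softmax (ham N β p.1) t.1 * softmax (ham N β (cos θ • p.1 + sin θ • p.2)) t.2) * F s t
      ∂(stdG (Fin N × Fin N)).prod (stdG (Fin N × Fin N)) := by
  have hmp := measurePreserving_sumPiEquivProdPi (ι := Fin N × Fin N) (ι' := Fin N × Fin N)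
    (X := fun _ => ℝ) fun _ => gaussianReal 0 1
  unfold E2
  rw [← hmp.integral_comp (MeasurableEquiv.measurableEmbedding _)]
  refine integral_congr_ae (ae_of_all _ fun g => ?_)
  simp only [sum_cpl, softmax_add]
  rfl

section Marginals

variable {S : Type*} [Fintype S] {p q : S → ℝ}

lemma sum_prod_fst_fst (hq : ∑ s, q s = 1) (h : S → S → ℝ) :
    ∑ s : S × S, ∑ t : S × S, (p s.1 * q s.2) * (p t.1 * q t.2) * h s.1 t.1 =
      ∑ s, ∑ t, p s * p t * h s t := by
  simp only [Fintype.sum_prod_type]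
  refine Finset.sum_congr rfl fun s _ => ?_
  calc _ = ∑ x, q x * ∑ t, ∑ y, q y * (p s * p t * h s t) :=
        Finset.sum_congr rfl fun x _ => by
          simp only [Finset.mul_sum]
          exact Finset.sum_congr rfl fun t _ => Finset.sum_congr rfl fun y _ => by ring
    _ = _ := by simp only [← Finset.sum_mul, hq, one_mul]

lemma sum_prod_swap (F : S × S → S × S → ℝ) :
    ∑ s : S × S, ∑ t : S × S, (p s.1 * q s.2) * (p t.1 * q t.2) * F s t =
      ∑ s : S × S, ∑ t : S × S, (q s.1 * p s.2) * (q t.1 * p t.2) * F s.swap t.swap := by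
  rw [← (Equiv.prodComm S S).sum_comp]
  refine Finset.sum_congr rfl fun s _ => ?_
  rw [← (Equiv.prodComm S S).sum_comp]
  exact Finset.sum_congr rfl fun t _ => by simp [mul_comm (q _) (p _)]

lemma sum_prod_fst_snd (hp : ∑ s, p s = 1) (hq : ∑ s, q s = 1) (h : S → S → ℝ) :
    ∑ s : S × S, ∑ t : S × S, (p s.1 * q s.2) * (p t.1 * q t.2) * h s.1 t.2 =
      ∑ s, ∑ t, p s * q t * h s t := by
  simp only [Fintype.sum_prod_type]
  refine Finset.sum_congr rfl fun s _ => ?_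
  calc _ = ∑ x, q x * ∑ y, p y * ∑ t, (p s * q t * h s t) :=
        Finset.sum_congr rfl fun x _ => by
          simp only [Finset.mul_sum]
          exact Finset.sum_congr rfl fun t _ => Finset.sum_congr rfl fun y _ => by ring
    _ = _ := by simp only [← Finset.sum_mul, hq, hp, one_mul]

lemma sum_prod_mul (f g : S × S → ℝ) :
    ∑ s : S × S, ∑ t : S × S, (p s.1 * q s.2) * (p t.1 * q t.2) * (f s * g t) =
      (∑ s : S × S, p s.1 * q s.2 * f s) * ∑ s : S × S, p s.1 * q s.2 * g s := by
  rw [Finset.sum_mul_sum]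
  exact Finset.sum_congr rfl fun s _ => Finset.sum_congr rfl fun t _ => by ring

end Marginals

lemma continuous_softmax_ham (β : ℝ) (σ : Config N) :
    Continuous fun g => softmax (ham N β g) σ := by
  unfold softmax ham
  refine Continuous.div (by fun_prop) (by fun_prop) fun g => (sum_exp_pos _).ne'

lemma softmax_le_one {S : Type*} [Fintype S] [Nonempty S] (h : S → ℝ) (s : S) : softmax h s ≤ 1 := by
  rw [← sum_softmax h]
  exact Finset.single_le_sum (fun s _ => softmax_nonneg h s) (mem_univ s)

lemma continuous_skX (β θ : ℝ) (h : Config N → Config N → ℝ) : Continuous (skX N β θ h) := by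
  unfold skX
  refine continuous_finsetSum _ fun σ _ => continuous_finsetSum _ fun τ _ => ?_
  exact (((continuous_softmax_ham β σ).comp continuous_fst).mul ((continuous_softmax_ham β τ).comp
    (by fun_prop : Continuous fun p : (Fin N × Fin N → ℝ) × (Fin N × Fin N → ℝ) =>
      cos θ • p.1 + sin θ • p.2))).mul continuous_const

lemma abs_skX_le (β θ : ℝ) (h : Config N → Config N → ℝ)
    (p : (Fin N × Fin N → ℝ) × (Fin N × Fin N → ℝ)) :
    |skX N β θ h p| ≤ ∑ σ, ∑ τ, |h σ τ| := by
  unfold skX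
  refine (Finset.abs_sum_le_sum_abs _ _).trans (Finset.sum_le_sum fun σ _ => ?_)
  refine (Finset.abs_sum_le_sum_abs _ _).trans (Finset.sum_le_sum fun τ _ => ?_)
  rw [abs_mul, abs_of_nonneg (mul_nonneg (softmax_nonneg _ _) (softmax_nonneg _ _))]
  exact mul_le_of_le_one_left (abs_nonneg _)
    (mul_le_one₀ (softmax_le_one _ _) (softmax_nonneg _ _) (softmax_le_one _ _))

lemma integrable_skX (β θ : ℝ) (h : Config N → Config N → ℝ) :
    Integrable (skX N β θ h) ((stdG (Fin N × Fin N)).prod (stdG (Fin N × Fin N))) :=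
  Integrable.of_bound (C := ∑ σ, ∑ τ, |h σ τ|) (continuous_skX β θ h).aestronglyMeasurable
    (ae_of_all _ fun p => abs_skX_le β θ h p)

lemma skAv_eq_skX (β : ℝ) (h : Config N → Config N → ℝ)
    (p : (Fin N × Fin N → ℝ) × (Fin N × Fin N → ℝ)) : skAv N β h p.1 = skX N β 0 h p := by
  simp [skAv, skX]

lemma E2_skc_eq (β : ℝ) (h : Config N → Config N → ℝ) : E2 (skc N β) h =
    ∫ p, skAv N β h p.1 ∂(stdG (Fin N × Fin N)).prod (stdG (Fin N × Fin N)) := by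
  rw [integral_fun_fst]
  unfold E2 skAv
  simp only [← ham_eq_sum, probReal_univ, one_smul]

lemma integral_skAv_rotate (β θ : ℝ) (h : Config N → Config N → ℝ) :
    ∫ p, skAv N β h (cos θ • p.1 + sin θ • p.2) ∂(stdG (Fin N × Fin N)).prod (stdG (Fin N × Fin N)) =
      E2 (skc N β) h := by
  rw [E2_skc_eq]
  exact integral_rotate (fun p => skAv N β h p.1)
    ((continuous_skAv β h).comp continuous_fst).measurable θ

lemma E2_cpl_fst_fst (β θ : ℝ) (h : Config N → Config N → ℝ) :
    E2 (cpl N β θ) (fun s t => h s.1 t.1) = E2 (skc N β) h := by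
  rw [E2_cpl, E2_skc_eq]
  exact integral_congr_ae (ae_of_all _ fun p => sum_prod_fst_fst (sum_softmax _) h)

lemma E2_cpl_snd_snd (β θ : ℝ) (h : Config N → Config N → ℝ) :
    E2 (cpl N β θ) (fun s t => h s.2 t.2) = E2 (skc N β) h := by
  rw [E2_cpl, ← integral_skAv_rotate β θ]
  refine integral_congr_ae (ae_of_all _ fun p => ?_)
  simp only
  rw [sum_prod_swap]
  exact sum_prod_fst_fst (sum_softmax _) h

lemma E2_cpl_fst_snd (β θ : ℝ) (h : Config N → Config N → ℝ) :
    E2 (cpl N β θ) (fun s t => h s.1 t.2) =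
      ∫ p, skX N β θ h p ∂(stdG (Fin N × Fin N)).prod (stdG (Fin N × Fin N)) := by
  rw [E2_cpl]
  exact integral_congr_ae (ae_of_all _ fun p => sum_prod_fst_snd (sum_softmax _) (sum_softmax _) h)

lemma E2_cpl_snd_fst (β θ : ℝ) (h : Config N → Config N → ℝ) (hh : ∀ σ τ, h σ τ = h τ σ) :
    E2 (cpl N β θ) (fun s t => h s.2 t.1) =
      ∫ p, skX N β θ h p ∂(stdG (Fin N × Fin N)).prod (stdG (Fin N × Fin N)) := by
  rw [E2_cpl]
  refine integral_congr_ae (ae_of_all _ fun p => ?_)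
  simp only [skX]
  rw [sum_prod_swap]
  refine (sum_prod_fst_snd (sum_softmax _) (sum_softmax _) h).trans ?_
  rw [Finset.sum_comm]
  exact Finset.sum_congr rfl fun σ _ => Finset.sum_congr rfl fun τ _ => by rw [hh]; ring

lemma E2_cpl_mul (β θ : ℝ) (h h' : Config N → Config N → ℝ) :
    E2 (cpl N β θ) (fun s t => h s.1 s.2 * h' t.1 t.2) =
      ∫ p, skX N β θ h p * skX N β θ h' p ∂(stdG (Fin N × Fin N)).prod (stdG (Fin N × Fin N)) := by
  rw [E2_cpl]
  refine integral_congr_ae (ae_of_all _ fun p => ?_)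
  simp only [skX]
  rw [sum_prod_mul (fun s : Config N × Config N => h s.1 s.2) fun s => h' s.1 s.2]
  simp only [Fintype.sum_prod_type]

lemma skX_const (β θ a : ℝ) (p : (Fin N × Fin N → ℝ) × (Fin N × Fin N → ℝ)) :
    skX N β θ (fun _ _ => a) p = a := by
  simp only [skX, ← Finset.sum_mul, ← Finset.mul_sum, sum_softmax, mul_one, one_mul]

lemma E2_cpl_self (β θ : ℝ) (h : Config N → Config N → ℝ) :
    E2 (cpl N β θ) (fun s _ => h s.1 s.2) =
      ∫ p, skX N β θ h p ∂(stdG (Fin N × Fin N)).prod (stdG (Fin N × Fin N)) := by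
  simpa [skX_const] using E2_cpl_mul β θ h fun _ _ => 1

lemma skX_ovlp_pow_le (β θ : ℝ) (m : ℕ) (p : (Fin N × Fin N → ℝ) × (Fin N × Fin N → ℝ)) :
    skX N β θ (fun σ τ => ovlp N σ τ ^ m) p ≤
      1 / 2 * (skAv N β (fun σ τ => ovlp N σ τ ^ m) p.1 +
        skAv N β (fun σ τ => ovlp N σ τ ^ m) (cos θ • p.1 + sin θ • p.2)) := by
  set P := softmax (ham N β p.1)
  set Q := softmax (ham N β (cos θ • p.1 + sin θ • p.2))
  have h := sum_sum_mul_ovlp_pow_nonneg m fun σ => P σ - Q σ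
  have hc : ∑ σ, ∑ τ, Q σ * P τ * ovlp N σ τ ^ m = ∑ σ, ∑ τ, P σ * Q τ * ovlp N σ τ ^ m := by
    rw [Finset.sum_comm]
    refine Finset.sum_congr rfl fun σ _ => Finset.sum_congr rfl fun τ _ => ?_
    have : ovlp N τ σ = ovlp N σ τ := by simp only [ovlp, mul_comm]
    rw [this]; ring
  have e : ∑ σ, ∑ τ, (P σ - Q σ) * (P τ - Q τ) * ovlp N σ τ ^ m =
      ∑ σ, ∑ τ, P σ * P τ * ovlp N σ τ ^ m - ∑ σ, ∑ τ, P σ * Q τ * ovlp N σ τ ^ m -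
      ∑ σ, ∑ τ, Q σ * P τ * ovlp N σ τ ^ m + ∑ σ, ∑ τ, Q σ * Q τ * ovlp N σ τ ^ m := by
    simp only [← Finset.sum_sub_distrib, ← Finset.sum_add_distrib]
    exact Finset.sum_congr rfl fun σ _ => Finset.sum_congr rfl fun τ _ => by ring
  rw [e, hc] at h
  simp only [skX, skAv]
  linarith

/-- Moments of the cross overlap are dominated by the single-system moments. -/
lemma integral_skX_ovlp_pow_le (β θ : ℝ) (m : ℕ) :
    ∫ p, skX N β θ (fun σ τ => ovlp N σ τ ^ m) p
      ∂(stdG (Fin N × Fin N)).prod (stdG (Fin N × Fin N)) ≤ skMom N β m := by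
  set h : Config N → Config N → ℝ := fun σ τ => ovlp N σ τ ^ m
  have h1 : Integrable (fun p : (Fin N × Fin N → ℝ) × (Fin N × Fin N → ℝ) => skAv N β h p.1)
      ((stdG (Fin N × Fin N)).prod (stdG (Fin N × Fin N))) := by
    simp only [skAv_eq_skX]
    exact integrable_skX β 0 h
  have h2 : Integrable (fun p : (Fin N × Fin N → ℝ) × (Fin N × Fin N → ℝ) =>
      skAv N β h (cos θ • p.1 + sin θ • p.2))
      ((stdG (Fin N × Fin N)).prod (stdG (Fin N × Fin N))) := by
    refine Integrable.of_bound (C := ∑ σ, ∑ τ, |h σ τ|) ((continuous_skAv β h).comp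
      (by fun_prop)).aestronglyMeasurable (ae_of_all _ fun p => ?_)
    rw [norm_eq_abs, skAv_eq_skX β h (cos θ • p.1 + sin θ • p.2, 0)]
    exact abs_skX_le _ _ _ _
  refine (integral_mono (integrable_skX β θ h) ((h1.add h2).const_mul (1 / 2))
    fun p => skX_ovlp_pow_le β θ m p).trans_eq ?_
  simp only [Pi.add_apply]
  rw [integral_const_mul, integral_add h1 h2, integral_skAv_rotate, ← E2_skc_eq]
  unfold skMom
  ring

end CoupledMoments

section CauchySchwarz

variable {ι S E : Type*} [Fintype ι] [DecidableEq ι] [Fintype S] [Nonempty S] [Fintype E]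
  [DecidableEq E]

lemma cphi_mul_le_sqrt (c : E → S → ℝ) (J : Finset E) (f g : (ι → S) → ℝ) (r : ℝ) :
    cphi c J (fun ρ => f ρ * g ρ) r ≤
      √(cphi c J (fun ρ => f ρ ^ 2) r) * √(cphi c J (fun ρ => g ρ ^ 2) r) := by
  have hf : 0 ≤ cphi c J (fun ρ => f ρ ^ 2) r := cphi_nonneg (fun ρ => sq_nonneg _) r
  have hd := discrim_le_zero (a := cphi c J (fun ρ => f ρ ^ 2) r)
    (b := 2 * cphi c J (fun ρ => f ρ * g ρ) r) (c := cphi c J (fun ρ => g ρ ^ 2) r) fun x => by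
      have h : 0 ≤ cphi c J (fun ρ => x * x * f ρ ^ 2 + (x * 2 * (f ρ * g ρ) + g ρ ^ 2)) r :=
        cphi_nonneg (fun ρ => by nlinarith [sq_nonneg (x * f ρ + g ρ)]) r
      rw [cphi_add, cphi_add, cphi_const_mul, cphi_const_mul] at h
      linarith
  rw [← sqrt_mul hf]
  refine le_sqrt_of_sq_le ?_
  unfold discrim at hd
  linarith

end CauchySchwarz

section CoupledExpansion

variable {N : ℕ}

lemma ovlp_sq_eq_sum (hN : 1 ≤ N) (s : Config N × Config N) :
    ovlp N s.1 s.2 ^ 2 = 1 / N + (1 / N : ℝ) * ∑ i, cplY i s := by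
  have hN' : (N : ℝ) ≠ 0 := by positivity
  have h : ∀ i, cplY i s = spin (s.1 i) * spin (s.2 i) * ovlp N s.1 s.2 - 1 / N := by
    intro i
    rw [ovlp_eq_cavx_add i, cplY]
    have e1 := spin_mul_self (s.1 i)
    have e2 := spin_mul_self (s.2 i)
    field_simp
    linear_combination (-(spin (s.2 i)) ^ 2) * e1 - e2
  simp only [h, Finset.sum_sub_distrib, ← Finset.sum_mul]
  have h2 : ∑ i, spin (s.1 i) * spin (s.2 i) = N * ovlp N s.1 s.2 := by
    unfold ovlp
    field_simp
  rw [h2]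
  simp
  field_simp
  ring

lemma sum_cavx_sq (hN : 1 ≤ N) (s : Config N × Config N) :
    (1 / N : ℝ) * ∑ i, cavx i s.1 s.2 ^ 2 =
      (1 - 2 / N) * ovlp N s.1 s.2 ^ 2 + (1 / N) ^ 2 := by
  have hN' : (N : ℝ) ≠ 0 := by positivity
  have h : ∀ i, cavx i s.1 s.2 ^ 2 = ovlp N s.1 s.2 ^ 2 + (1 / N) ^ 2 -
      2 / N * ovlp N s.1 s.2 * (spin (s.1 i) * spin (s.2 i)) := by
    intro i
    have e1 := spin_mul_self (s.1 i)
    have e2 := spin_mul_self (s.2 i)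
    have := ovlp_eq_cavx_add i s.1 s.2
    have h3 : cavx i s.1 s.2 = ovlp N s.1 s.2 - spin (s.1 i) * spin (s.2 i) / N := by linarith
    rw [h3]
    field_simp
    linear_combination ((spin (s.2 i)) ^ 2) * e1 + e2
  simp only [h, Finset.sum_sub_distrib, ← Finset.mul_sum, Finset.sum_const]
  have h2 : ∑ i, spin (s.1 i) * spin (s.2 i) = N * ovlp N s.1 s.2 := by
    unfold ovlp
    field_simp
  rw [h2]
  simp
  field_simp
  ring

/-- The site-averaged cavity expansion for the coupled systems. -/
lemma abs_E2_ovlp_sq_sub_le (hN : 1 ≤ N) {β θ D : ℝ} (hβ : β ^ 2 ≤ 1)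
    {V : Config N × Config N → ℝ} (hV0 : ∀ s, 0 ≤ V s)
    (hV : ∀ i s, V (flipAt i s.1, flipAt i s.2) = V s)
    (hD : ∀ i, cphi (cpl N β θ) (cplJ i) (fun ρ : Fin 10 → Config N × Config N =>
        |cavx i (ρ 0).1 (ρ 0).2| * V (ρ 1) * cavW (cplω i) (cplω₀ i) ρ ^ 2) 1 ≤ D) :
    |E2 (cpl N β θ) (fun s t => ovlp N s.1 s.2 ^ 2 * V t) -
      (1 / N * E2 (cpl N β θ) (fun _ t => V t) + β ^ 2 * cos θ *
        ((1 - 2 / N) * E2 (cpl N β θ) (fun s t => ovlp N s.1 s.2 ^ 2 * V t) +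
          (1 / N) ^ 2 * E2 (cpl N β θ) (fun _ t => V t)))| ≤ 11 * cavC * D := by
  set c := cpl N β θ
  have hN' : (N : ℝ) ≠ 0 := by positivity
  have h1 : E2 c (fun s t => ovlp N s.1 s.2 ^ 2 * V t) = 1 / N * E2 c (fun _ t => V t) +
      1 / N * ∑ i, E2 c (fun s t => cplY i s * V t) := by
    rw [← E2_sum, ← E2_const_mul, ← E2_const_mul, ← E2_add]
    congr 1
    funext s t
    rw [ovlp_sq_eq_sum hN s, ← Finset.sum_mul]
    ring
  have h2 : (1 - 2 / N) * E2 c (fun s t => ovlp N s.1 s.2 ^ 2 * V t) +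
      (1 / N) ^ 2 * E2 c (fun _ t => V t) =
      1 / N * ∑ i, E2 c (fun s t => cavx i s.1 s.2 ^ 2 * V t) := by
    rw [← E2_sum, ← E2_const_mul, ← E2_const_mul, ← E2_const_mul, ← E2_add]
    congr 1
    funext s t
    rw [← Finset.sum_mul, ← mul_assoc, ← mul_assoc, sum_cavx_sq hN s]
    ring
  rw [h2]
  nth_rw 1 [h1]
  have h3 : ∀ i : Fin N, |E2 c (fun s t => cplY i s * V t) -
        β ^ 2 * cos θ * E2 c (fun s t => cavx i s.1 s.2 ^ 2 * V t)| ≤ 11 * cavC * D := fun i =>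
    (abs_E2_cplY_sub_le i hβ hV0 (hV i)).trans (mul_le_mul_of_nonneg_left (hD i)
      (by have := cavC_pos; positivity))
  have h4 : 1 / N * E2 c (fun _ t => V t) + 1 / N * ∑ i, E2 c (fun s t => cplY i s * V t) -
      (1 / N * E2 c (fun _ t => V t) + β ^ 2 * cos θ *
        (1 / N * ∑ i, E2 c (fun s t => cavx i s.1 s.2 ^ 2 * V t))) =
      1 / N * ∑ i, (E2 c (fun s t => cplY i s * V t) -
        β ^ 2 * cos θ * E2 c (fun s t => cavx i s.1 s.2 ^ 2 * V t)) := by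
    rw [Finset.sum_sub_distrib, ← Finset.mul_sum]
    ring
  rw [h4, abs_mul, abs_of_nonneg (by positivity)]
  have h5 := (Finset.abs_sum_le_sum_abs _ _).trans (Finset.sum_le_card_nsmul univ _ _ fun i _ => h3 i)
  rw [Finset.card_univ, Fintype.card_fin, nsmul_eq_mul] at h5
  calc _ ≤ 1 / (N : ℝ) * (N * (11 * cavC * D)) := mul_le_mul_of_nonneg_left h5 (by positivity)
    _ = _ := by field_simp

lemma ovlp_comm (σ τ : Config N) : ovlp N σ τ = ovlp N τ σ := by simp only [ovlp, mul_comm]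

lemma E2_cpl_cavW_pow_le (i : Fin N) {β θ : ℝ} (hβ : β ^ 2 ≤ 1) (k : ℕ) :
    cphi (cpl N β θ) (cplJ i) (fun ρ => cavW (cplω i) (cplω₀ i) ρ ^ (2 * k + 2)) 1 ≤
      2 * 512 ^ (2 * k + 2) * (skMom N β (2 * (k + 1)) + (1 / N) ^ (2 * (k + 1))) := by
  set c := cpl N β θ
  set M := skMom N β (2 * (k + 1)) + (1 / N) ^ (2 * (k + 1)) with hM
  have hM0 : 0 ≤ M := add_nonneg (skMom_nonneg β _) (by positivity)
  have hev : Even (2 * k + 2) := ⟨k + 1, by ring⟩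
  have hpt : ∀ σ τ : Config N, |cavx i σ τ| ^ (2 * k + 2) ≤
      2 ^ (2 * k + 2) * (ovlp N σ τ ^ (2 * k + 2) + (1 / N) ^ (2 * k + 2)) := fun σ τ => by
    rw [hev.pow_abs]
    exact cavx_pow_le i σ τ (k + 1)
  have step : ∀ (x : Config N × Config N → Config N × Config N → ℝ)
      (y : Config N × Config N → Config N × Config N → ℝ),
      (∀ s t, |x s t| ^ (2 * k + 2) ≤ 2 ^ (2 * k + 2) * (y s t + (1 / N) ^ (2 * k + 2))) →
      E2 c y ≤ skMom N β (2 * (k + 1)) →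
      E2 c (fun s t => |x s t| ^ (2 * k + 2)) ≤ 2 ^ (2 * k + 2) * M := by
    intro x y h hy
    refine (E2_mono h).trans ?_
    rw [E2_const_mul, E2_add, E2_const]
    exact mul_le_mul_of_nonneg_left (add_le_add_left hy _) (by positivity)
  have hcross := integral_skX_ovlp_pow_le (N := N) β θ (2 * k + 2)
  have s1 := step (fun s t => cavx i s.1 t.1) (fun s t => ovlp N s.1 t.1 ^ (2 * k + 2))
    (fun s t => hpt _ _) (E2_cpl_fst_fst β θ fun σ τ => ovlp N σ τ ^ (2 * k + 2)).le
  have s2 := step (fun s t => cavx i s.2 t.2) (fun s t => ovlp N s.2 t.2 ^ (2 * k + 2))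
    (fun s t => hpt _ _) (E2_cpl_snd_snd β θ fun σ τ => ovlp N σ τ ^ (2 * k + 2)).le
  have s3 := step (fun s t => cavx i s.1 t.2) (fun s t => ovlp N s.1 t.2 ^ (2 * k + 2))
    (fun s t => hpt _ _)
    ((E2_cpl_fst_snd β θ fun σ τ => ovlp N σ τ ^ (2 * k + 2)).le.trans hcross)
  have s4 := step (fun s t => cavx i s.2 t.1) (fun s t => ovlp N s.2 t.1 ^ (2 * k + 2))
    (fun s t => hpt _ _) ((E2_cpl_snd_fst β θ (fun σ τ => ovlp N σ τ ^ (2 * k + 2))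
      fun σ τ => by rw [ovlp_comm]).le.trans hcross)
  have s5 := step (fun s t => cavx i s.1 s.2) (fun s t => ovlp N s.1 s.2 ^ (2 * k + 2))
    (fun s t => hpt _ _)
    ((E2_cpl_self β θ fun σ τ => ovlp N σ τ ^ (2 * k + 2)).le.trans hcross)
  have hω : E2 c (fun s t => cplω i s t ^ (2 * k + 1 + 1)) ≤ 8 ^ (2 * k + 2) * M := by
    have h1 : ∀ s t, cplω i s t ^ (2 * k + 1 + 1) ≤ 4 ^ (2 * k + 1) *
        (|cavx i s.1 t.1| ^ (2 * k + 2) + |cavx i s.2 t.2| ^ (2 * k + 2) +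
          |cavx i s.1 t.2| ^ (2 * k + 2) + |cavx i s.2 t.1| ^ (2 * k + 2)) := by
      intro s t
      have := pow_sum_div_card_le_sum_pow (s := (univ : Finset (Fin 4)))
        (f := ![|cavx i s.1 t.1|, |cavx i s.2 t.2|, |cavx i s.1 t.2|, |cavx i s.2 t.1|])
        (fun j _ => by fin_cases j <;> simp) (2 * k + 1)
      rw [div_le_iff₀ (by positivity)] at this
      simp [Fin.sum_univ_four] at this
      unfold cplω
      linarith
    refine (E2_mono h1).trans ?_
    rw [E2_const_mul, E2_add, E2_add, E2_add]
    calc _ ≤ (4 : ℝ) ^ (2 * k + 1) * (4 * (2 ^ (2 * k + 2) * M)) :=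
          mul_le_mul_of_nonneg_left (by linarith) (by positivity)
      _ = _ := by
        rw [show (8 : ℝ) = 4 * 2 by norm_num, mul_pow, pow_succ (4 : ℝ) (2 * k + 1)]
        ring
  have hω0 : E2 c (fun s _ => cplω₀ i s ^ (2 * k + 1 + 1)) ≤ 8 ^ (2 * k + 2) * M := by
    simp only [cplω₀, mul_pow, E2_const_mul]
    calc _ ≤ (2 : ℝ) ^ (2 * k + 2) * (2 ^ (2 * k + 2) * M) :=
          mul_le_mul_of_nonneg_left s5 (by positivity)
      _ = 4 ^ (2 * k + 2) * M := by rw [← mul_assoc, ← mul_pow]; norm_num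
      _ ≤ _ := by gcongr; norm_num
  refine (cphi_cavW_pow_le (cavBd_cpl (θ := θ) i hβ) (2 * k + 1)).trans ?_
  calc _ ≤ (64 : ℝ) ^ (2 * k + 1 + 1) * (8 ^ (2 * k + 2) * M + 8 ^ (2 * k + 2) * M) :=
        mul_le_mul_of_nonneg_left (add_le_add hω hω0) (by positivity)
    _ = _ := by
      rw [show (512 : ℝ) = 64 * 8 by norm_num, mul_pow]
      ring

end CoupledExpansion

section CoupledErrors

variable {N : ℕ}

/-- The second moment of the cross overlap. -/
def cplA (N : ℕ) (β θ : ℝ) : ℝ := E2 (cpl N β θ) fun s _ => ovlp N s.1 s.2 ^ 2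

/-- The second moment of the Gibbs average of the squared cross overlap. -/
def cplB (N : ℕ) (β θ : ℝ) : ℝ :=
  E2 (cpl N β θ) fun s t => ovlp N s.1 s.2 ^ 2 * ovlp N t.1 t.2 ^ 2

lemma cplA_nonneg (β θ : ℝ) : 0 ≤ cplA N β θ := E2_nonneg fun _ _ => sq_nonneg _

lemma cplB_nonneg (β θ : ℝ) : 0 ≤ cplB N β θ :=
  E2_nonneg fun _ _ => mul_nonneg (sq_nonneg _) (sq_nonneg _)

lemma E2_snd_eq_fst {S E : Type*} [Fintype S] [Nonempty S] [Fintype E] [DecidableEq E]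
    (c : E → S → ℝ) (f : S → ℝ) : E2 c (fun _ t => f t) = E2 c fun s _ => f s := by
  unfold E2
  refine integral_congr_ae (ae_of_all _ fun g => ?_)
  simp only
  rw [Finset.sum_comm]
  exact Finset.sum_congr rfl fun s _ => Finset.sum_congr rfl fun t _ => by ring

lemma ovlp_flipAt_flipAt (i : Fin N) (s : Config N × Config N) :
    ovlp N (flipAt i s.1) (flipAt i s.2) = ovlp N s.1 s.2 := by
  rw [ovlp_eq_cavx_add i, ovlp_eq_cavx_add i s.1, cavx_flipAt_left, cavx_flipAt_right,
    spin_flipAt_self, spin_flipAt_self, neg_mul_neg]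

lemma cphi_cavx_mul_le (i : Fin N) {β θ : ℝ} {V : Config N × Config N → ℝ} (hV0 : ∀ s, 0 ≤ V s) :
    cphi (cpl N β θ) (cplJ i) (fun ρ : Fin 10 → Config N × Config N =>
        |cavx i (ρ 0).1 (ρ 0).2| * V (ρ 1) * cavW (cplω i) (cplω₀ i) ρ ^ 2) 1 ≤
      2 * √(E2 (cpl N β θ) (fun s t => ovlp N s.1 s.2 ^ 2 * V t) +
          E2 (cpl N β θ) (fun s _ => V s) * (1 / N) ^ 2) *
        √(cphi (cpl N β θ) (cplJ i) (fun ρ : Fin 10 → Config N × Config N =>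
          V (ρ 1) * cavW (cplω i) (cplω₀ i) ρ ^ 4) 1) := by
  set c := cpl N β θ
  have h1 := cphi_mul_le_sqrt c (cplJ i) (fun ρ : Fin 10 → Config N × Config N =>
    |cavx i (ρ 0).1 (ρ 0).2| * √(V (ρ 1)))
    (fun ρ => √(V (ρ 1)) * cavW (cplω i) (cplω₀ i) ρ ^ 2) 1
  have e1 : ∀ ρ : Fin 10 → Config N × Config N, |cavx i (ρ 0).1 (ρ 0).2| * √(V (ρ 1)) *
      (√(V (ρ 1)) * cavW (cplω i) (cplω₀ i) ρ ^ 2) =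
      |cavx i (ρ 0).1 (ρ 0).2| * V (ρ 1) * cavW (cplω i) (cplω₀ i) ρ ^ 2 := fun ρ => by
    have := mul_self_sqrt (hV0 (ρ 1))
    linear_combination (|cavx i (ρ 0).1 (ρ 0).2| * cavW (cplω i) (cplω₀ i) ρ ^ 2) * this
  have e2 : ∀ ρ : Fin 10 → Config N × Config N, (√(V (ρ 1)) * cavW (cplω i) (cplω₀ i) ρ ^ 2) ^ 2 =
      V (ρ 1) * cavW (cplω i) (cplω₀ i) ρ ^ 4 := fun ρ => by
    rw [mul_pow, sq_sqrt (hV0 _), ← pow_mul]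
  have e3 : ∀ ρ : Fin 10 → Config N × Config N, (|cavx i (ρ 0).1 (ρ 0).2| * √(V (ρ 1))) ^ 2 =
      cavx i (ρ 0).1 (ρ 0).2 ^ 2 * V (ρ 1) := fun ρ => by
    rw [mul_pow, sq_sqrt (hV0 _), sq_abs]
  simp only [e1, e2, e3] at h1
  refine h1.trans (mul_le_mul_of_nonneg_right ?_ (sqrt_nonneg _))
  have h2 : cphi c (cplJ i) (fun ρ : Fin 10 → Config N × Config N =>
      cavx i (ρ 0).1 (ρ 0).2 ^ 2 * V (ρ 1)) 1 ≤
      2 ^ 2 * (E2 c (fun s t => ovlp N s.1 s.2 ^ 2 * V t) + E2 c (fun s _ => V s) * (1 / N) ^ 2) := by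
    rw [cphi_pair_one (by decide) fun s t => cavx i s.1 s.2 ^ 2 * V t, ← E2_snd_eq_fst,
      mul_comm (E2 c _) ((1 / N : ℝ) ^ 2), ← E2_const_mul, ← E2_add, ← E2_const_mul]
    refine E2_mono fun s t => ?_
    have := mul_le_mul_of_nonneg_right (cavx_pow_le i s.1 s.2 1) (hV0 t)
    simp only [mul_one] at this
    linarith
  refine (sqrt_le_sqrt h2).trans_eq ?_
  rw [sqrt_mul (by positivity), sqrt_sq (by norm_num)]

/-- The cavity equation for the second moment of the cross overlap. -/
lemma abs_cplA_sub_le (hN : 1 ≤ N) {β θ h G : ℝ} (hβ : β ^ 2 ≤ 1) (hh : 0 ≤ h)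
    (hW : ∀ i, cphi (cpl N β θ) (cplJ i) (fun ρ : Fin 10 → Config N × Config N =>
      cavW (cplω i) (cplω₀ i) ρ ^ 4) 1 ≤ G * h ^ 2) :
    |cplA N β θ - (1 / N + β ^ 2 * cos θ * ((1 - 2 / N) * cplA N β θ + (1 / N) ^ 2))| ≤
      22 * cavC * √G * (√(cplA N β θ + (1 / N) ^ 2) * h) := by
  have := abs_E2_ovlp_sq_sub_le hN (θ := θ) hβ (V := fun _ => 1) (fun _ => zero_le_one)
    (fun _ _ => rfl) (fun i => (cphi_cavx_mul_le i fun _ => zero_le_one).trans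
      (mul_le_mul_of_nonneg_left (sqrt_le_sqrt (by simpa only [one_mul] using hW i))
        (by positivity)))
  simp only [mul_one, E2_const, one_mul] at this
  refine this.trans_eq ?_
  rw [sqrt_mul' _ (sq_nonneg h), sqrt_sq hh]
  unfold cplA
  ring

lemma cphi_ovlp_sq_mul_cavW_le (i : Fin N) {β θ h G : ℝ} (hβ : β ^ 2 ≤ 1) (hG : 0 ≤ G)
    (hW : cphi (cpl N β θ) (cplJ i) (fun ρ : Fin 10 → Config N × Config N =>
      cavW (cplω i) (cplω₀ i) ρ ^ 10) 1 ≤ G * h ^ 5)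
    (hR : E2 (cpl N β θ) (fun s _ => ovlp N s.1 s.2 ^ 10) ≤ G * h ^ 5) :
    cphi (cpl N β θ) (cplJ i) (fun ρ : Fin 10 → Config N × Config N =>
      ovlp N (ρ 1).1 (ρ 1).2 ^ 2 * cavW (cplω i) (cplω₀ i) ρ ^ 4) 1 ≤
      √(2 * G) * (√(cplA N β θ) * √(h ^ 5)) := by
  have h1 := cphi_mul_le_sqrt (cpl N β θ) (cplJ i) (fun ρ : Fin 10 → Config N × Config N =>
    ovlp N (ρ 1).1 (ρ 1).2)
    (fun ρ => ovlp N (ρ 1).1 (ρ 1).2 * cavW (cplω i) (cplω₀ i) ρ ^ 4) 1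
  have e1 : ∀ ρ : Fin 10 → Config N × Config N, ovlp N (ρ 1).1 (ρ 1).2 *
      (ovlp N (ρ 1).1 (ρ 1).2 * cavW (cplω i) (cplω₀ i) ρ ^ 4) =
      ovlp N (ρ 1).1 (ρ 1).2 ^ 2 * cavW (cplω i) (cplω₀ i) ρ ^ 4 := fun ρ => by
    rw [← mul_assoc, ← sq]
  simp only [e1] at h1
  have h2 : cphi (cpl N β θ) (cplJ i) (fun ρ : Fin 10 → Config N × Config N =>
      (ovlp N (ρ 1).1 (ρ 1).2 * cavW (cplω i) (cplω₀ i) ρ ^ 4) ^ 2) 1 ≤ 2 * G * h ^ 5 := by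
    refine (cphi_mono (g := fun ρ : Fin 10 → Config N × Config N =>
      ovlp N (ρ 1).1 (ρ 1).2 ^ 10 + cavW (cplω i) (cplω₀ i) ρ ^ 10) (fun ρ => ?_) 1).trans ?_
    · have h3 : ∀ x y : ℝ, 0 ≤ y → (x * y ^ 4) ^ 2 ≤ x ^ 10 + y ^ 10 := fun x y hy => by
        have h4 := abs_pow_mul_pow_le (x := x) hy 2 8
        rw [sq_abs, show 2 + 8 = 10 from rfl, (show Even 10 from ⟨5, rfl⟩).pow_abs] at h4
        linarith [show (x * y ^ 4) ^ 2 = x ^ 2 * y ^ 8 by ring]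
      exact h3 _ _ ((cavBd_cpl (θ := θ) i hβ).cavW_nonneg ρ)
    · rw [cphi_add, cphi_single_one (b := 0) (by decide)
        fun s : Config N × Config N => ovlp N s.1 s.2 ^ 10]
      linarith [hW]
  rw [cphi_single_one (b := 0) (by decide) fun s : Config N × Config N => ovlp N s.1 s.2 ^ 2] at h1
  refine h1.trans ((mul_le_mul_of_nonneg_left (sqrt_le_sqrt h2) (sqrt_nonneg _)).trans_eq ?_)
  rw [sqrt_mul (by positivity), mul_left_comm]
  rfl

/-- The cavity equation for the second moment of the averaged squared cross overlap. -/
lemma abs_cplB_sub_le (hN : 1 ≤ N) {β θ h G : ℝ} (hβ : β ^ 2 ≤ 1) (hG : 0 ≤ G)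
    (hW : ∀ i, cphi (cpl N β θ) (cplJ i) (fun ρ : Fin 10 → Config N × Config N =>
      cavW (cplω i) (cplω₀ i) ρ ^ 10) 1 ≤ G * h ^ 5)
    (hR : E2 (cpl N β θ) (fun s _ => ovlp N s.1 s.2 ^ 10) ≤ G * h ^ 5) :
    |cplB N β θ - (1 / N * cplA N β θ +
        β ^ 2 * cos θ * ((1 - 2 / N) * cplB N β θ + (1 / N) ^ 2 * cplA N β θ))| ≤
      22 * cavC * √(√(2 * G)) * (√(cplB N β θ + cplA N β θ * (1 / N) ^ 2) *
        √(√(cplA N β θ) * √(h ^ 5))) := by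
  have hD : ∀ i, cphi (cpl N β θ) (cplJ i) (fun ρ : Fin 10 → Config N × Config N =>
      |cavx i (ρ 0).1 (ρ 0).2| * ovlp N (ρ 1).1 (ρ 1).2 ^ 2 *
        cavW (cplω i) (cplω₀ i) ρ ^ 2) 1 ≤
      2 * √(cplB N β θ + cplA N β θ * (1 / N) ^ 2) *
        √(√(2 * G) * (√(cplA N β θ) * √(h ^ 5))) := fun i =>
    (cphi_cavx_mul_le i (V := fun s => ovlp N s.1 s.2 ^ 2) fun _ => sq_nonneg _).trans <|
      mul_le_mul_of_nonneg_left (sqrt_le_sqrt (cphi_ovlp_sq_mul_cavW_le i hβ hG (hW i) hR))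
        (mul_nonneg zero_le_two (sqrt_nonneg _))
  have h1 := abs_E2_ovlp_sq_sub_le hN (θ := θ) hβ (V := fun s => ovlp N s.1 s.2 ^ 2)
    (fun _ => sq_nonneg _) (fun i s => by simp only [ovlp_flipAt_flipAt]) hD
  rw [E2_snd_eq_fst, sqrt_mul (sqrt_nonneg _)] at h1
  refine h1.trans_eq ?_
  generalize √(√(2 * G)) = x
  generalize √(√(cplA N β θ) * √(h ^ 5)) = y
  ring

end CoupledErrors

section SelfConsistency

lemma le_of_sq_le_add_mul {y m k : ℝ} (hm : 0 ≤ m) (hk : 1 ≤ k) (h : y ^ 2 ≤ k + m * y) :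
    y ≤ k + m := by
  by_contra! hc
  nlinarith [mul_pos (by linarith : 0 < y - (k + m)) (by linarith : 0 < y)]

/-- Self-consistent control of the solution of the first cavity equation. -/
lemma cavity_fst_bound {n a w A C e e₀ : ℝ} (hn : 1 ≤ n) (ha : 0 < a) (haw : a ≤ w)
    (hw : w ≤ 1) (hA : 0 ≤ A) (hC : 0 ≤ C) (he : 0 ≤ e) (hee : e ≤ e₀)
    (hes : e ^ 2 * (n * a ^ 2 * w) = 1)
    (h1 : |A - (1 / n + (1 - w) * ((1 - 2 / n) * A + (1 / n) ^ 2))| ≤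
      C * (√(A + (1 / n) ^ 2) * (1 / (n * a)))) :
    n * A * w + 1 ≤ (3 + C * e₀) ^ 2 ∧
      |n * A * w - 1| ≤ (C * (3 + C * e₀) + 2 * (3 + C * e₀) ^ 2 * e₀) * e := by
  have hn0 : 0 < n := by linarith
  have hw0 : 0 < w := by linarith
  have he₀ : 0 ≤ e₀ := he.trans hee
  set z := n * A * w with hz
  have hz0 : 0 ≤ z := by positivity
  set y := √(z + 1) with hy
  have hy0 : 0 ≤ y := sqrt_nonneg _
  have hy2 : y ^ 2 = z + 1 := sq_sqrt (by linarith)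
  have hs : √(A + (1 / n) ^ 2) * (1 / a) ≤ y * e := by
    refine abs_le_of_sq_le_sq' ?_ (by positivity) |>.2
    rw [mul_pow, mul_pow, sq_sqrt (by positivity), hy2]
    have : e ^ 2 = 1 / (n * a ^ 2 * w) := by field_simp; linarith
    rw [this, hz, ← sub_nonneg]
    have : (n * A * w + 1) * (1 / (n * a ^ 2 * w)) - (A + (1 / n) ^ 2) * (1 / a) ^ 2 =
        (n - w) / (n ^ 2 * a ^ 2 * w) := by
      field_simp
      ring
    rw [this]
    exact div_nonneg (by linarith) (by positivity)
  have h2 : |z - 1 + (1 - w) * (2 * A - 1 / n)| ≤ C * (y * e) := by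
    have e1 : z - 1 + (1 - w) * (2 * A - 1 / n) =
        n * (A - (1 / n + (1 - w) * ((1 - 2 / n) * A + (1 / n) ^ 2))) := by
      rw [hz]
      field_simp
      ring
    rw [e1, abs_mul, abs_of_pos hn0]
    calc _ ≤ n * (C * (√(A + (1 / n) ^ 2) * (1 / (n * a)))) := by gcongr
      _ = C * (√(A + (1 / n) ^ 2) * (1 / a)) := by field_simp
      _ ≤ _ := by gcongr
  have hn1 : 1 / n ≤ 1 := by rw [div_le_one hn0]; exact hn
  have hn1' : 0 ≤ 1 / n := by positivity
  have hy3 : y ≤ 3 + C * e₀ := by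
    refine le_of_sq_le_add_mul (by positivity) (by norm_num) ?_
    have h3 := (abs_le.1 h2).2
    have h4 : C * (y * e) ≤ C * e₀ * y := by
      nlinarith [mul_le_mul_of_nonneg_left hee (mul_nonneg hC hy0)]
    nlinarith [mul_nonneg (by linarith : 0 ≤ 1 - w) hA,
      mul_nonneg hw0.le hn1']
  have hY : z + 1 ≤ (3 + C * e₀) ^ 2 := by rw [← hy2]; gcongr
  refine ⟨hY, ?_⟩
  have h5 : |(1 - w) * (2 * A - 1 / n)| ≤ 2 * (3 + C * e₀) ^ 2 * e₀ * e := by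
    have h6 : |(1 - w) * (2 * A - 1 / n)| ≤ 2 * A + 1 / n := by
      rw [abs_mul, abs_of_nonneg (by linarith : 0 ≤ 1 - w)]
      have : |2 * A - 1 / n| ≤ 2 * A + 1 / n := by rw [abs_le]; constructor <;> linarith
      nlinarith [abs_nonneg (2 * A - 1 / n)]
    have h7 : 2 * A + 1 / n = (2 * z + w) * a ^ 2 * e ^ 2 := by
      have : e ^ 2 = 1 / (n * a ^ 2 * w) := by field_simp; linarith
      rw [this, hz]
      field_simp
    have ha2 : a ^ 2 ≤ 1 := by nlinarith
    have h8 : (2 * z + w) * a ^ 2 ≤ 2 * (3 + C * e₀) ^ 2 := by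
      nlinarith [mul_le_mul_of_nonneg_left ha2 (by positivity : 0 ≤ 2 * z + w)]
    calc _ ≤ (2 * z + w) * a ^ 2 * e ^ 2 := h6.trans_eq h7
      _ ≤ 2 * (3 + C * e₀) ^ 2 * e ^ 2 := by gcongr
      _ ≤ 2 * (3 + C * e₀) ^ 2 * (e₀ * e) := by rw [sq e]; gcongr
      _ = _ := by ring
  calc |z - 1| = |(z - 1 + (1 - w) * (2 * A - 1 / n)) - (1 - w) * (2 * A - 1 / n)| := by
        congr 1; ring
    _ ≤ C * (y * e) + 2 * (3 + C * e₀) ^ 2 * e₀ * e := (abs_sub _ _).trans (add_le_add h2 h5)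
    _ ≤ C * ((3 + C * e₀) * e) + 2 * (3 + C * e₀) ^ 2 * e₀ * e := by gcongr
    _ = _ := by ring

/-- Self-consistent control of the solutions of the two cavity equations. -/
lemma cavity_snd_bound {n a w A B C e₀ Y e : ℝ} (hn : 1 ≤ n) (ha : 0 < a) (haw : a ≤ w)
    (hw : w ≤ 1) (hA : 0 ≤ A) (hB : 0 ≤ B) (hC : 0 ≤ C) (he : 0 ≤ e) (hee : e ≤ e₀) (hY : 1 ≤ Y)
    (hz : n * A * w ≤ Y ^ 2) (hne : 1 / n ≤ e₀ * e) (hes : e ^ 4 * (n ^ 2 * a ^ 5 * w) = 1)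
    (h2 : |B - (1 / n * A + (1 - w) * ((1 - 2 / n) * B + (1 / n) ^ 2 * A))| ≤
      C * (√(B + A * (1 / n) ^ 2) * √(√A * √((1 / (n * a)) ^ 5)))) :
    n ^ 2 * w ^ 2 * B - n * A * w ≤
      (Y ^ 2 * e₀ + C * Y * (3 * Y ^ 2 + C * Y * e₀)) * e := by
  have hn0 : 0 < n := by linarith
  have hw0 : 0 < w := by linarith
  have he₀ : 0 ≤ e₀ := he.trans hee
  set z := n * A * w with hzd
  have hz0 : 0 ≤ z := by positivity
  set q := n ^ 2 * w ^ 2 * B with hq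
  have hq0 : 0 ≤ q := by positivity
  have hn1 : 1 / n ≤ 1 := by rw [div_le_one hn0]; exact hn
  have hn1' : 0 ≤ 1 / n := by positivity
  set y := √(q + Y ^ 2) with hy
  have hy0 : 0 ≤ y := sqrt_nonneg _
  have hy2 : y ^ 2 = q + Y ^ 2 := sq_sqrt (by positivity)
  have hs1 : n * w * √(B + A * (1 / n) ^ 2) ≤ y := by
    refine abs_le_of_sq_le_sq' ?_ hy0 |>.2
    rw [mul_pow, sq_sqrt (by positivity), hy2]
    have : (n * w) ^ 2 * (B + A * (1 / n) ^ 2) = q + w ^ 2 * A := by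
      rw [hq]; field_simp
    rw [this]
    have : w ^ 2 * A ≤ z := by
      rw [hzd]; nlinarith [mul_nonneg hA hw0.le]
    linarith
  have hs2 : n * √(√A * √((1 / (n * a)) ^ 5)) ≤ Y * e := by
    refine le_of_pow_le_pow_left₀ (n := 4) (by norm_num) (by positivity) ?_
    have e1 : √(√A * √((1 / (n * a)) ^ 5)) ^ 4 = A * (1 / (n * a)) ^ 5 := by
      rw [show (4 : ℕ) = 2 * 2 from rfl, pow_mul, sq_sqrt (by positivity), mul_pow, sq_sqrt hA,
        sq_sqrt (by positivity)]
    rw [mul_pow, e1, mul_pow]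
    have e2 : e ^ 4 = 1 / (n ^ 2 * a ^ 5 * w) := by field_simp; linarith
    have e3 : n ^ 4 * (A * (1 / (n * a)) ^ 5) = z * e ^ 4 := by
      rw [e2, hzd]; field_simp
    rw [e3]
    gcongr
    exact hz.trans (pow_le_pow_right₀ hY (by norm_num))
  have h3 : q - z ≤ z * (1 / n) + C * (y * (Y * e)) := by
    have e1 : q - z + 2 * (1 - w) * n * w * B - (1 - w) * (z * (1 / n)) =
        n ^ 2 * w * (B - (1 / n * A + (1 - w) * ((1 - 2 / n) * B + (1 / n) ^ 2 * A))) := by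
      rw [hq, hzd]
      field_simp
      ring
    have h4 : q - z + 2 * (1 - w) * n * w * B - (1 - w) * (z * (1 / n)) ≤ C * (y * (Y * e)) := by
      rw [e1]
      calc _ ≤ n ^ 2 * w * (C * (√(B + A * (1 / n) ^ 2) * √(√A * √((1 / (n * a)) ^ 5)))) := by
            gcongr; exact (abs_le.1 h2).2
        _ = C * ((n * w * √(B + A * (1 / n) ^ 2)) * (n * √(√A * √((1 / (n * a)) ^ 5)))) := by ring
        _ ≤ _ := by gcongr
    have h5 : 0 ≤ 2 * (1 - w) * n * w * B := by
      have : 0 ≤ 1 - w := by linarith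
      positivity
    have h6 : 0 ≤ w * (z * (1 / n)) := by positivity
    linarith
  have hy3 : y ≤ 3 * Y ^ 2 + C * Y * e₀ := by
    refine le_of_sq_le_add_mul (by positivity) (by nlinarith) ?_
    have h4 : C * (y * (Y * e)) ≤ C * Y * e₀ * y := by
      have : C * (y * (Y * e)) ≤ C * (y * (Y * e₀)) := by gcongr
      linarith
    have h5 : z * (1 / n) ≤ Y ^ 2 := by nlinarith
    linarith
  have h6 : z * (1 / n) ≤ Y ^ 2 * (e₀ * e) := by gcongr
  have h7 : C * (y * (Y * e)) ≤ C * ((3 * Y ^ 2 + C * Y * e₀) * (Y * e)) := by gcongr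
  linarith

/-- A constant for `cavity_solution_bound`. -/
def cavityK (C e₀ : ℝ) : ℝ :=
  (C * (3 + C * e₀) + 2 * (3 + C * e₀) ^ 2 * e₀) + ((3 + C * e₀) ^ 2 * e₀ +
    C * (3 + C * e₀) * (3 * (3 + C * e₀) ^ 2 + C * (3 + C * e₀) * e₀))

/-- The averaged squared cross overlap concentrates around the solution of the limiting cavity
equation. -/
lemma cavity_solution_bound {n a w A B C e₀ : ℝ} (hn : 1 ≤ n) (ha : 0 < a) (haw : a ≤ w)
    (hw : w ≤ 1) (hA : 0 ≤ A) (hB : 0 ≤ B) (hC : 0 ≤ C) (he₀ : 1 / √(n * a ^ 3) ≤ e₀)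
    (h1 : |A - (1 / n + (1 - w) * ((1 - 2 / n) * A + (1 / n) ^ 2))| ≤
      C * (√(A + (1 / n) ^ 2) * (1 / (n * a))))
    (h2 : |B - (1 / n * A + (1 - w) * ((1 - 2 / n) * B + (1 / n) ^ 2 * A))| ≤
      C * (√(B + A * (1 / n) ^ 2) * √(√A * √((1 / (n * a)) ^ 5)))) :
    n ^ 2 * B - 2 * (1 / w) * (n * A) + (1 / w) ^ 2 ≤
      cavityK C e₀ * (1 / √(n * a ^ 3) * √(√(a / w))) * (1 / w) ^ 2 := by
  have hn0 : 0 < n := by linarith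
  have hw0 : 0 < w := by linarith
  set δ := 1 / √(n * a ^ 3) with hδ
  have hδ0 : 0 < δ := by positivity
  have hδ2 : δ ^ 2 = 1 / (n * a ^ 3) := by
    rw [hδ, div_pow, sq_sqrt (by positivity), one_pow]
  set r := √(a / w) with hr
  have hr0 : 0 < r := by positivity
  have hr2 : r ^ 2 = a / w := sq_sqrt (by positivity)
  have hr1 : r ≤ 1 := by
    rw [hr, sqrt_le_left zero_le_one, one_pow, div_le_one hw0]; exact haw
  set s := √r with hs
  have hs0 : 0 < s := by positivity
  have hs2 : s ^ 2 = r := sq_sqrt hr0.le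
  have hs1 : s ≤ 1 := by rw [hs, sqrt_le_left zero_le_one, one_pow]; exact hr1
  have hrs : r ≤ s := by nlinarith
  have he₀' : 0 ≤ e₀ := hδ0.le.trans he₀
  have hδr : δ * r ≤ δ * s := by gcongr
  have hδs : δ * s ≤ e₀ := by nlinarith
  obtain ⟨hz, hz1⟩ := cavity_fst_bound (e := δ * r) hn ha haw hw hA hC (by positivity)
    (hδr.trans hδs) (by rw [mul_pow, hδ2, hr2]; field_simp) h1
  have hY : 1 ≤ 3 + C * e₀ := by nlinarith [mul_nonneg hC he₀']
  have hne : 1 / n ≤ e₀ * (δ * s) := by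
    have h3 : 1 / n = a ^ 2 * w * ((δ * r) * (δ * r)) := by
      have : (δ * r) * (δ * r) = δ ^ 2 * r ^ 2 := by ring
      rw [this, hδ2, hr2]; field_simp
    have h4 : a ^ 2 * w ≤ 1 := by
      have : a ^ 2 ≤ 1 := by nlinarith
      nlinarith
    calc 1 / n = a ^ 2 * w * ((δ * r) * (δ * r)) := h3
      _ ≤ 1 * ((δ * s) * (δ * s)) := by gcongr
      _ ≤ e₀ * (δ * s) := by rw [one_mul]; gcongr
  have hq := cavity_snd_bound (e := δ * s) hn ha haw hw hA hB hC (by positivity) hδs hY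
    (by linarith) hne (by
      have : (δ * s) ^ 4 = (δ ^ 2) ^ 2 * (s ^ 2) ^ 2 := by ring
      rw [this, hδ2, hs2, hr2]; field_simp) h2
  have h5 : n ^ 2 * w ^ 2 * B - 2 * (n * A * w) + 1 ≤ cavityK C e₀ * (δ * s) := by
    have h6 := (abs_le.1 hz1).1
    have h7 : (C * (3 + C * e₀) + 2 * (3 + C * e₀) ^ 2 * e₀) * (δ * r) ≤
      (C * (3 + C * e₀) + 2 * (3 + C * e₀) ^ 2 * e₀) * (δ * s) := by gcongr
    unfold cavityK
    linarith
  have h8 : n ^ 2 * B - 2 * (1 / w) * (n * A) + (1 / w) ^ 2 =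
      (n ^ 2 * w ^ 2 * B - 2 * (n * A * w) + 1) * (1 / w) ^ 2 := by field_simp
  rw [h8]
  gcongr

end SelfConsistency

section CrossOverlap

variable {N : ℕ}

lemma integral_sq_skX_sub (β θ x : ℝ) :
    ∫ p, (N * skX N β θ (fun σ τ => ovlp N σ τ ^ 2) p - x) ^ 2
      ∂(stdG (Fin N × Fin N)).prod (stdG (Fin N × Fin N)) =
    N ^ 2 * cplB N β θ - 2 * x * (N * cplA N β θ) + x ^ 2 := by
  have hA : cplA N β θ = _ := E2_cpl_self β θ fun σ τ => ovlp N σ τ ^ 2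
  have hB : cplB N β θ = _ :=
    E2_cpl_mul β θ (fun σ τ => ovlp N σ τ ^ 2) fun σ τ => ovlp N σ τ ^ 2
  rw [hA, hB]
  set X := skX N β θ fun σ τ => ovlp N σ τ ^ 2
  have hX : Integrable X ((stdG (Fin N × Fin N)).prod (stdG (Fin N × Fin N))) :=
    integrable_skX β θ _
  have hXX : Integrable (fun p => X p * X p)
      ((stdG (Fin N × Fin N)).prod (stdG (Fin N × Fin N))) :=
    hX.mul_bdd (c := ∑ σ, ∑ τ, |ovlp N σ τ ^ 2|) (continuous_skX β θ _).aestronglyMeasurable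
      (ae_of_all _ fun p => abs_skX_le β θ _ p)
  have e1 : ∀ p, (N * X p - x) ^ 2 = (N ^ 2 * (X p * X p) - 2 * x * N * X p) + x ^ 2 :=
    fun p => by ring
  simp only [e1]
  have h2 : Integrable (fun p => N ^ 2 * (X p * X p) - 2 * x * N * X p)
      ((stdG (Fin N × Fin N)).prod (stdG (Fin N × Fin N))) :=
    (hXX.const_mul _).sub (hX.const_mul _)
  rw [integral_add h2 (integrable_const _),
    integral_sub (hXX.const_mul _) (hX.const_mul _), integral_const_mul, integral_const_mul]
  simp only [integral_const, probReal_univ, one_smul]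
  ring

lemma integral_abs_le_sqrt_integral_sq {Ω : Type*} [MeasurableSpace Ω] {μ : Measure Ω}
    [IsProbabilityMeasure μ] {f : Ω → ℝ} (hf : Integrable f μ)
    (hf2 : Integrable (fun x => f x ^ 2) μ) : ∫ x, |f x| ∂μ ≤ √(∫ x, f x ^ 2 ∂μ) := by
  refine le_sqrt_of_sq_le ?_
  set m := ∫ x, |f x| ∂μ with hm
  have h1 : 0 ≤ ∫ x, (|f x| - m) ^ 2 ∂μ := integral_nonneg fun _ => sq_nonneg _
  have e1 : ∀ x, (|f x| - m) ^ 2 = (f x ^ 2 - 2 * m * |f x|) + m ^ 2 := fun x => by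
    rw [← sq_abs (f x)]; ring
  simp only [e1] at h1
  have h2 : Integrable (fun x => f x ^ 2 - 2 * m * |f x|) μ := hf2.sub (hf.abs.const_mul _)
  rw [integral_add h2 (integrable_const _),
    integral_sub hf2 (hf.abs.const_mul _), integral_const_mul] at h1
  simp only [integral_const, probReal_univ, one_smul, ← hm] at h1
  linarith

lemma integral_abs_skX_sub_le (β θ x : ℝ) :
    ∫ p, |N * skX N β θ (fun σ τ => ovlp N σ τ ^ 2) p - x|
      ∂(stdG (Fin N × Fin N)).prod (stdG (Fin N × Fin N)) ≤
    √(N ^ 2 * cplB N β θ - 2 * x * (N * cplA N β θ) + x ^ 2) := by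
  rw [← integral_sq_skX_sub]
  set X := skX N β θ fun σ τ => ovlp N σ τ ^ 2 with hX
  have hXc : Continuous fun p => N * X p - x :=
    (continuous_const.mul (continuous_skX β θ _)).sub continuous_const
  have hb : ∀ p, |N * X p - x| ≤ N * (∑ σ, ∑ τ, |ovlp N σ τ ^ 2|) + |x| := fun p =>
    (abs_sub _ _).trans (add_le_add_left (by
      rw [abs_mul, Nat.abs_cast]
      exact mul_le_mul_of_nonneg_left (abs_skX_le β θ _ p) (Nat.cast_nonneg _)) _)
  refine integral_abs_le_sqrt_integral_sq (Integrable.of_bound hXc.aestronglyMeasurable _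
    (ae_of_all _ hb)) (Integrable.of_bound
      (C := (N * (∑ σ, ∑ τ, |ovlp N σ τ ^ 2|) + |x|) ^ 2) (hXc.pow 2).aestronglyMeasurable
    (ae_of_all _ fun p => ?_))
  rw [norm_pow, norm_eq_abs]
  exact pow_le_pow_left₀ (abs_nonneg _) (hb p) 2

/-- A constant dominating the moments of the cavity fields. -/
def cplG : ℝ := 4 * 512 ^ 10 * (6 * momD + 1) ^ 5

lemma cplG_pos : 0 < cplG := by
  have := momD_pos
  unfold cplG
  positivity

lemma one_div_pow_le {β : ℝ} (hN : 1 ≤ N) (hβ0 : 0 < β) (hβ1 : β < 1) (k : ℕ) :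
    (1 / (N : ℝ)) ^ (2 * k) ≤ (1 / (N * (1 - β ^ 2))) ^ k := by
  have hN0 : (1 : ℝ) ≤ N := by exact_mod_cast hN
  have hb : 0 < 1 - β ^ 2 := by nlinarith
  rw [pow_mul]
  refine pow_le_pow_left₀ (by positivity) ?_ k
  have h1 : 1 / (N : ℝ) ≤ 1 := by rw [div_le_one (by linarith)]; exact hN0
  have h2 : 1 / (N : ℝ) ≤ 1 / (N * (1 - β ^ 2)) :=
    one_div_le_one_div_of_le (by positivity) (by nlinarith)
  have h3 : (0 : ℝ) ≤ 1 / N := by positivity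
  nlinarith

lemma cphi_cpl_cavW_pow_le {β θ : ℝ} (hN : 1 ≤ N) (hβ0 : 0 < β) (hβ1 : β < 1)
    (hm : ∀ k ≤ 5, skMom N β (2 * k) ≤ (6 * momD + 1) ^ k * (1 / (N * (1 - β ^ 2))) ^ k)
    (i : Fin N) {k : ℕ} (hk : k ≤ 4) :
    cphi (cpl N β θ) (cplJ i) (fun ρ => cavW (cplω i) (cplω₀ i) ρ ^ (2 * k + 2)) 1 ≤
      cplG * (1 / (N * (1 - β ^ 2))) ^ (k + 1) := by
  refine (E2_cpl_cavW_pow_le i (by nlinarith) k).trans ?_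
  have hD := momD_pos
  have hb : 0 < 1 - β ^ 2 := by nlinarith
  set h := (1 / (N * (1 - β ^ 2)) : ℝ) with hh
  have hh0 : 0 ≤ h := by positivity
  have h1 := hm (k + 1) (by omega)
  have h2 := one_div_pow_le hN hβ0 hβ1 (k + 1)
  have h3 : (6 * momD + 1) ^ (k + 1) ≤ (6 * momD + 1) ^ 5 :=
    pow_le_pow_right₀ (by linarith) (by omega)
  have h4 : 1 ≤ (6 * momD + 1) ^ 5 := one_le_pow₀ (by linarith)
  have h5 : (512 : ℝ) ^ (2 * k + 2) ≤ 512 ^ 10 := pow_le_pow_right₀ (by norm_num) (by omega)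
  have h6 : skMom N β (2 * (k + 1)) + (1 / N) ^ (2 * (k + 1)) ≤
      2 * (6 * momD + 1) ^ 5 * h ^ (k + 1) := by
    have h7 : (6 * momD + 1) ^ (k + 1) * h ^ (k + 1) ≤ (6 * momD + 1) ^ 5 * h ^ (k + 1) := by
      gcongr
    have h8 : 1 * h ^ (k + 1) ≤ (6 * momD + 1) ^ 5 * h ^ (k + 1) := by gcongr
    linarith
  have h7 : 0 ≤ skMom N β (2 * (k + 1)) + (1 / N) ^ (2 * (k + 1)) :=
    add_nonneg (skMom_nonneg β _) (by positivity)
  calc _ ≤ 2 * 512 ^ 10 * (2 * (6 * momD + 1) ^ 5 * h ^ (k + 1)) := by gcongr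
    _ = _ := by unfold cplG; ring

/-- A constant for the two cavity equations. -/
def cplC : ℝ := 22 * cavC * (√cplG + √(√(2 * cplG)))

lemma cplC_nonneg : 0 ≤ cplC := by
  have := cavC_pos
  unfold cplC
  positivity

/-- The averaged squared cross overlap is close to its limit. -/
lemma integral_abs_skX_sub_limit_le {c₀ β θ : ℝ} (hc : 0 < c₀) (hN : 1 ≤ N) (hβ0 : 0 < β)
    (hβ1 : β < 1) (hcN : c₀ ≤ N * (1 - β ^ 2) ^ 3)
    (hm : ∀ k ≤ 5, skMom N β (2 * k) ≤ (6 * momD + 1) ^ k * (1 / (N * (1 - β ^ 2))) ^ k)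
    (hθ : 0 ≤ cos θ) :
    ∫ p, |N * skX N β θ (fun σ τ => ovlp N σ τ ^ 2) p - 1 / (1 - β ^ 2 * cos θ)|
      ∂(stdG (Fin N × Fin N)).prod (stdG (Fin N × Fin N)) ≤
    √(cavityK cplC (1 / √c₀) * (1 / √(N * (1 - β ^ 2) ^ 3) *
      √(√((1 - β ^ 2) / (1 - β ^ 2 * cos θ)))) * (1 / (1 - β ^ 2 * cos θ)) ^ 2) := by
  refine (integral_abs_skX_sub_le _ _ _).trans (sqrt_le_sqrt ?_)
  have hN0 : (1 : ℝ) ≤ N := by exact_mod_cast hN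
  have hb : 0 < 1 - β ^ 2 := by nlinarith
  have hb2 : β ^ 2 ≤ 1 := by linarith
  have hG := cplG_pos
  have hC := cavC_pos
  have hh : (0 : ℝ) ≤ 1 / (N * (1 - β ^ 2)) := by positivity
  have h1 := abs_cplA_sub_le (θ := θ) hN hb2 hh
    (fun i => cphi_cpl_cavW_pow_le (θ := θ) hN hβ0 hβ1 hm i (k := 1) (by norm_num))
  have hR : E2 (cpl N β θ) (fun s _ => ovlp N s.1 s.2 ^ 10) ≤
      cplG * (1 / (N * (1 - β ^ 2))) ^ 5 := by
    rw [E2_cpl_self β θ fun σ τ => ovlp N σ τ ^ 10]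
    refine (integral_skX_ovlp_pow_le β θ 10).trans ((hm 5 le_rfl).trans ?_)
    gcongr
    unfold cplG
    have : 0 < (6 * momD + 1) ^ 5 := by have := momD_pos; positivity
    nlinarith
  have h2 := abs_cplB_sub_le (θ := θ) hN hb2 hG.le
    (fun i => cphi_cpl_cavW_pow_le (θ := θ) hN hβ0 hβ1 hm i (k := 4) (by norm_num)) hR
  have e1 : β ^ 2 * cos θ = 1 - (1 - β ^ 2 * cos θ) := by ring
  have hc1 := cos_le_one θ
  refine cavity_solution_bound hN0 hb (by nlinarith [sq_nonneg β]) (by nlinarith [sq_nonneg β])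
    (cplA_nonneg β θ) (cplB_nonneg β θ) cplC_nonneg
    (one_div_le_one_div_of_le (sqrt_pos.2 hc) (sqrt_le_sqrt hcN)) ?_ ?_
  · rw [← e1]
    refine h1.trans (mul_le_mul_of_nonneg_right ?_ (by positivity))
    unfold cplC
    exact mul_le_mul_of_nonneg_left (le_add_of_nonneg_right (sqrt_nonneg _)) (by positivity)
  · rw [← e1]
    refine h2.trans (mul_le_mul_of_nonneg_right ?_ (by positivity))
    unfold cplC
    exact mul_le_mul_of_nonneg_left (le_add_of_nonneg_left (sqrt_nonneg _)) (by positivity)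

lemma sqrt_error_eq {K n a w : ℝ} (hK : 0 ≤ K) (hn : 0 < n) (ha : 0 < a) (hw : 0 < w) :
    √(K * (1 / √(n * a ^ 3) * √(√(a / w))) * (1 / w) ^ 2) =
      √K * (n * a ^ 3) ^ (-(1 : ℝ) / 4) * a ^ ((1 : ℝ) / 8) * w ^ (-(9 : ℝ) / 8) := by
  have h1 : 0 < n * a ^ 3 := by positivity
  rw [sqrt_mul' _ (sq_nonneg _), sqrt_sq (by positivity), sqrt_mul hK, sqrt_mul (by positivity)]
  have e1 : √(1 / √(n * a ^ 3)) = (n * a ^ 3) ^ (-(1 : ℝ) / 4) := by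
    rw [sqrt_eq_rpow, sqrt_eq_rpow, one_div, ← rpow_neg h1.le, ← rpow_mul h1.le]
    norm_num
  have e2 : √(√(√(a / w))) = a ^ ((1 : ℝ) / 8) * w ^ (-(1 : ℝ) / 8) := by
    rw [sqrt_eq_rpow, sqrt_eq_rpow, sqrt_eq_rpow, ← rpow_mul (by positivity),
      ← rpow_mul (by positivity), div_rpow ha.le hw.le, div_eq_mul_inv, ← rpow_neg hw.le]
    norm_num
  have e3 : w ^ (-(9 : ℝ) / 8) = w ^ (-(1 : ℝ) / 8) * (1 / w) := by
    rw [one_div, ← rpow_neg_one, ← rpow_add hw]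
    norm_num
  rw [e1, e2, e3]
  ring

end CrossOverlap

section FreeEnergy

variable {N : ℕ}

lemma hasGrad_freeEnergy (N : ℕ) (β : ℝ) : ∃ C, HasGrad (freeEnergy N β)
    (fun x e => ∑ σ, softmax (ham N β x) σ * skc N β e σ) C := by
  refine ⟨∑ e, ∑ σ, |skc N β e σ|, ?_⟩
  have h1 := hasGrad_log_sum_exp (skc N β) (fun _ => 0) (C := ∑ e, ∑ σ, |skc N β e σ|)
    fun e σ => (single_le_sum (f := fun σ => |skc N β e σ|) (fun _ _ => abs_nonneg _)
      (mem_univ σ)).trans (single_le_sum (f := fun e => ∑ σ, |skc N β e σ|)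
        (fun _ _ => sum_nonneg fun _ _ => abs_nonneg _) (mem_univ e))
  simp only [zero_add, ← ham_eq_sum] at h1
  exact h1

lemma sum_grad_freeEnergy (hN : 1 ≤ N) (β θ : ℝ)
    (p : (Fin N × Fin N → ℝ) × (Fin N × Fin N → ℝ)) :
    ∑ e, (∑ σ, softmax (ham N β p.1) σ * skc N β e σ) *
        (∑ σ, softmax (ham N β (cos θ • p.1 + sin θ • p.2)) σ * skc N β e σ) =
      β ^ 2 / 2 * (N * skX N β θ (fun σ τ => ovlp N σ τ ^ 2) p - 1) := by
  rw [sum_slope_mul hN]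
  suffices h : ∑ σ, ∑ τ, softmax (ham N β p.1) σ *
      softmax (ham N β (cos θ • p.1 + sin θ • p.2)) τ * (β ^ 2 * (N * ovlp N σ τ ^ 2 - 1) / 2) =
      β ^ 2 / 2 * (N * skX N β θ (fun σ τ => ovlp N σ τ ^ 2) p - skX N β θ (fun _ _ => 1) p) by
    rw [h, skX_const]
  simp only [skX, Finset.mul_sum, ← Finset.sum_sub_distrib]
  exact Finset.sum_congr rfl fun σ _ => Finset.sum_congr rfl fun τ _ => by ring

lemma one_sub_mul_cos_pos {u : ℝ} (hu0 : 0 ≤ u) (hu1 : u < 1) (θ : ℝ) : 0 < 1 - u * cos θ := by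
  nlinarith [cos_le_one θ]

lemma integral_sin_mul_limit {u : ℝ} (hu0 : 0 ≤ u) (hu1 : u < 1) :
    ∫ θ in (0 : ℝ)..(π / 2), sin θ * (u / 2 * (1 / (1 - u * cos θ) - 1)) =
      -(1 / 2) * log (1 - u) - u / 2 := by
  have hw := one_sub_mul_cos_pos hu0 hu1
  rw [intervalIntegral.integral_eq_sub_of_hasDerivAt
    (f := fun θ => 1 / 2 * log (1 - u * cos θ) + u / 2 * cos θ)]
  · simp only [cos_pi_div_two, cos_zero, mul_zero, sub_zero, log_one, mul_one]
    ring
  · intro θ _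
    have h1 : HasDerivAt (fun θ => 1 - u * cos θ) (u * sin θ) θ := by
      simpa using ((hasDerivAt_cos θ).const_mul u).const_sub 1
    refine (((h1.log (hw θ).ne').const_mul (1 / 2)).add
      ((hasDerivAt_cos θ).const_mul (u / 2))).congr_deriv ?_
    have := (hw θ).ne'
    field_simp
    ring
  · refine Continuous.intervalIntegrable ?_ _ _
    have h2 : Continuous fun θ => 1 / (1 - u * cos θ) :=
      continuous_const.div (by fun_prop) fun θ => (hw θ).ne'
    fun_prop

lemma continuous_one_sub_mul_cos_rpow {u : ℝ} (hu0 : 0 ≤ u) (hu1 : u < 1) (r : ℝ) :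
    Continuous fun θ => (1 - u * cos θ) ^ r :=
  Continuous.rpow_const (by fun_prop) fun θ => Or.inl (one_sub_mul_cos_pos hu0 hu1 θ).ne'

lemma integral_sin_mul_rpow_le {u : ℝ} (hu0 : 0 < u) (hu1 : u < 1) :
    ∫ θ in (0 : ℝ)..(π / 2), sin θ * (1 - u * cos θ) ^ (-(9 : ℝ) / 8) ≤
      8 / u * (1 - u) ^ (-(1 : ℝ) / 8) := by
  have hw := one_sub_mul_cos_pos hu0.le hu1
  rw [intervalIntegral.integral_eq_sub_of_hasDerivAt
    (f := fun θ => -(8 / u) * (1 - u * cos θ) ^ (-(1 : ℝ) / 8))]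
  · simp only [cos_pi_div_two, cos_zero, mul_zero, sub_zero, mul_one, one_rpow]
    have : 0 < 8 / u := by positivity
    linarith
  · intro θ _
    have h1 : HasDerivAt (fun θ => 1 - u * cos θ) (u * sin θ) θ := by
      simpa using ((hasDerivAt_cos θ).const_mul u).const_sub 1
    refine ((h1.rpow_const (p := -(1 : ℝ) / 8) (Or.inl (hw θ).ne')).const_mul
      (-(8 / u))).congr_deriv ?_
    rw [show -(1 : ℝ) / 8 - 1 = -9 / 8 by norm_num]
    field_simp
  · exact (continuous_sin.mul
      (continuous_one_sub_mul_cos_rpow hu0.le hu1 _)).intervalIntegrable _ _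

lemma nuSK_pos {β : ℝ} (hβ0 : 0 < β) (hβ1 : β < 1) : 0 < nuSK β := by
  have h1 : 0 < 1 - β ^ 2 := by nlinarith
  have h2 := log_lt_sub_one_of_pos h1 (by nlinarith [sq_pos_of_pos hβ0])
  unfold nuSK
  linarith

lemma cavityK_nonneg {C e₀ : ℝ} (hC : 0 ≤ C) (he : 0 ≤ e₀) : 0 ≤ cavityK C e₀ := by
  unfold cavityK
  positivity

/-- The total variation bound for the free energy, given the moment bounds for the overlap. -/
lemma abs_measureReal_freeEnergy_sub_le {c₀ β : ℝ} (hc : 0 < c₀) (hN : 1 ≤ N) (hβ0 : 0 < β)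
    (hβ1 : β < 1) (hcN : c₀ ≤ N * (1 - β ^ 2) ^ 3)
    (hm : ∀ k ≤ 5, skMom N β (2 * k) ≤ (6 * momD + 1) ^ k * (1 / (N * (1 - β ^ 2))) ^ k)
    {A : Set ℝ} (hA : MeasurableSet A) :
    |((gaussPi N) ((fun g => (freeEnergy N β g -
        ∫ g', freeEnergy N β g' ∂gaussPi N) / √(nuSK β)) ⁻¹' A)).toReal -
      ((gaussianReal 0 1) A).toReal| ≤
    8 * √(cavityK cplC (1 / √c₀)) / nuSK β * (N * (1 - β ^ 2) ^ 3) ^ (-(1 : ℝ) / 4) := by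
  obtain ⟨C, hF⟩ := hasGrad_freeEnergy N β
  set u := β ^ 2 with hu
  have hu0 : 0 < u := by positivity
  have hu1 : u < 1 := by nlinarith
  have ha : 0 < 1 - u := by linarith
  have hN0 : (0 : ℝ) < N := by exact_mod_cast hN
  have hw := one_sub_mul_cos_pos hu0.le hu1
  set K := cavityK cplC (1 / √c₀) with hKd
  have hK : 0 ≤ K := cavityK_nonneg cplC_nonneg (by positivity)
  set P := √K * (N * (1 - u) ^ 3) ^ (-(1 : ℝ) / 4) * (1 - u) ^ ((1 : ℝ) / 8) with hP
  have hP0 : 0 ≤ P := by positivity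
  have hb : Continuous fun θ => u / 2 * (1 / (1 - u * cos θ) - 1) := by
    have h2 : Continuous fun θ => 1 / (1 - u * cos θ) :=
      continuous_const.div (by fun_prop) fun θ => (hw θ).ne'
    fun_prop
  have hd : Continuous fun θ => u / 2 * P * (1 - u * cos θ) ^ (-(9 : ℝ) / 8) :=
    continuous_const.mul (continuous_one_sub_mul_cos_rpow hu0.le hu1 _)
  have hν := nuSK_pos hβ0 hβ1
  have h1 := hF.abs_measureReal_sub_gaussian_le hb hd hν
    (integral_sin_mul_limit hu0.le hu1) (fun θ hθ => ?_) hA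
  · refine h1.trans ?_
    have e1 : ∫ θ in (0 : ℝ)..(π / 2), sin θ * (u / 2 * P * (1 - u * cos θ) ^ (-(9 : ℝ) / 8)) =
        u / 2 * P * ∫ θ in (0 : ℝ)..(π / 2), sin θ * (1 - u * cos θ) ^ (-(9 : ℝ) / 8) := by
      rw [← intervalIntegral.integral_const_mul]
      congr 1
      ext θ
      ring
    rw [e1]
    calc _ ≤ 2 / nuSK β * (u / 2 * P * (8 / u * (1 - u) ^ (-(1 : ℝ) / 8))) := by
          gcongr
          exact integral_sin_mul_rpow_le hu0 hu1
      _ = 8 * √K / nuSK β * (N * (1 - u) ^ 3) ^ (-(1 : ℝ) / 4) *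
          ((1 - u) ^ ((1 : ℝ) / 8) * (1 - u) ^ (-(1 : ℝ) / 8)) := by
          rw [hP]
          field_simp
      _ = _ := by
          rw [← rpow_add ha]
          norm_num
  · have e2 : ∀ p : (Fin N × Fin N → ℝ) × (Fin N × Fin N → ℝ),
        |∑ e, (∑ σ, softmax (ham N β p.1) σ * skc N β e σ) *
          (∑ σ, softmax (ham N β (cos θ • p.1 + sin θ • p.2)) σ * skc N β e σ) -
            u / 2 * (1 / (1 - u * cos θ) - 1)| =
        u / 2 * |N * skX N β θ (fun σ τ => ovlp N σ τ ^ 2) p - 1 / (1 - u * cos θ)| := fun p => by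
      rw [sum_grad_freeEnergy hN, ← mul_sub, abs_mul, abs_of_pos (by positivity : 0 < β ^ 2 / 2)]
      congr 2
      ring
    simp only [e2]
    rw [integral_const_mul, mul_assoc]
    refine mul_le_mul_of_nonneg_left ?_ (by positivity)
    refine (integral_abs_skX_sub_limit_le hc hN hβ0 hβ1 hcN hm
      (cos_nonneg_of_mem_Icc ⟨by linarith [hθ.1, pi_pos], hθ.2⟩)).trans_eq ?_
    rw [sqrt_error_eq hK hN0 ha (hw θ)]

end FreeEnergy

section NearCritical

lemma rpow_near_critical {n a : ℝ} (hn : 0 < n) (ha : 0 < a) :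
    (n ^ ((1 : ℝ) / 3) * a) ^ (-(3 : ℝ) / 4) = (n * a ^ 3) ^ (-(1 : ℝ) / 4) := by
  have h1 : (n ^ ((1 : ℝ) / 3) * a) ^ 3 = n * a ^ 3 := by
    rw [mul_pow, ← rpow_natCast, ← rpow_mul hn.le]
    norm_num
  rw [← h1, ← rpow_natCast, ← rpow_mul (by positivity)]
  norm_num

lemma exists_pos_eventually_le {x : ℕ → ℝ}
    (hc : (∃ c : ℝ, 0 < c ∧ Tendsto x atTop (nhds c)) ∨ Tendsto x atTop atTop) :
    ∃ c₀ : ℝ, 0 < c₀ ∧ ∀ᶠ N in atTop, c₀ ≤ x N := by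
  rcases hc with ⟨c, hc0, hc⟩ | hc
  · exact ⟨c / 2, by positivity, hc.eventually_const_le (by linarith)⟩
  · exact ⟨1, one_pos, hc.eventually_ge_atTop 1⟩

lemma eventually_one_le_nuSK {β : ℕ → ℝ} (hβmem : ∀ N, β N ∈ Set.Ioo (0 : ℝ) 1)
    (hβlim : Tendsto β atTop (nhds 1)) : ∀ᶠ N in atTop, 1 ≤ nuSK (β N) := by
  have h1 : Tendsto (fun N => 1 - β N ^ 2) atTop (nhdsWithin 0 (Set.Ioi 0)) := by
    refine tendsto_nhdsWithin_iff.2 ⟨?_, Eventually.of_forall fun N => ?_⟩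
    · simpa using (hβlim.pow 2).const_sub 1
    · have := hβmem N
      simp only [Set.mem_Ioi]
      nlinarith [this.1, this.2]
  filter_upwards [(tendsto_log_nhdsGT_zero.comp h1).eventually_le_atBot (-3)] with N hN
  have := hβmem N
  have h2 : β N ^ 2 ≤ 1 := by nlinarith [this.1, this.2]
  simp only [Function.comp] at hN
  unfold nuSK
  linarith

end NearCritical

/-- Gaussian CLT in total variation for the centered, scaled SK free
energy near the critical temperature. -/
theorem sk_clt_near_critical
    (β : ℕ → ℝ) (hβmem : ∀ N, β N ∈ Set.Ioo (0 : ℝ) 1)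
    (hβlim : Tendsto β atTop (nhds 1))
    (hc : (∃ c : ℝ, 0 < c ∧
        Tendsto (fun N : ℕ => (N : ℝ) ^ ((1 : ℝ) / 3) * (1 - β N ^ 2)) atTop (nhds c)) ∨
      Tendsto (fun N : ℕ => (N : ℝ) ^ ((1 : ℝ) / 3) * (1 - β N ^ 2)) atTop atTop) :
    ∃ L : ℝ, ∀ N : ℕ, 1 ≤ N → ∀ A : Set ℝ, MeasurableSet A →
      |((gaussPi N) ((fun g => (freeEnergy N (β N) g -
            ∫ g', freeEnergy N (β N) g' ∂gaussPi N) / Real.sqrt (nuSK (β N))) ⁻¹' A)).toReal -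
          ((gaussianReal 0 1) A).toReal| ≤
        L / Real.sqrt (nuSK (β N)) *
          ((N : ℝ) ^ ((1 : ℝ) / 3) * (1 - β N ^ 2)) ^ (-(3 : ℝ) / 4) := by
  obtain ⟨c₀, hc₀, hev⟩ := exists_pos_eventually_le hc
  have hc3 : 0 < c₀ ^ 3 := by positivity
  obtain ⟨N₀, hN₀⟩ := eventually_atTop.1
    (hev.and ((eventually_one_le_nuSK hβmem hβlim).and (eventually_skMom_le hc3)))
  set R : ℕ → ℝ := fun N => ((N : ℝ) ^ ((1 : ℝ) / 3) * (1 - β N ^ 2)) ^ (-(3 : ℝ) / 4) with hR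
  have ha : ∀ N, 0 < 1 - β N ^ 2 := fun N => by
    have := hβmem N
    nlinarith [this.1, this.2]
  have hR0 : ∀ N, 0 ≤ R N := fun N =>
    rpow_nonneg (mul_nonneg (by positivity) (ha N).le) _
  have hν : ∀ N, 0 < √(nuSK (β N)) := fun N => sqrt_pos.2 (nuSK_pos (hβmem N).1 (hβmem N).2)
  set K := 8 * √(cavityK cplC (1 / √(c₀ ^ 3))) with hK
  have hK0 : 0 ≤ K := by positivity
  have hS : ∀ N, 0 ≤ √(nuSK (β N)) / R N := fun N => div_nonneg (sqrt_nonneg _) (hR0 N)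
  refine ⟨K + ∑ N ∈ range N₀, √(nuSK (β N)) / R N, fun N hN A hA => ?_⟩
  have hN0 : (0 : ℝ) < N := by exact_mod_cast hN
  change _ ≤ _ * R N
  rcases le_or_gt N₀ N with h | h
  · obtain ⟨h1, h2, h3⟩ := hN₀ N h
    have h4 : c₀ ^ 3 ≤ N * (1 - β N ^ 2) ^ 3 := by
      have h5 : ((N : ℝ) ^ ((1 : ℝ) / 3) * (1 - β N ^ 2)) ^ 3 = N * (1 - β N ^ 2) ^ 3 := by
        rw [mul_pow, ← rpow_natCast, ← rpow_mul hN0.le]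
        norm_num
      rw [← h5]
      exact pow_le_pow_left₀ hc₀.le h1 3
    refine (abs_measureReal_freeEnergy_sub_le hc3 hN (hβmem N).1 (hβmem N).2 h4
      (h3 _ (hβmem N).1 (hβmem N).2 h4) hA).trans ?_
    rw [← rpow_near_critical hN0 (ha N)]
    refine mul_le_mul_of_nonneg_right ?_ (hR0 N)
    have h6 : √(nuSK (β N)) ≤ nuSK (β N) := by
      rw [sqrt_le_left (by linarith)]
      nlinarith
    calc K / nuSK (β N) ≤ K / √(nuSK (β N)) := div_le_div_of_nonneg_left hK0 (hν N) h6
      _ ≤ _ := by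
        refine div_le_div_of_nonneg_right ?_ (hν N).le
        exact le_add_of_nonneg_right (sum_nonneg fun N _ => hS N)
  · have hRN : 0 < R N := rpow_pos_of_pos (mul_pos (by positivity) (ha N)) _
    have h1 : √(nuSK (β N)) / R N ≤ K + ∑ N ∈ range N₀, √(nuSK (β N)) / R N :=
      (single_le_sum (f := fun N => √(nuSK (β N)) / R N) (fun N _ => hS N)
        (mem_range.2 h)).trans (le_add_of_nonneg_left hK0)
    have h2 : 1 ≤ (K + ∑ N ∈ range N₀, √(nuSK (β N)) / R N) / √(nuSK (β N)) * R N := by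
      rw [div_le_iff₀ hRN] at h1
      rw [div_mul_eq_mul_div, one_le_div (hν N)]
      exact h1
    refine le_trans ?_ h2
    exact abs_sub_le_of_nonneg_of_le measureReal_nonneg measureReal_le_one
      measureReal_nonneg measureReal_le_one

end
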